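/- Let f_0 be a C^∞ diffeomorphism of [0,∞) with f_0(0) = 0 and 0 < f_0(x) < x for all x > 0 (a smooth contracting diffeomorphism). Assume there is a complete C^∞ vector field ξ_0 on [0,∞), vanishing only at 0, with sup(|ξ_0| + |Dξ_0|) < ∞, whose time-1 flow is f_0 and whose flow { f_0^t : t ∈ ℝ } equals the C^1-centralizer Z^1_{f_0} (so ξ_0 is the Szekeres vector field of f_0, smooth and C^1-bounded). Assume moreover the oscillation condition: limsup_{x→0⁺} ( sup_{0<y≤x} |log(x − f_0(x))| / |log(y − f_0(y))| ) = +∞. Then for every integer k ≥ 0 and every ε > 0 there exists a C^∞ diffeomorphism f of [0,∞) such that |D^m(f − f_0)(x)| ≤ ε·|D^m(f_0 − id)(x)| for all 0 ≤ m ≤ k and all x ∈ [0,∞), and such that the centralizer Z^∞_f is a proper, dense and uncountable subgroup of the one-parameter group Z^1_f; that is, there is a complete C^1 vector field ξ vanishing only at 0 whose flow { f^t } equals Z^1_f, with f^1 = f, and the set { t ∈ ℝ : f^t is a C^∞ diffeomorphism of [0,∞) } is a proper, dense and uncountable additive subgroup of ℝ. -/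

import Mathlib

open Set Filter Topology

/-- `f` is a diffeomorphism of the half-line `[0,∞)`: it fixes `0`, maps `[0,∞)` bijectively
onto itself, is differentiable (in the sense of `[0,∞)`) with everywhere positive derivative,
and its inverse is differentiable. -/
def HalfLineDiffeo (f : ℝ → ℝ) : Prop :=
  f 0 = 0 ∧ Set.BijOn f (Set.Ici 0) (Set.Ici 0) ∧
    (∀ x ∈ Set.Ici (0 : ℝ), ∃ d : ℝ, 0 < d ∧ HasDerivWithinAt f d (Set.Ici 0) x) ∧
    (∀ y ∈ Set.Ici (0 : ℝ), ∃ d : ℝ,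
      HasDerivWithinAt (Function.invFunOn f (Set.Ici 0)) d (Set.Ici 0) y)

/-- `f` is a `C^r` diffeomorphism of `[0,∞)`. -/
def CrHalfLineDiffeo (r : ℕ∞) (f : ℝ → ℝ) : Prop :=
  HalfLineDiffeo f ∧ ContDiffOn ℝ r f (Set.Ici 0)

/-- The `C^r` centralizer of `f` : all `C^r` diffeomorphisms of `[0,∞)` commuting with `f`. -/
def Centralizer (r : ℕ∞) (f : ℝ → ℝ) : Set (ℝ → ℝ) :=
  {g | CrHalfLineDiffeo r g ∧ ∀ x ∈ Set.Ici (0 : ℝ), g (f x) = f (g x)}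

/-- `F` is the (complete, globally defined) flow of the vector field `ξ` on `[0,∞)`:
`F 0 x = x` and `∂ₜ F t x = ξ (F t x)` for all `t ∈ ℝ` and `x ∈ [0,∞)`. -/
def IsFlowOf (ξ : ℝ → ℝ) (F : ℝ → ℝ → ℝ) : Prop :=
  ∀ x ∈ Set.Ici (0 : ℝ), F 0 x = x ∧
    ∀ t : ℝ, F t x ∈ Set.Ici (0 : ℝ) ∧ HasDerivAt (fun s => F s x) (ξ (F t x)) t

namespace HalfLine

open Asymptotics
open scoped ContDiff

/-- `X` is an integral curve of `ξ` parametrizing `(0,∞)` by the whole time line, with inverse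
`T`; the vector field `ξ` is smooth on `[0,∞)`, negative on `(0,∞)` and `|ξ'| ≤ C`. -/
structure TimeChart (ξ X T : ℝ → ℝ) (C : ℝ) : Prop where
  smooth : ContDiffOn ℝ ∞ ξ (Ici 0)
  zero : ξ 0 = 0
  neg : ∀ x, 0 < x → ξ x < 0
  bound : ∀ x, 0 < x → |deriv ξ x| ≤ C
  pos : ∀ t, 0 < X t
  hasDerivAt : ∀ t, HasDerivAt X (ξ (X t)) t
  hasDerivAt_time : ∀ x, 0 < x → HasDerivAt T (ξ x)⁻¹ x
  left_inv : ∀ t, T (X t) = t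
  right_inv : ∀ x, 0 < x → X (T x) = x

theorem diffeo_pos {g : ℝ → ℝ} (hg : HalfLineDiffeo g) {x : ℝ} (hx : 0 < x) :
    0 < g x := by
  obtain ⟨h0, hb, -⟩ := hg
  have h1 : 0 ≤ g x := hb.mapsTo hx.le
  rcases h1.lt_or_eq with h | h
  · exact h
  · have := hb.injOn (mem_Ici.2 le_rfl) (mem_Ici.2 hx.le) (h0.trans h)
    exact absurd this hx.ne

theorem exists_timeChart {f₀ ξ₀ : ℝ → ℝ} {F₀ : ℝ → ℝ → ℝ}
    (hcontr : ∀ x : ℝ, 0 < x → 0 < f₀ x ∧ f₀ x < x)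
    (hsm : ContDiffOn ℝ ∞ ξ₀ (Ici 0)) (h0 : ξ₀ 0 = 0) (hne : ∀ x : ℝ, 0 < x → ξ₀ x ≠ 0)
    (hbdd : ∃ C : ℝ, ∀ x ∈ Ici (0 : ℝ), |ξ₀ x| + |derivWithin ξ₀ (Ici 0) x| ≤ C)
    (hF₀ : IsFlowOf ξ₀ F₀) (hF₀1 : ∀ x ∈ Ici (0 : ℝ), F₀ 1 x = f₀ x)
    (hdiff : ∀ t, HalfLineDiffeo (F₀ t)) :
    ∃ (X T : ℝ → ℝ) (C : ℝ), TimeChart ξ₀ X T C ∧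
      ∀ t x, 0 < x → F₀ t x = X (T x + t) := by
  have hpos : ∀ t x, 0 < x → 0 < F₀ t x := fun t x hx => diffeo_pos (hdiff t) hx
  have hcont : ContinuousOn ξ₀ (Ioi 0) := hsm.continuousOn.mono Ioi_subset_Ici_self
  have hneg : ∀ x, 0 < x → ξ₀ x < 0 := by
    by_contra! hcon
    obtain ⟨x₁, hx₁, hx₁'⟩ := hcon
    have hall : ∀ x, 0 < x → 0 < ξ₀ x := by
      intro x hx
      by_contra! hle
      obtain ⟨y, hy, hy0⟩ := isPreconnected_Ioi.intermediate_value (mem_Ioi.2 hx)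
        (mem_Ioi.2 hx₁) hcont ⟨hle, hx₁'⟩
      exact hne y hy hy0
    have hmono : StrictMono fun s => F₀ s 1 := by
      apply strictMono_of_deriv_pos
      intro s
      rw [((hF₀ 1 (by simp)).2 s).2.deriv]
      exact hall _ (hpos _ _ one_pos)
    have h1 := hmono (zero_lt_one)
    simp only [(hF₀ 1 (by simp)).1, hF₀1 1 (by simp)] at h1
    exact absurd h1 (not_lt.2 (hcontr 1 one_pos).2.le)
  set T : ℝ → ℝ := fun x => ∫ y in (1 : ℝ)..x, (ξ₀ y)⁻¹ with hT
  have hcinv : ContinuousOn (fun y => (ξ₀ y)⁻¹) (Ioi 0) :=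
    hcont.inv₀ fun y hy => hne y hy
  have hTd : ∀ x, 0 < x → HasDerivAt T (ξ₀ x)⁻¹ x := by
    intro x hx
    apply intervalIntegral.integral_hasDerivAt_right
    · apply ContinuousOn.intervalIntegrable
      apply hcinv.mono
      intro y hy
      rcases le_total 1 x with h | h
      · rw [uIcc_of_le h] at hy; exact lt_of_lt_of_le one_pos hy.1
      · rw [uIcc_of_ge h] at hy; exact lt_of_lt_of_le hx hy.1
    · exact hcinv.stronglyMeasurableAtFilter isOpen_Ioi x hx
    · exact hcinv.continuousAt (Ioi_mem_nhds hx)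
  have hTF : ∀ t x, 0 < x → T (F₀ t x) = T x + t := by
    intro t x hx
    have hd : ∀ s, HasDerivAt (fun s => T (F₀ s x) - s) 0 s := by
      intro s
      have h1 := (hTd _ (hpos s x hx)).comp s ((hF₀ x hx.le).2 s).2
      rw [inv_mul_cancel₀ (hne _ (hpos s x hx))] at h1
      have h2 := h1.sub (hasDerivAt_id s)
      rw [sub_self] at h2
      exact h2
    have := is_const_of_deriv_eq_zero (fun s => (hd s).differentiableAt) (fun s => (hd s).deriv)
      t 0
    simp only [(hF₀ x hx.le).1] at this
    linarith
  have hTanti : StrictAntiOn T (Ioi 0) := by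
    apply strictAntiOn_of_deriv_neg (convex_Ioi 0)
    · exact fun x hx => (hTd x hx).continuousAt.continuousWithinAt
    · intro x hx
      rw [interior_Ioi] at hx
      rw [(hTd x hx).deriv]
      exact inv_lt_zero.2 (hneg x hx)
  have hT1 : T 1 = 0 := by simp [hT]
  obtain ⟨C, hC⟩ := hbdd
  refine ⟨fun t => F₀ t 1, T, C, ⟨hsm, h0, hneg, ?_, fun t => hpos t 1 one_pos, fun t =>
    ((hF₀ 1 (by simp)).2 t).2, hTd, fun t => ?_, fun x hx => ?_⟩, fun t x hx => ?_⟩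
  · intro x hx
    have h1 := hC x hx.le
    rw [derivWithin_of_mem_nhds (Ici_mem_nhds hx)] at h1
    have := abs_nonneg (ξ₀ x)
    linarith
  · rw [hTF t 1 one_pos, hT1, zero_add]
  · apply hTanti.injOn (hpos _ _ one_pos) hx
    rw [hTF _ 1 one_pos, hT1, zero_add]
  · apply hTanti.injOn (hpos _ _ hx) (hpos _ _ one_pos)
    rw [hTF _ 1 one_pos, hT1, zero_add, hTF _ _ hx]

namespace TimeChart

variable {ξ X T : ℝ → ℝ} {C : ℝ} (h : TimeChart ξ X T C)
include h

theorem strictAnti : StrictAnti X := by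
  apply strictAnti_of_deriv_neg
  intro t
  rw [(h.hasDerivAt t).deriv]
  exact h.neg _ (h.pos t)

theorem continuous : Continuous X :=
  continuous_iff_continuousAt.2 fun t => (h.hasDerivAt t).continuousAt

theorem C_nonneg : 0 ≤ C := (abs_nonneg _).trans (h.bound 1 one_pos)

theorem lt_time {x t : ℝ} (hx : 0 < x) (hxt : x < X t) : t < T x := by
  rw [← h.strictAnti.lt_iff_gt, h.right_inv x hx]
  exact hxt

theorem tendsto_time : Tendsto T (𝓝[>] 0) atTop := by
  refine tendsto_atTop.2 fun t => ?_
  filter_upwards [Ioo_mem_nhdsGT (h.pos t)] with x hx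
  exact (h.lt_time hx.1 hx.2).le

theorem tendsto_zero : Tendsto X atTop (𝓝[>] 0) := by
  refine tendsto_nhdsWithin_iff.2 ⟨?_, Eventually.of_forall h.pos⟩
  refine tendsto_order.2 ⟨fun a ha => Eventually.of_forall fun t => ha.trans (h.pos t),
    fun a ha => ?_⟩
  filter_upwards [eventually_gt_atTop (T a)] with t ht
  have := h.strictAnti ht
  rwa [h.right_inv a ha] at this

theorem smoothOn_Ioi : ContDiffOn ℝ ∞ ξ (Ioi 0) := h.smooth.mono Ioi_subset_Ici_self

theorem contDiff : ContDiff ℝ ∞ X := by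
  rw [contDiff_infty]
  intro n
  induction n with
  | zero => exact contDiff_zero.2 h.continuous
  | succ n ih =>
    have : ((n + 1 : ℕ) : WithTop ℕ∞) = (n : WithTop ℕ∞) + 1 := by push_cast; rfl
    rw [this, contDiff_succ_iff_deriv]
    refine ⟨fun t => (h.hasDerivAt t).differentiableAt, by simp, ?_⟩
    have h1 : deriv X = ξ ∘ X := funext fun t => (h.hasDerivAt t).deriv
    rw [h1]
    exact (h.smoothOn_Ioi.of_le (by exact_mod_cast le_top)).comp_contDiff ih fun t => h.pos t

theorem contDiffOn_time : ContDiffOn ℝ ∞ T (Ioi 0) := by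
  rw [contDiffOn_infty_iff_deriv_of_isOpen isOpen_Ioi]
  refine ⟨fun x hx => (h.hasDerivAt_time x hx).differentiableAt.differentiableWithinAt, ?_⟩
  apply (h.smoothOn_Ioi.inv fun x hx => (h.neg x hx).ne).congr
  intro x hx
  exact (h.hasDerivAt_time x hx).deriv

/-- The speed `ω(t) = -ξ(X t)` of the chart. -/
theorem hasDerivAt_speed (t : ℝ) :
    HasDerivAt (fun s => -ξ (X s)) (deriv ξ (X t) * -ξ (X t)) t := by
  have h1 : HasDerivAt ξ (deriv ξ (X t)) (X t) :=
    ((h.smoothOn_Ioi.differentiableOn (by simp)).differentiableAt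
      (Ioi_mem_nhds (h.pos t))).hasDerivAt
  have h2 := (h1.comp t (h.hasDerivAt t)).neg
  rw [← mul_neg] at h2
  exact h2

theorem speed_pos (t : ℝ) : 0 < -ξ (X t) := neg_pos.2 (h.neg _ (h.pos t))

theorem speed_le (s t : ℝ) : -ξ (X s) ≤ Real.exp (C * |s - t|) * -ξ (X t) := by
  have hd : ∀ u, HasDerivAt (fun s => Real.log (-ξ (X s))) (deriv ξ (X u)) u := by
    intro u
    have := (h.hasDerivAt_speed u).log (h.speed_pos u).ne'
    rwa [mul_div_cancel_right₀ _ (h.speed_pos u).ne'] at this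
  have h1 := (convex_univ (𝕜 := ℝ) (E := ℝ)).norm_image_sub_le_of_norm_deriv_le
    (f := fun s => Real.log (-ξ (X s))) (C := C) (x := t) (y := s)
    (fun u _ => (hd u).differentiableAt)
    (fun u _ => by rw [(hd u).deriv]; exact h.bound _ (h.pos u)) (mem_univ _) (mem_univ _)
  simp only [Real.norm_eq_abs] at h1
  have h2 := (abs_le.1 h1).2
  rw [← Real.log_le_log_iff (h.speed_pos s) (mul_pos (Real.exp_pos _) (h.speed_pos t)),
    Real.log_mul (Real.exp_pos _).ne' (h.speed_pos t).ne', Real.log_exp]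
  linarith

theorem tendsto_speed : Tendsto (fun t => -ξ (X t)) atTop (𝓝 0) := by
  have h1 : Tendsto ξ (𝓝[≥] 0) (𝓝 (ξ 0)) := h.smooth.continuousOn 0 (by simp)
  rw [h.zero] at h1
  have := (h1.mono_left (nhdsWithin_mono 0 Ioi_subset_Ici_self)).comp h.tendsto_zero
  simpa using this.neg

end TimeChart

theorem contDiff_deriv {u : ℝ → ℝ} (hu : ContDiff ℝ ∞ u) : ContDiff ℝ ∞ (deriv u) :=
  (contDiff_infty_iff_deriv.1 hu).2

theorem differentiable_of_smooth {u : ℝ → ℝ} (hu : ContDiff ℝ ∞ u) : Differentiable ℝ u :=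
  (contDiff_infty_iff_deriv.1 hu).1

/-- The derivatives of `u` of order at most `m` are `O(w)` at `+∞`. -/
def DerivO (m : ℕ) (w u : ℝ → ℝ) : Prop := ∀ i ≤ m, iteratedDeriv i u =O[atTop] w

theorem derivO_zero {w u : ℝ → ℝ} : DerivO 0 w u ↔ u =O[atTop] w := by
  simp [DerivO]

theorem derivO_succ {m : ℕ} {w u : ℝ → ℝ} :
    DerivO (m + 1) w u ↔ u =O[atTop] w ∧ DerivO m w (deriv u) := by
  constructor
  · intro h
    refine ⟨by simpa using h 0 (by omega), fun i hi => ?_⟩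
    rw [← iteratedDeriv_succ']
    exact h (i + 1) (by omega)
  · rintro ⟨h0, h1⟩ i hi
    cases i with
    | zero => simpa using h0
    | succ i =>
      rw [iteratedDeriv_succ']
      exact h1 i (by omega)

theorem DerivO.isBigO {m : ℕ} {w u : ℝ → ℝ} (h : DerivO m w u) : u =O[atTop] w := by
  simpa using h 0 (Nat.zero_le _)

theorem DerivO.mono {m n : ℕ} {w u : ℝ → ℝ} (h : DerivO m w u) (hn : n ≤ m) : DerivO n w u :=
  fun i hi => h i (hi.trans hn)

theorem DerivO.trans {m : ℕ} {w w' u : ℝ → ℝ} (h : DerivO m w u) (hw : w =O[atTop] w') :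
    DerivO m w' u :=
  fun i hi => (h i hi).trans hw

theorem DerivO.add {m : ℕ} {w u v : ℝ → ℝ} (hu : ContDiff ℝ ∞ u) (hv : ContDiff ℝ ∞ v)
    (h : DerivO m w u) (h' : DerivO m w v) : DerivO m w (fun t => u t + v t) := by
  induction m generalizing u v with
  | zero => exact derivO_zero.2 (h.isBigO.add h'.isBigO)
  | succ m ih =>
    refine derivO_succ.2 ⟨h.isBigO.add h'.isBigO, ?_⟩
    have : deriv (fun t => u t + v t) = fun t => deriv u t + deriv v t := by
      funext t
      exact deriv_fun_add (differentiable_of_smooth hu t) (differentiable_of_smooth hv t)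
    rw [this]
    exact ih (contDiff_deriv hu) (contDiff_deriv hv) (derivO_succ.1 h).2 (derivO_succ.1 h').2

theorem DerivO.mul {m : ℕ} {w w' u v : ℝ → ℝ} (hu : ContDiff ℝ ∞ u) (hv : ContDiff ℝ ∞ v)
    (h : DerivO m w u) (h' : DerivO m w' v) :
    DerivO m (fun t => w t * w' t) (fun t => u t * v t) := by
  induction m generalizing u v with
  | zero => exact derivO_zero.2 (h.isBigO.mul h'.isBigO)
  | succ m ih =>
    refine derivO_succ.2 ⟨h.isBigO.mul h'.isBigO, ?_⟩
    have : deriv (fun t => u t * v t) = fun t => deriv u t * v t + u t * deriv v t := by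
      funext t
      exact deriv_fun_mul (differentiable_of_smooth hu t) (differentiable_of_smooth hv t)
    rw [this]
    exact ((ih (contDiff_deriv hu) hv (derivO_succ.1 h).2 (h'.mono m.le_succ)).add
      ((contDiff_deriv hu).mul hv) (hu.mul (contDiff_deriv hv))
      (ih hu (contDiff_deriv hv) (h.mono m.le_succ) (derivO_succ.1 h').2))

/-- Smooth functions all of whose derivatives are bounded at `+∞`. -/
structure Tame (u : ℝ → ℝ) : Prop where
  smooth : ContDiff ℝ ∞ u
  derivO : ∀ m, DerivO m (fun _ => 1) u

namespace Tame

theorem deriv {u : ℝ → ℝ} (h : Tame u) : Tame (deriv u) :=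
  ⟨contDiff_deriv h.smooth, fun m => (derivO_succ.1 (h.derivO (m + 1))).2⟩

theorem iteratedDeriv {u : ℝ → ℝ} (h : Tame u) (i : ℕ) : Tame (iteratedDeriv i u) := by
  induction i with
  | zero => simpa using h
  | succ i ih => rw [iteratedDeriv_succ]; exact ih.deriv

theorem const (c : ℝ) : Tame fun _ => c := by
  refine ⟨contDiff_const, fun m => ?_⟩
  induction m generalizing c with
  | zero => exact derivO_zero.2 (isBigO_const_const _ one_ne_zero _)
  | succ m ih =>
    refine derivO_succ.2 ⟨isBigO_const_const _ one_ne_zero _, ?_⟩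
    simpa using ih 0

theorem add {u v : ℝ → ℝ} (hu : Tame u) (hv : Tame v) : Tame fun t => u t + v t :=
  ⟨hu.smooth.add hv.smooth, fun m => (hu.derivO m).add hu.smooth hv.smooth (hv.derivO m)⟩

theorem mul {u v : ℝ → ℝ} (hu : Tame u) (hv : Tame v) : Tame fun t => u t * v t :=
  ⟨hu.smooth.mul hv.smooth, fun m => by
    simpa using (hu.derivO m).mul hu.smooth hv.smooth (hv.derivO m)⟩

theorem sub {u v : ℝ → ℝ} (hu : Tame u) (hv : Tame v) : Tame fun t => u t - v t := by
  simpa [sub_eq_add_neg] using hu.add ((const (-1)).mul hv)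

theorem sum {ι : Type*} {s : Finset ι} {u : ι → ℝ → ℝ} (hu : ∀ i ∈ s, Tame (u i)) :
    Tame fun t => ∑ i ∈ s, u i t := by
  classical
  induction s using Finset.induction_on with
  | empty => simpa using const 0
  | insert a s ha ih =>
    simp only [Finset.sum_insert ha]
    exact (hu a (by simp)).add (ih fun i hi => hu i (by simp [hi]))

theorem inv {u : ℝ → ℝ} (hu : Tame u) {δ : ℝ} (hδ : 0 < δ) (hlow : ∀ t, δ ≤ u t) :
    Tame fun t => (u t)⁻¹ := by
  have hpos : ∀ t, 0 < u t := fun t => hδ.trans_le (hlow t)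
  have hsm : ContDiff ℝ ∞ fun t => (u t)⁻¹ := hu.smooth.inv fun t => (hpos t).ne'
  have h0 : (fun t => (u t)⁻¹) =O[atTop] fun _ => (1 : ℝ) := by
    refine IsBigO.of_bound δ⁻¹ (Eventually.of_forall fun t => ?_)
    rw [Real.norm_of_nonneg (inv_nonneg.2 (hpos t).le)]
    simpa using inv_anti₀ hδ (hlow t)
  refine ⟨hsm, fun m => ?_⟩
  induction m with
  | zero => exact derivO_zero.2 h0
  | succ m ih =>
    refine derivO_succ.2 ⟨h0, ?_⟩
    have : _root_.deriv (fun t => (u t)⁻¹)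
        = fun t => (-1 * _root_.deriv u t) * ((u t)⁻¹ * (u t)⁻¹) := by
      funext t
      rw [deriv_fun_inv'' (differentiable_of_smooth hu.smooth t) (hpos t).ne']
      field_simp
    rw [this]
    simpa using (((const (-1)).mul hu.deriv).derivO m).mul ((const (-1)).mul hu.deriv).smooth
      (hsm.mul hsm) (ih.mul hsm hsm ih)

theorem derivO_comp {φ H : ℝ → ℝ} (hφ : Tame φ) (hH : ContDiff ℝ ∞ H)
    (hHt : Tendsto H atTop atTop) {m : ℕ} (hH' : ∀ n < m, DerivO n (fun _ => 1) (_root_.deriv H)) :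
    DerivO m (fun _ => 1) fun t => φ (H t) := by
  have h0 : ∀ ψ : ℝ → ℝ, Tame ψ → (fun t => ψ (H t)) =O[atTop] fun _ => (1 : ℝ) :=
    fun ψ hψ => (hψ.derivO 0).isBigO.comp_tendsto hHt
  induction m generalizing φ with
  | zero => exact derivO_zero.2 (h0 φ hφ)
  | succ m ih =>
    refine derivO_succ.2 ⟨h0 φ hφ, ?_⟩
    have : _root_.deriv (fun t => φ (H t))
        = fun t => (_root_.deriv φ (H t)) * _root_.deriv H t := by
      funext t
      exact deriv_comp t (differentiable_of_smooth hφ.smooth _) (differentiable_of_smooth hH t)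
    rw [this]
    simpa using (ih hφ.deriv fun n hn => hH' n (by omega)).mul (hφ.deriv.smooth.comp hH)
      (contDiff_deriv hH) (hH' m (by omega))

theorem comp {φ H : ℝ → ℝ} (hφ : Tame φ) (hH : ContDiff ℝ ∞ H)
    (hHt : Tendsto H atTop atTop) (hH' : Tame (_root_.deriv H)) : Tame fun t => φ (H t) :=
  ⟨hφ.smooth.comp hH, fun _ => hφ.derivO_comp hH hHt fun n _ => hH'.derivO n⟩

/-- If `G ∘ H - G` has zero derivative with `G' ≥ δ > 0` and `G'` tame, then `H'` is tame. -/
theorem of_conj {G H : ℝ → ℝ} (hG : ContDiff ℝ ∞ G) (hG' : Tame (_root_.deriv G))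
    {δ : ℝ} (hδ : 0 < δ) (hlow : ∀ t, δ ≤ _root_.deriv G t) (hH : ContDiff ℝ ∞ H)
    (hHt : Tendsto H atTop atTop) {τ : ℝ} (hconj : ∀ t, G (H t) = G t + τ) :
    Tame (_root_.deriv H) := by
  have hi := hG'.inv hδ hlow
  have hd : _root_.deriv H = fun t => (_root_.deriv G (H t))⁻¹ * _root_.deriv G t := by
    funext t
    have h1 : HasDerivAt (fun t => G (H t)) (_root_.deriv G (H t) * _root_.deriv H t) t :=
      (differentiable_of_smooth hG (H t)).hasDerivAt.comp t
        (differentiable_of_smooth hH t).hasDerivAt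
    have h2 : HasDerivAt (fun t => G (H t)) (_root_.deriv G t) t := by
      have : (fun t => G (H t)) = fun t => G t + τ := funext hconj
      rw [this]
      exact (differentiable_of_smooth hG t).hasDerivAt.add_const τ
    rw [← h1.unique h2, inv_mul_cancel_left₀ (hδ.trans_le (hlow _)).ne']
  have key : ∀ m, ∀ n < m, DerivO n (fun _ => 1) (_root_.deriv H) := by
    intro m
    induction m with
    | zero => intro n hn; omega
    | succ m ih =>
      intro n hn
      have : DerivO m (fun _ => 1) (_root_.deriv H) := by
        rw [hd]
        simpa using (hi.derivO_comp hH hHt ih).mul (hi.smooth.comp hH) hG'.smooth (hG'.derivO m)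
      exact this.mono (by omega)
  exact ⟨contDiff_deriv hH, fun m => key (m + 1) m (by omega)⟩

end Tame

section Boundary

/-- A function which is smooth on `(0,∞)` and flat at `0` up to order `m` is `C^m` on `[0,∞)`. -/
theorem contDiffOn_Ici_of_flat {g : ℝ → ℝ} {m : ℕ} (hg : ContDiffOn ℝ ∞ g (Ioi 0))
    (hg0 : g 0 = 0) (hlim : ∀ i ≤ m, Tendsto (iteratedDeriv i g) (𝓝[>] 0) (𝓝 0)) :
    ContDiffOn ℝ m g (Ici 0) := by
  induction m generalizing g with
  | zero =>
    refine contDiffOn_zero.2 fun x hx => ?_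
    rcases (mem_Ici.1 hx).eq_or_lt with rfl | hx
    · rw [← Ioi_insert, continuousWithinAt_insert_self]
      have := hlim 0 le_rfl
      rw [iteratedDeriv_zero] at this
      rwa [ContinuousWithinAt, hg0]
    · exact (hg.continuousOn.continuousAt (Ioi_mem_nhds hx)).continuousWithinAt
  | succ m ih =>
    have hc : ContinuousWithinAt g (Ioi 0) 0 := by
      have := hlim 0 (Nat.zero_le _)
      rw [iteratedDeriv_zero] at this
      rwa [ContinuousWithinAt, hg0]
    have hdiff : DifferentiableOn ℝ g (Ioi 0) := hg.differentiableOn (by simp)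
    have hd0 : HasDerivWithinAt g 0 (Ici 0) 0 :=
      hasDerivWithinAt_Ici_of_tendsto_deriv hdiff hc self_mem_nhdsWithin
        (by simpa using hlim 1 (by omega))
    have hW0 : derivWithin g (Ici 0) 0 = 0 := hd0.derivWithin (uniqueDiffOn_Ici 0 0 (by simp))
    have hW : ∀ x, 0 < x → derivWithin g (Ici 0) x = deriv g x := fun x hx =>
      derivWithin_of_mem_nhds (Ici_mem_nhds hx)
    have hsucc : ((m + 1 : ℕ) : WithTop ℕ∞) = (m : WithTop ℕ∞) + 1 := by push_cast; rfl
    rw [hsucc, contDiffOn_succ_iff_derivWithin (uniqueDiffOn_Ici 0)]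
    refine ⟨fun x hx => ?_, by simp, ih ?_ hW0 fun i hi => ?_⟩
    · rcases (mem_Ici.1 hx).eq_or_lt with rfl | hx
      · exact hd0.differentiableWithinAt
      · exact (hdiff.differentiableAt (Ioi_mem_nhds hx)).differentiableWithinAt
    · exact ((contDiffOn_infty_iff_deriv_of_isOpen isOpen_Ioi).1 hg).2.congr hW
    · refine (hlim (i + 1) (by omega)).congr' ?_
      filter_upwards [self_mem_nhdsWithin] with x hx
      rw [iteratedDeriv_succ']
      apply Filter.EventuallyEq.iteratedDeriv_eq
      filter_upwards [Ioi_mem_nhds hx] with y hy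
      exact (hW y hy).symm

end Boundary

theorem contDiffOn_derivWithin {φ : ℝ → ℝ} (hφ : ContDiffOn ℝ ∞ φ (Ici 0)) :
    ContDiffOn ℝ ∞ (derivWithin φ (Ici 0)) (Ici 0) :=
  ((contDiffOn_infty_iff_derivWithin (uniqueDiffOn_Ici 0)).1 hφ).2

theorem derivWithin_eq_deriv {φ : ℝ → ℝ} {x : ℝ} (hx : 0 < x) :
    derivWithin φ (Ici 0) x = deriv φ x :=
  derivWithin_of_mem_nhds (Ici_mem_nhds hx)

theorem hasDerivAt_of_smoothOn {φ : ℝ → ℝ} (hφ : ContDiffOn ℝ ∞ φ (Ici 0)) {x : ℝ} (hx : 0 < x) :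
    HasDerivAt φ (derivWithin φ (Ici 0) x) x := by
  rw [derivWithin_eq_deriv hx]
  exact ((hφ.differentiableOn (by simp) x hx.le).differentiableAt (Ici_mem_nhds hx)).hasDerivAt

theorem isBigO_one_of_smoothOn {φ : ℝ → ℝ} (hφ : ContDiffOn ℝ ∞ φ (Ici 0)) :
    φ =O[𝓝[>] 0] fun _ => (1 : ℝ) :=
  ((hφ.continuousOn 0 (mem_Ici.2 le_rfl)).mono Ioi_subset_Ici_self).tendsto.isBigO_one ℝ

theorem iteratedDeriv_congr_Ioi {f g : ℝ → ℝ} (h : ∀ x, 0 < x → f x = g x) (n : ℕ) {x : ℝ}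
    (hx : 0 < x) : iteratedDeriv n f x = iteratedDeriv n g x :=
  Filter.EventuallyEq.iteratedDeriv_eq n (by filter_upwards [Ioi_mem_nhds hx] with y hy using h y hy)

/-- `φ` vanishes to order `n` with respect to the scale `σ` at `0⁺`, losing one order per
derivative. -/
def ScaleO (σ : ℝ → ℝ) (m n : ℕ) (φ : ℝ → ℝ) : Prop :=
  ∀ i ≤ m, iteratedDeriv i φ =O[𝓝[>] 0] fun x => σ x ^ (n - i)

section ScaleO

variable {σ : ℝ → ℝ}

theorem scaleO_zero {n : ℕ} {φ : ℝ → ℝ} :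
    ScaleO σ 0 n φ ↔ φ =O[𝓝[>] 0] fun x => σ x ^ n := by
  simp [ScaleO]

theorem scaleO_succ {m n : ℕ} {φ : ℝ → ℝ} :
    ScaleO σ (m + 1) n φ ↔ φ =O[𝓝[>] 0] (fun x => σ x ^ n) ∧ ScaleO σ m (n - 1) (deriv φ) := by
  constructor
  · intro h
    refine ⟨by simpa using h 0 (by omega), fun i hi => ?_⟩
    rw [← iteratedDeriv_succ', Nat.sub_sub, add_comm 1]
    exact h (i + 1) (by omega)
  · rintro ⟨h0, h1⟩ i hi
    cases i with
    | zero => simpa using h0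
    | succ i =>
      rw [iteratedDeriv_succ', add_comm i 1, ← Nat.sub_sub]
      exact h1 i (by omega)

theorem ScaleO.isBigO {m n : ℕ} {φ : ℝ → ℝ} (h : ScaleO σ m n φ) :
    φ =O[𝓝[>] 0] fun x => σ x ^ n := by
  simpa using h 0 (Nat.zero_le _)

theorem ScaleO.mono {m m' n : ℕ} {φ : ℝ → ℝ} (h : ScaleO σ m n φ) (hm : m' ≤ m) :
    ScaleO σ m' n φ := fun i hi => h i (hi.trans hm)

theorem ScaleO.weaken {m n n' : ℕ} {φ : ℝ → ℝ} (hσ : σ =O[𝓝[>] 0] fun _ => (1 : ℝ))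
    (h : ScaleO σ m n φ) (hn : n' ≤ n) : ScaleO σ m n' φ := fun i hi => by
  refine (h i hi).trans ?_
  have : n - i = (n' - i) + (n - i - (n' - i)) := by omega
  rw [this]
  simpa [pow_add] using (isBigO_refl (fun x => σ x ^ (n' - i)) (𝓝[>] 0)).mul
    (hσ.pow (n - i - (n' - i)))

theorem ScaleO.congr {m n : ℕ} {φ ψ : ℝ → ℝ} (h : ScaleO σ m n φ) (he : ∀ x, 0 < x → φ x = ψ x) :
    ScaleO σ m n ψ := fun i hi => by
  refine (h i hi).congr' ?_ EventuallyEq.rfl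
  filter_upwards [self_mem_nhdsWithin] with x hx
  exact iteratedDeriv_congr_Ioi he i hx

theorem ScaleO.add {m n : ℕ} {φ ψ : ℝ → ℝ} (hφ : ContDiffOn ℝ ∞ φ (Ioi 0))
    (hψ : ContDiffOn ℝ ∞ ψ (Ioi 0)) (h : ScaleO σ m n φ) (h' : ScaleO σ m n ψ) :
    ScaleO σ m n (fun x => φ x + ψ x) := fun i hi => by
  refine ((h i hi).add (h' i hi)).congr' ?_ EventuallyEq.rfl
  filter_upwards [self_mem_nhdsWithin] with x hx
  have h1 : ContDiffAt ℝ i φ x := (hφ.contDiffAt (Ioi_mem_nhds hx)).of_le (by exact_mod_cast le_top)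
  have h2 : ContDiffAt ℝ i ψ x := (hψ.contDiffAt (Ioi_mem_nhds hx)).of_le (by exact_mod_cast le_top)
  exact (iteratedDeriv_add h1 h2).symm

theorem ScaleO.mul {m n n' : ℕ} {φ ψ : ℝ → ℝ} (hσ : σ =O[𝓝[>] 0] fun _ => (1 : ℝ))
    (hφ : ContDiffOn ℝ ∞ φ (Ioi 0)) (hψ : ContDiffOn ℝ ∞ ψ (Ioi 0))
    (h : ScaleO σ m n φ) (h' : ScaleO σ m n' ψ) :
    ScaleO σ m (n + n') (fun x => φ x * ψ x) := by
  induction m generalizing φ ψ n n' with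
  | zero => exact scaleO_zero.2 (by simpa [pow_add] using h.isBigO.mul h'.isBigO)
  | succ m ih =>
    have hφ' := ((contDiffOn_infty_iff_deriv_of_isOpen isOpen_Ioi).1 hφ)
    have hψ' := ((contDiffOn_infty_iff_deriv_of_isOpen isOpen_Ioi).1 hψ)
    refine scaleO_succ.2 ⟨by simpa [pow_add] using h.isBigO.mul h'.isBigO, ?_⟩
    have e1 := (ih hφ'.2 hψ (scaleO_succ.1 h).2 (h'.mono (Nat.le_succ m))).weaken hσ
      (show n + n' - 1 ≤ n - 1 + n' by omega)
    have e2 := (ih hφ hψ'.2 (h.mono (Nat.le_succ m)) (scaleO_succ.1 h').2).weaken hσ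
      (show n + n' - 1 ≤ n + (n' - 1) by omega)
    refine (e1.add (hφ'.2.mul hψ) (hφ.mul hψ'.2) e2).congr fun x hx => ?_
    exact (((hφ'.1 x hx).differentiableAt (Ioi_mem_nhds hx)).hasDerivAt.mul
      ((hψ'.1 x hx).differentiableAt (Ioi_mem_nhds hx)).hasDerivAt).deriv.symm

theorem scaleO_order_zero {m : ℕ} {φ : ℝ → ℝ} (hφ : ContDiffOn ℝ ∞ φ (Ici 0)) :
    ScaleO σ m 0 φ := by
  induction m generalizing φ with
  | zero => exact scaleO_zero.2 (by simpa using isBigO_one_of_smoothOn hφ)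
  | succ m ih =>
    refine scaleO_succ.2 ⟨by simpa using isBigO_one_of_smoothOn hφ, ?_⟩
    exact (ih (contDiffOn_derivWithin hφ)).congr fun x hx => derivWithin_eq_deriv hx

end ScaleO

/-- A one-signed function with bounded second derivative and a critical point at `0` satisfies
`ξ'^2 = O(ξ)`. -/
theorem isBigO_deriv_sq {ξ : ℝ → ℝ} (hs : ContDiffOn ℝ ∞ ξ (Ici 0)) (hneg : ∀ x, 0 < x → ξ x < 0)
    (h0 : derivWithin ξ (Ici 0) 0 = 0) :
    deriv ξ =O[𝓝[>] 0] fun x => Real.sqrt (-ξ x) := by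
  have hs1 := contDiffOn_derivWithin hs
  have hs2 := contDiffOn_derivWithin hs1
  obtain ⟨B₁, hB₁⟩ := (isBigO_one_of_smoothOn hs2).bound
  set B := max B₁ 1 with hBdef
  have hBpos : 0 < B := lt_max_of_lt_right one_pos
  obtain ⟨δ, hδ, hb⟩ := mem_nhdsGT_iff_exists_Ioo_subset.1 hB₁
  have hb2 : ∀ x, 0 < x → x < δ → |derivWithin (derivWithin ξ (Ici 0)) (Ici 0) x| ≤ B := by
    intro x hx hxδ
    have := hb ⟨hx, hxδ⟩
    simp only [mem_ofPred_eq, norm_one, mul_one, Real.norm_eq_abs] at this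
    exact this.trans (le_max_left _ _)
  have hb1 : ∀ x y, 0 ≤ x → 0 ≤ y → x < δ → y < δ →
      |derivWithin ξ (Ici 0) y - derivWithin ξ (Ici 0) x| ≤ B * |y - x| := by
    have key : ∀ x y, 0 ≤ x → x < y → y < δ →
        |derivWithin ξ (Ici 0) y - derivWithin ξ (Ici 0) x| ≤ B * |y - x| := by
      intro x y hx hxy hy
      obtain ⟨c, hc, hce⟩ := exists_hasDerivAt_eq_slope (derivWithin ξ (Ici 0))
        (derivWithin (derivWithin ξ (Ici 0)) (Ici 0)) hxy
        (hs1.continuousOn.mono fun z hz => mem_Ici.2 (hx.trans hz.1))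
        (fun z hz => hasDerivAt_of_smoothOn hs1 (hx.trans_lt hz.1))
      have := hb2 c (hx.trans_lt hc.1) (hc.2.trans hy)
      rw [hce, abs_div, div_le_iff₀ (abs_pos.2 (by linarith))] at this
      exact this
    intro x y hx hy hxδ hyδ
    rcases lt_trichotomy x y with h | h | h
    · exact key x y hx h hyδ
    · simp [h]
    · rw [abs_sub_comm, abs_sub_comm y x]; exact key y x hy h hxδ
  refine IsBigO.of_bound (2 * Real.sqrt B) ?_
  filter_upwards [Ioo_mem_nhdsGT (half_pos hδ)] with x hx
  obtain ⟨hx, hxδ⟩ := hx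
  set d := deriv ξ x with hd
  have hdw : derivWithin ξ (Ici 0) x = d := derivWithin_eq_deriv hx
  have hdx : |d| ≤ B * x := by
    have := hb1 0 x le_rfl hx.le hδ (by linarith)
    rwa [h0, hdw, sub_zero, sub_zero, abs_of_pos hx] at this
  set s : ℝ := d / (2 * B) with hsdef
  have hsx : |s| ≤ x / 2 := by
    rw [hsdef, abs_div, abs_of_pos (by positivity : 0 < 2 * B), div_le_iff₀ (by positivity)]
    linarith
  have hsx' := abs_le.1 hsx
  have hquad : |(ξ (x + s) - d * (x + s)) - (ξ x - d * x)| ≤ B * |s| * |s| := by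
    have hconv : Convex ℝ (uIcc x (x + s)) := convex_uIcc _ _
    have hmem : ∀ z ∈ uIcc x (x + s), 0 < z ∧ z < δ ∧ |z - x| ≤ |s| := by
      intro z hz
      have h1 := abs_sub_left_of_mem_uIcc hz
      rw [add_sub_cancel_left] at h1
      have := abs_le.1 (h1.trans hsx)
      exact ⟨by linarith, by linarith, h1⟩
    have := hconv.norm_image_sub_le_of_norm_hasDerivWithin_le (f := fun z => ξ z - d * z)
      (f' := fun z => derivWithin ξ (Ici 0) z - d) (C := B * |s|) (x := x) (y := x + s)
      (fun z hz => (((hasDerivAt_of_smoothOn hs (hmem z hz).1).sub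
        (by simpa using (hasDerivAt_id z).const_mul d)).hasDerivWithinAt))
      (fun z hz => by
        have := hb1 x z hx.le (hmem z hz).1.le (by linarith) (hmem z hz).2.1
        rw [hdw] at this
        exact this.trans (mul_le_mul_of_nonneg_left (hmem z hz).2.2 hBpos.le))
      left_mem_uIcc right_mem_uIcc
    simpa using this
  have hpos : ξ (x + s) < 0 := hneg _ (by linarith)
  have h3 := (abs_le.1 hquad).1
  have h4 : B * |s| * |s| = d ^ 2 / (4 * B) := by
    rw [mul_assoc, abs_mul_abs_self, hsdef]; field_simp; ring
  have h5 : d * s = d ^ 2 / (2 * B) := by rw [hsdef]; field_simp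
  have h6 : d ^ 2 / (2 * B) = 2 * (d ^ 2 / (4 * B)) := by field_simp; ring
  have h7 : d ^ 2 / (4 * B) ≤ -ξ x := by
    rw [h4] at h3
    nlinarith
  rw [div_le_iff₀ (by positivity)] at h7
  have hξ := hneg x hx
  rw [Real.norm_eq_abs, Real.norm_of_nonneg (Real.sqrt_nonneg _)]
  refine abs_le_of_sq_le_sq ?_ (by positivity)
  rw [mul_pow, mul_pow, Real.sq_sqrt hBpos.le, Real.sq_sqrt (by linarith)]
  linarith

/-- Iterated Lie derivatives of the identity along `ξ`. -/
noncomputable def lieIter (ξ : ℝ → ℝ) : ℕ → ℝ → ℝ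
  | 0 => id
  | j + 1 => fun x => ξ x * derivWithin (lieIter ξ j) (Ici 0) x

theorem lieIter_smooth {ξ : ℝ → ℝ} (hs : ContDiffOn ℝ ∞ ξ (Ici 0)) (j : ℕ) :
    ContDiffOn ℝ ∞ (lieIter ξ j) (Ici 0) := by
  induction j with
  | zero => exact contDiffOn_id
  | succ j ih => exact hs.mul (contDiffOn_derivWithin ih)

theorem lieIter_succ_scaleO {ξ : ℝ → ℝ} (hs : ContDiffOn ℝ ∞ ξ (Ici 0))
    (hneg : ∀ x, 0 < x → ξ x < 0) (h0 : derivWithin ξ (Ici 0) 0 = 0) (j m : ℕ) :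
    ScaleO (fun x => Real.sqrt (-ξ x)) m (j + 2) (lieIter ξ (j + 1)) := by
  have hσ : (fun x => Real.sqrt (-ξ x)) =O[𝓝[>] 0] fun _ => (1 : ℝ) := by
    have h1 := ((hs.continuousOn 0 (mem_Ici.2 le_rfl)).mono Ioi_subset_Ici_self).tendsto
    exact ((Real.continuous_sqrt.tendsto _).comp h1.neg).isBigO_one ℝ
  have hξ : ∀ m, ScaleO (fun x => Real.sqrt (-ξ x)) m 2 ξ := by
    intro m
    have hO : ξ =O[𝓝[>] 0] fun x => Real.sqrt (-ξ x) ^ 2 := by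
      refine IsBigO.of_bound 1 ?_
      filter_upwards [self_mem_nhdsWithin] with x hx
      have := hneg x hx
      rw [Real.sq_sqrt (by linarith), norm_neg, one_mul]
    rcases m with _ | _ | m
    · exact scaleO_zero.2 hO
    · exact scaleO_succ.2 ⟨hO, scaleO_zero.2 (by simpa using isBigO_deriv_sq hs hneg h0)⟩
    · refine scaleO_succ.2 ⟨hO, scaleO_succ.2 ⟨by simpa using isBigO_deriv_sq hs hneg h0, ?_⟩⟩
      have h2 := scaleO_order_zero (σ := fun x => Real.sqrt (-ξ x)) (m := m)
        (contDiffOn_derivWithin (contDiffOn_derivWithin hs))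
      refine h2.congr fun x hx => ?_
      rw [derivWithin_eq_deriv hx]
      refine Filter.EventuallyEq.deriv_eq ?_
      filter_upwards [Ioi_mem_nhds hx] with y hy using derivWithin_eq_deriv hy
  induction j generalizing m with
  | zero =>
    refine (hξ m).congr fun x hx => ?_
    simp [lieIter, derivWithin_eq_deriv hx]
  | succ j ih =>
    have h1 := (scaleO_succ.1 (ih (m + 1))).2
    have hsm := lieIter_smooth hs (j + 1)
    have h2 := (hξ m).mul hσ (hs.mono Ioi_subset_Ici_self)
      ((contDiffOn_derivWithin hsm).mono Ioi_subset_Ici_self)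
      (h1.congr fun x hx => (derivWithin_eq_deriv hx).symm)
    rw [show j + 1 + 2 = 2 + (j + 2 - 1) by omega]
    exact h2

/-- If `u = O(w²)` and `u'' = O(1)` for a slowly varying weight `w`, then `u' = O(w)`. -/
theorem isBigO_deriv_of_sq {u w : ℝ → ℝ} {A : ℝ} (hw : ∀ t, 0 < w t)
    (hw1 : ∀ᶠ t in atTop, w t ≤ 1) (hA : ∀ t s, 0 ≤ s → s ≤ 1 → w (t + s) ≤ A * w t)
    (hu : ContDiff ℝ ∞ u) (h0 : u =O[atTop] fun t => w t ^ 2)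
    (h2 : deriv (deriv u) =O[atTop] fun _ => (1 : ℝ)) : deriv u =O[atTop] w := by
  obtain ⟨K, hKpos, hK⟩ := h0.exists_pos
  obtain ⟨B, hBpos, hB⟩ := h2.exists_pos
  obtain ⟨t₀, ht₀⟩ := eventually_atTop.1 (hK.bound.and (hB.bound.and hw1))
  refine IsBigO.of_bound (B + K * (A ^ 2 + 1)) (eventually_atTop.2 ⟨t₀, fun t ht => ?_⟩)
  set s := w t with hs
  have hs0 : 0 < s := hw t
  have hs1 : s ≤ 1 := (ht₀ t ht).2.2
  have hu' := contDiff_deriv hu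
  obtain ⟨θ, hθ, hθe⟩ := exists_deriv_eq_slope u (show t < t + s by linarith)
    hu.continuous.continuousOn (differentiable_of_smooth hu).differentiableOn
  obtain ⟨η, hη, hηe⟩ := exists_deriv_eq_slope (deriv u) hθ.1
    hu'.continuous.continuousOn (differentiable_of_smooth hu').differentiableOn
  have hηt : t₀ ≤ η := ht.trans hη.1.le
  have e1 : |deriv (deriv u) η| ≤ B := by simpa using (ht₀ η hηt).2.1
  have e2 : |u t| ≤ K * s ^ 2 := by simpa using (ht₀ t ht).1
  have e3 : |u (t + s)| ≤ K * w (t + s) ^ 2 := by simpa using (ht₀ (t + s) (by linarith)).1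
  have e4 : |u (t + s)| ≤ K * (A * s) ^ 2 := e3.trans (by
    gcongr
    · exact (hw _).le
    · exact hA t s hs0.le hs1)
  have hη2 : deriv u θ - deriv u t = deriv (deriv u) η * (θ - t) := by
    rw [hηe, div_mul_cancel₀]; linarith [hθ.1]
  have hθ2 : u (t + s) - u t = deriv u θ * s := by
    rw [hθe, add_sub_cancel_left, div_mul_cancel₀]; exact hs0.ne'
  have e5 : |deriv u θ| ≤ K * (A ^ 2 + 1) * s := by
    have : |deriv u θ| * s ≤ K * (A ^ 2 + 1) * s * s := by
      rw [← abs_of_pos hs0, ← abs_mul, ← hθ2, abs_of_pos hs0]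
      refine (abs_sub _ _).trans ?_
      calc _ ≤ K * (A * s) ^ 2 + K * s ^ 2 := add_le_add e4 e2
        _ = _ := by ring
    exact le_of_mul_le_mul_right this hs0
  have e6 : |deriv u θ - deriv u t| ≤ B * s := by
    rw [hη2, abs_mul]
    refine mul_le_mul e1 ?_ (abs_nonneg _) hBpos.le
    rw [abs_of_pos (by linarith [hθ.1])]
    linarith [hθ.2]
  rw [Real.norm_eq_abs, Real.norm_of_nonneg hs0.le]
  have e7 := abs_sub_abs_le_abs_sub (deriv u t) (deriv u θ)
  rw [abs_sub_comm] at e7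
  linarith

/-- The map of the half-line which is `Ψ` in the time coordinate. -/
noncomputable def timeConj (X T Ψ : ℝ → ℝ) (x : ℝ) : ℝ := if x ≤ 0 then 0 else X (Ψ (T x))

theorem timeConj_of_pos {X T Ψ : ℝ → ℝ} {x : ℝ} (hx : 0 < x) :
    timeConj X T Ψ x = X (Ψ (T x)) := if_neg (not_le.2 hx)

theorem timeConj_zero {X T Ψ : ℝ → ℝ} : timeConj X T Ψ 0 = 0 := if_pos le_rfl

namespace TimeChart

variable {ξ X T : ℝ → ℝ} {C : ℝ} (h : TimeChart ξ X T C)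
include h

theorem speed_le_one : ∀ᶠ t in atTop, -ξ (X t) ≤ 1 :=
  h.tendsto_speed.eventually_le_const one_pos

theorem speed_pow_isBigO {m n : ℕ} (hmn : m ≤ n) :
    (fun t => (-ξ (X t)) ^ n) =O[atTop] fun t => (-ξ (X t)) ^ m := by
  refine IsBigO.of_bound 1 ?_
  filter_upwards [h.speed_le_one] with t ht
  have := (h.speed_pos t).le
  rw [one_mul, norm_pow, norm_pow, Real.norm_of_nonneg this]
  exact pow_le_pow_of_le_one this ht hmn

theorem tame_comp {φ : ℝ → ℝ} (hφ : ContDiffOn ℝ ∞ φ (Ici 0)) : Tame fun t => φ (X t) := by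
  refine ⟨(hφ.mono Ioi_subset_Ici_self).comp_contDiff h.contDiff h.pos, fun m => ?_⟩
  have hO : ∀ φ : ℝ → ℝ, ContDiffOn ℝ ∞ φ (Ici 0) →
      (fun t => φ (X t)) =O[atTop] fun _ => (1 : ℝ) := fun φ hφ =>
    (isBigO_one_of_smoothOn hφ).comp_tendsto h.tendsto_zero
  induction m generalizing φ with
  | zero => exact derivO_zero.2 (hO φ hφ)
  | succ m ih =>
    refine derivO_succ.2 ⟨hO φ hφ, ?_⟩
    have : deriv (fun t => φ (X t)) = fun t => derivWithin φ (Ici 0) (X t) * ξ (X t) := by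
      funext t
      exact ((hasDerivAt_of_smoothOn hφ (h.pos t)).comp t (h.hasDerivAt t)).deriv
    rw [this]
    exact ih ((contDiffOn_derivWithin hφ).mul h.smooth)

theorem tame : Tame X := h.tame_comp (φ := id) contDiffOn_id

theorem iteratedDeriv_eq (j : ℕ) : iteratedDeriv j X = fun t => lieIter ξ j (X t) := by
  induction j with
  | zero => simp [lieIter]
  | succ j ih =>
    rw [iteratedDeriv_succ, ih]
    funext t
    have := ((hasDerivAt_of_smoothOn (lieIter_smooth h.smooth j) (h.pos t)).comp t
      (h.hasDerivAt t)).deriv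
    exact this.trans (mul_comm _ _)

theorem iteratedDeriv_isBigO (hflat : derivWithin ξ (Ici 0) 0 = 0) {n : ℕ} (hn : 0 < n) :
    iteratedDeriv (2 * n) X =O[atTop] fun t => (-ξ (X t)) ^ n := by
  obtain ⟨n, rfl⟩ : ∃ k, n = k + 1 := ⟨n - 1, by omega⟩
  rw [h.iteratedDeriv_eq]
  have h1 := (lieIter_succ_scaleO h.smooth h.neg hflat (2 * n + 1) 0).isBigO
  refine (h1.comp_tendsto h.tendsto_zero).trans (IsBigO.of_bound 1 ?_)
  filter_upwards [h.speed_le_one] with t ht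
  have hp := (h.speed_pos t).le
  simp only [Function.comp]
  rw [show 2 * n + 1 + 2 = 2 * (n + 1) + 1 by ring, pow_succ, pow_mul, Real.sq_sqrt hp, norm_mul,
    one_mul]
  refine mul_le_of_le_one_right (norm_nonneg _) ?_
  rw [Real.norm_of_nonneg (Real.sqrt_nonneg _)]
  exact Real.sqrt_le_one.2 ht

theorem taylor_isBigO (hflat : derivWithin ξ (Ici 0) 0 = 0) {n : ℕ} (hn : 0 < n) {τ : ℝ}
    (hτ : τ ∈ Icc (0 : ℝ) 1) :
    (fun t => X (t + τ) - ∑ j ∈ Finset.range (2 * n), τ ^ j / (j.factorial : ℝ) *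
      lieIter ξ j (X t)) =O[atTop] fun t => (-ξ (X t)) ^ n := by
  obtain ⟨K, hKpos, hK⟩ := (h.iteratedDeriv_isBigO hflat hn).exists_pos
  obtain ⟨t₀, ht₀⟩ := eventually_atTop.1 hK.bound
  refine IsBigO.of_bound (K * Real.exp C ^ n) (eventually_atTop.2 ⟨t₀, fun t ht => ?_⟩)
  obtain ⟨N, hN⟩ : ∃ N, 2 * n = N + 1 := ⟨2 * n - 1, by omega⟩
  have hlt : t < t + 1 := by linarith
  have hu := uniqueDiffOn_Icc hlt
  have hat : ∀ (i : ℕ) (s : ℝ), ContDiffAt ℝ i X s := fun i s =>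
    (h.contDiff.contDiffAt).of_le (by exact_mod_cast le_top)
  have key := taylor_mean_remainder_bound (f := X) (a := t) (b := t + 1) (x := t + τ) (n := N)
    (C := K * Real.exp C ^ n * (-ξ (X t)) ^ n) hlt.le
    ((h.contDiff.of_le (by exact_mod_cast le_top)).contDiffOn)
    ⟨by linarith [hτ.1], by linarith [hτ.2]⟩
    (fun y hy => by
      rw [← hN, iteratedDerivWithin_eq_iteratedDeriv hu (hat _ _) hy]
      refine (ht₀ y (ht.trans hy.1)).trans ?_
      rw [norm_pow, Real.norm_of_nonneg (h.speed_pos y).le, mul_assoc, ← mul_pow]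
      refine mul_le_mul_of_nonneg_left (pow_le_pow_left₀ (h.speed_pos y).le ?_ _) hKpos.le
      refine (h.speed_le y t).trans ?_
      refine mul_le_mul_of_nonneg_right (Real.exp_le_exp.2 ?_) (h.speed_pos t).le
      refine mul_le_of_le_one_right h.C_nonneg ?_
      rw [abs_le]; constructor <;> linarith [hy.1, hy.2])
  have he : taylorWithinEval X N (Icc t (t + 1)) t (t + τ) =
      ∑ j ∈ Finset.range (2 * n), τ ^ j / (j.factorial : ℝ) * lieIter ξ j (X t) := by
    rw [taylor_within_apply, ← hN]
    refine Finset.sum_congr rfl fun j _ => ?_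
    rw [iteratedDerivWithin_eq_iteratedDeriv hu (hat _ _) (left_mem_Icc.2 hlt.le),
      h.iteratedDeriv_eq, add_sub_cancel_left, smul_eq_mul]
    ring
  rw [he, add_sub_cancel_left] at key
  refine key.trans ?_
  rw [norm_pow, Real.norm_of_nonneg (h.speed_pos t).le]
  have hpos : 0 ≤ K * Real.exp C ^ n * (-ξ (X t)) ^ n := by
    have := (h.speed_pos t).le
    positivity
  refine div_le_of_le_mul₀ (by positivity) hpos ?_
  refine mul_le_mul_of_nonneg_left ?_ hpos
  exact (pow_le_one₀ hτ.1 hτ.2).trans (by exact_mod_cast Nat.one_le_iff_ne_zero.2 N.factorial_ne_zero)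

theorem deriv_isBigO {u : ℝ → ℝ} (hu : Tame u) {n : ℕ}
    (h0 : u =O[atTop] fun t => (-ξ (X t)) ^ (2 * n)) :
    deriv u =O[atTop] fun t => (-ξ (X t)) ^ n := by
  refine isBigO_deriv_of_sq (A := Real.exp C ^ n) (fun t => pow_pos (h.speed_pos t) _) ?_ ?_
    hu.smooth (by simpa only [← pow_mul, mul_comm n 2] using h0) (hu.deriv.deriv.derivO 0).isBigO
  · filter_upwards [h.speed_le_one] with t ht using pow_le_one₀ (h.speed_pos t).le ht
  · intro t s hs hs1
    rw [← mul_pow]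
    refine pow_le_pow_left₀ (h.speed_pos _).le ((h.speed_le _ t).trans ?_) _
    refine mul_le_mul_of_nonneg_right (Real.exp_le_exp.2 ?_) (h.speed_pos t).le
    refine mul_le_of_le_one_right h.C_nonneg ?_
    rwa [add_sub_cancel_left, abs_of_nonneg hs]

theorem derivO_of_isBigO {u : ℝ → ℝ} (hu : Tame u) {m n : ℕ}
    (h0 : u =O[atTop] fun t => (-ξ (X t)) ^ (n * 2 ^ m)) :
    DerivO m (fun t => (-ξ (X t)) ^ n) u := by
  induction m generalizing u with
  | zero => exact derivO_zero.2 (by simpa using h0)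
  | succ m ih =>
    refine derivO_succ.2 ⟨h0.trans (h.speed_pow_isBigO ?_), ih hu.deriv (h.deriv_isBigO hu ?_)⟩
    · exact Nat.le_mul_of_pos_right _ (by positivity)
    · rwa [show 2 * (n * 2 ^ m) = n * 2 ^ (m + 1) by ring]

theorem derivO_inv_field (m : ℕ) :
    DerivO m (fun t => (-ξ (X t))⁻¹) fun t => (ξ (X t))⁻¹ := by
  have hO : (fun t => (ξ (X t))⁻¹) =O[atTop] fun t => (-ξ (X t))⁻¹ :=
    IsBigO.of_bound 1 (Eventually.of_forall fun t => by simp)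
  have hne : ∀ t, ξ (X t) ≠ 0 := fun t => (h.neg _ (h.pos t)).ne
  have hT := h.tame_comp h.smooth
  have hT' := h.tame_comp (contDiffOn_derivWithin h.smooth)
  induction m with
  | zero => exact derivO_zero.2 hO
  | succ m ih =>
    refine derivO_succ.2 ⟨hO, ?_⟩
    have : deriv (fun t => (ξ (X t))⁻¹) =
        fun t => (-1 * derivWithin ξ (Ici 0) (X t)) * (ξ (X t))⁻¹ := by
      funext t
      have h1 := (hasDerivAt_of_smoothOn h.smooth (h.pos t)).comp t (h.hasDerivAt t)
      refine (h1.inv (hne t)).deriv.trans ?_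
      have := hne t
      simp only [Function.comp]
      field_simp
    rw [this]
    have h2 := (Tame.const (-1)).mul hT'
    simpa using (h2.derivO m).mul h2.smooth (hT.smooth.inv hne) ih

/-- Derivatives in the space coordinate of a function which is small in the time coordinate. -/
theorem iteratedDeriv_isBigO_of_derivO {u g : ℝ → ℝ} (hu : ContDiff ℝ ∞ u)
    (hg : ∀ x, 0 < x → g x = u (T x)) {m n : ℕ}
    (hO : DerivO m (fun t => (-ξ (X t)) ^ (n + m)) u) :
    iteratedDeriv m g =O[𝓝[>] 0] fun x => (-ξ x) ^ n := by
  induction m generalizing u g with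
  | zero =>
    have := hO.isBigO.comp_tendsto h.tendsto_time
    refine (this.congr' ?_ ?_)
    · filter_upwards [self_mem_nhdsWithin] with x hx using by simp [hg x hx]
    · filter_upwards [self_mem_nhdsWithin] with x hx using by simp [h.right_inv x hx]
  | succ m ih =>
    rw [iteratedDeriv_succ']
    have hne : ∀ t, ξ (X t) ≠ 0 := fun t => (h.neg _ (h.pos t)).ne
    have hρ : ContDiff ℝ ∞ fun t => (ξ (X t))⁻¹ := (h.tame_comp h.smooth).smooth.inv hne
    refine ih (u := fun t => deriv u t * (ξ (X t))⁻¹) ((contDiff_deriv hu).mul hρ) ?_ ?_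
    · intro x hx
      have h1 := (differentiable_of_smooth hu (T x)).hasDerivAt.comp x (h.hasDerivAt_time x hx)
      rw [h.right_inv x hx, ← h1.deriv]
      refine Filter.EventuallyEq.deriv_eq ?_
      filter_upwards [Ioi_mem_nhds hx] with y hy using hg y hy
    · refine ((derivO_succ.1 hO).2.mul (contDiff_deriv hu) hρ (h.derivO_inv_field m)).trans ?_
      refine IsBigO.of_bound 1 (Eventually.of_forall fun t => ?_)
      have := (h.speed_pos t).ne'
      rw [← add_assoc, pow_succ, mul_assoc, mul_inv_cancel₀ this]
      simp

theorem iteratedDeriv_isBigO_of_isBigO {u g : ℝ → ℝ} (hu : Tame u)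
    (hg : ∀ x, 0 < x → g x = u (T x)) {m n : ℕ}
    (hO : u =O[atTop] fun t => (-ξ (X t)) ^ ((n + m) * 2 ^ m)) :
    iteratedDeriv m g =O[𝓝[>] 0] fun x => (-ξ x) ^ n :=
  h.iteratedDeriv_isBigO_of_derivO hu.smooth hg (h.derivO_of_isBigO hu hO)

theorem tendsto_field : Tendsto ξ (𝓝[>] 0) (𝓝 0) := by
  have := ((h.smooth.continuousOn 0 (mem_Ici.2 le_rfl)).mono Ioi_subset_Ici_self).tendsto
  rwa [h.zero] at this

/-- A map of the half-line which is infinitely close to a flow map at the origin is smooth. -/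
theorem contDiffOn_timeConj (hflat : derivWithin ξ (Ici 0) 0 = 0) {H : ℝ → ℝ}
    (hH : Tame fun t => X (H t)) {τ : ℝ} (hτ : τ ∈ Icc (0 : ℝ) 1)
    (hO : ∀ n : ℕ, (fun t => X (H t) - X (t + τ)) =O[atTop] fun t => (-ξ (X t)) ^ n) :
    ContDiffOn ℝ ∞ (timeConj X T H) (Ici 0) := by
  refine contDiffOn_infty.2 fun m => ?_
  set N := (1 + m) * 2 ^ m with hN
  have hNpos : 0 < N := by positivity
  set E : ℝ → ℝ := fun x => ∑ j ∈ Finset.range (2 * N), τ ^ j / (j.factorial : ℝ) * lieIter ξ j x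
    with hE
  have hEs : ContDiffOn ℝ ∞ E (Ici 0) :=
    ContDiffOn.sum fun j _ => contDiffOn_const.mul (lieIter_smooth h.smooth j)
  have hu : Tame fun t => X (H t) - E (X t) := hH.sub (h.tame_comp hEs)
  have huO : (fun t => X (H t) - E (X t)) =O[atTop] fun t => (-ξ (X t)) ^ N := by
    simpa using (hO N).add (h.taylor_isBigO hflat hNpos hτ)
  have hflat' : ContDiffOn ℝ m (fun x => timeConj X T H x - E x) (Ici 0) := by
    have hgu : ∀ x, 0 < x → timeConj X T H x - E x = X (H (T x)) - E (X (T x)) := fun x hx => by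
      rw [timeConj_of_pos hx, h.right_inv x hx]
    refine contDiffOn_Ici_of_flat ?_ ?_ fun i hi => ?_
    · exact (hu.smooth.comp_contDiffOn h.contDiffOn_time).congr hgu
    · rw [timeConj_zero, hE, zero_sub, neg_eq_zero]
      refine Finset.sum_eq_zero fun j _ => ?_
      cases j <;> simp [lieIter, h.zero]
    · have h1 := h.iteratedDeriv_isBigO_of_isBigO hu hgu (m := i) (n := 1)
        (huO.trans (h.speed_pow_isBigO
          (Nat.mul_le_mul (by omega) (Nat.pow_le_pow_right two_pos hi))))
      refine h1.trans_tendsto ?_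
      simpa using h.tendsto_field.neg
  have := hflat'.add (hEs.of_le (show (m : WithTop ℕ∞) ≤ ∞ by exact_mod_cast le_top))
  simpa using this

end TimeChart

theorem iteratedDerivWithin_smooth {g : ℝ → ℝ} (hg : ContDiffOn ℝ ∞ g (Ici 0)) (j : ℕ) :
    ContDiffOn ℝ ∞ (iteratedDerivWithin j g (Ici 0)) (Ici 0) := by
  induction j with
  | zero => simpa using hg
  | succ j ih =>
    have : iteratedDerivWithin (j + 1) g (Ici 0) =
        derivWithin (iteratedDerivWithin j g (Ici 0)) (Ici 0) := by
      funext x; rw [iteratedDerivWithin_succ]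
    rw [this]; exact contDiffOn_derivWithin ih

theorem hasDerivAt_iteratedDerivWithin {g : ℝ → ℝ} (hg : ContDiffOn ℝ ∞ g (Ici 0)) (j : ℕ) {x : ℝ}
    (hx : 0 < x) :
    HasDerivAt (iteratedDerivWithin j g (Ici 0)) (iteratedDerivWithin (j + 1) g (Ici 0) x) x := by
  rw [iteratedDerivWithin_succ]
  exact hasDerivAt_of_smoothOn (iteratedDerivWithin_smooth hg j) hx

theorem iteratedDerivWithin_eq_of_pos {g : ℝ → ℝ} (j : ℕ) {x : ℝ} (hx : 0 < x) :
    iteratedDerivWithin j g (Ici 0) x = iteratedDeriv j g x := by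
  induction j generalizing x with
  | zero => simp
  | succ j ih =>
    rw [iteratedDerivWithin_succ, iteratedDeriv_succ, derivWithin_eq_deriv hx]
    refine Filter.EventuallyEq.deriv_eq ?_
    filter_upwards [Ioi_mem_nhds hx] with y hy using ih hy

/-- The oscillation condition as a power comparison. -/
theorem exists_pow_gt {f : ℝ → ℝ}
    (hcontr : ∀ x : ℝ, 0 < x → 0 < f x ∧ f x < x)
    (hosc : ∀ M : ℝ, ∀ ε : ℝ, 0 < ε → ∃ x : ℝ, 0 < x ∧ x < ε ∧
      ∃ y : ℝ, 0 < y ∧ y ≤ x ∧ M < |Real.log (x - f x)| / |Real.log (y - f y)|)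
    (M : ℕ) {δ : ℝ} (hδ : 0 < δ) :
    ∃ x, 0 < x ∧ x < δ ∧ ∃ y, 0 < y ∧ y ≤ x ∧ |f x - x| < |f y - y| ^ M := by
  obtain ⟨x, hx, hxδ, y, hy, hyx, hM⟩ := hosc M (min δ 1) (lt_min hδ one_pos)
  have hx1 : x < 1 := hxδ.trans_le (min_le_right _ _)
  have key : ∀ z, 0 < z → z < 1 → |f z - z| = z - f z ∧ 0 < z - f z ∧ z - f z < 1 := by
    intro z hz hz1
    have := hcontr z hz
    exact ⟨by rw [abs_sub_comm, abs_of_pos (by linarith)], by linarith, by linarith⟩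
  obtain ⟨ex, px, lx⟩ := key x hx hx1
  obtain ⟨ey, py, ly⟩ := key y hy (hyx.trans_lt hx1)
  have hlx := Real.log_neg px lx
  have hly := Real.log_neg py ly
  refine ⟨x, hx, hxδ.trans_le (min_le_left _ _), y, hy, hyx, ?_⟩
  rw [ex, ey, ← Real.log_lt_log_iff px (pow_pos py _), Real.log_pow]
  rw [lt_div_iff₀ (abs_pos.2 hly.ne), abs_of_neg hlx, abs_of_neg hly] at hM
  linarith

/-- A smooth function satisfying the oscillation condition is flat at the origin. -/
theorem iteratedDerivWithin_eq_zero_of_osc {g : ℝ → ℝ} (hg : ContDiffOn ℝ ∞ g (Ici 0))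
    (hosc : ∀ δ > 0, ∃ x, 0 < x ∧ x < δ ∧ ∃ y, 0 < y ∧ y ≤ x ∧ |g x| < |g y| ^ 2)
    (hg0 : g 0 = 0) (n : ℕ) : iteratedDerivWithin n g (Ici 0) 0 = 0 := by
  induction n using Nat.strong_induction_on with
  | _ n ih =>
  by_contra hne
  have hn0 : n ≠ 0 := by rintro rfl; exact hne (by simpa using hg0)
  have ht := taylor_isLittleO (f := g) (x₀ := 0) (n := n) (convex_Ici (0 : ℝ)) (mem_Ici.2 le_rfl)
    (hg.of_le (by exact_mod_cast le_top))
  set α := iteratedDerivWithin n g (Ici 0) 0 / (n.factorial : ℝ) with hα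
  have hα0 : 0 < |α| := abs_pos.2 (div_ne_zero hne (by positivity))
  have he : ∀ x, taylorWithinEval g n (Ici 0) 0 x = α * x ^ n := by
    intro x
    rw [taylor_within_apply, Finset.sum_range_succ, Finset.sum_eq_zero fun i hi => ?_]
    · simp only [sub_zero, zero_add, smul_eq_mul, hα]
      ring
    · rw [ih i (Finset.mem_range.1 hi), smul_zero]
  have hb := ht.bound (half_pos hα0)
  have hb' : ∀ᶠ x in 𝓝[>] (0 : ℝ), ‖g x - taylorWithinEval g n (Ici 0) 0 x‖ ≤
      |α| / 2 * ‖(x - 0) ^ n‖ :=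
    hb.filter_mono (nhdsWithin_mono _ Ioi_subset_Ici_self)
  obtain ⟨δ, hδ, hδb⟩ := mem_nhdsGT_iff_exists_Ioo_subset.1 hb'
  have hsm : ∀ᶠ x in 𝓝[>] (0 : ℝ), 8 * |α| * x ^ n < 1 := by
    have hc : Continuous fun x : ℝ => 8 * |α| * x ^ n := by fun_prop
    have : Tendsto (fun x : ℝ => 8 * |α| * x ^ n) (𝓝[>] 0) (𝓝 0) := by
      have := (hc.tendsto 0).mono_left (nhdsWithin_le_nhds (s := Ioi 0))
      simpa [hn0] using this
    exact this.eventually_lt_const one_pos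
  obtain ⟨δ', hδ', hδb'⟩ := mem_nhdsGT_iff_exists_Ioo_subset.1 hsm
  obtain ⟨x, hx, hxδ, y, hy, hyx, hlt⟩ := hosc (min δ δ') (lt_min hδ hδ')
  have hb1 : ∀ z, 0 < z → z < δ → |g z - α * z ^ n| ≤ |α| / 2 * z ^ n := by
    intro z hz hzδ
    have := hδb ⟨hz, hzδ⟩
    simp only [mem_ofPred_eq, he, sub_zero, norm_pow, Real.norm_eq_abs, abs_of_pos hz] at this
    exact this
  have hxδ₁ := hxδ.trans_le (min_le_left _ _)
  have h1 := hb1 x hx hxδ₁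
  have h2 := hb1 y hy (hyx.trans_lt hxδ₁)
  have h3 : 8 * |α| * x ^ n < 1 := hδb' ⟨hx, hxδ.trans_le (min_le_right _ _)⟩
  have hxn : 0 < x ^ n := pow_pos hx n
  have hyn : 0 < y ^ n := pow_pos hy n
  have hyxn : y ^ n ≤ x ^ n := pow_le_pow_left₀ hy.le hyx n
  have h4 : |α| / 2 * x ^ n ≤ |g x| := by
    have := abs_sub_abs_le_abs_sub (α * x ^ n) (g x)
    rw [abs_sub_comm, abs_mul, abs_of_pos hxn] at this
    linarith
  have h5 : |g y| ≤ 2 * |α| * x ^ n := by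
    have := abs_sub_abs_le_abs_sub (g y) (α * y ^ n)
    rw [abs_mul, abs_of_pos hyn] at this
    nlinarith
  have h6 : |g y| ^ 2 ≤ (2 * |α| * x ^ n) ^ 2 := pow_le_pow_left₀ (abs_nonneg _) h5 2
  have h7 : (2 * |α| * x ^ n) ^ 2 = (|α| / 2 * x ^ n) * (8 * |α| * x ^ n) := by ring
  have h8 : (|α| / 2 * x ^ n) * (8 * |α| * x ^ n) < (|α| / 2 * x ^ n) * 1 :=
    mul_lt_mul_of_pos_left h3 (by positivity)
  linarith

/-- A lower bound on a derivative of order `j` over an interval propagates to all lower orders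
on a proportional subinterval. -/
theorem exists_subinterval_lower_bound (j : ℕ) : ∃ κ : ℝ, 0 < κ ∧ κ ≤ 1 ∧
    ∀ (v : ℕ → ℝ → ℝ) (α L B : ℝ), 0 < L → L ≤ 1 → 0 ≤ B →
      (∀ i < j, ∀ x ∈ Icc α (α + L), HasDerivAt (v i) (v (i + 1) x) x) →
      (∀ x ∈ Icc α (α + L), B ≤ |v j x|) →
      ∃ β l, α ≤ β ∧ β + l ≤ α + L ∧ κ * L ≤ l ∧
        ∀ i ≤ j, ∀ x ∈ Icc β (β + l), κ * B * L ^ j ≤ |v i x| := by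
  induction j with
  | zero =>
    refine ⟨1, one_pos, le_rfl, fun v α L B hL hL1 hB hd hb => ⟨α, L, le_rfl, le_rfl, by simp, ?_⟩⟩
    intro i hi x hx
    obtain rfl : i = 0 := by omega
    simpa using hb x hx
  | succ j ih =>
    obtain ⟨κ, hκ, hκ1, H⟩ := ih
    refine ⟨κ / 4 ^ (j + 1), by positivity,
      div_le_one_of_le₀ (hκ1.trans (one_le_pow₀ (by norm_num))) (by positivity), ?_⟩
    intro v α L B hL hL1 hB hd hb
    obtain ⟨γ, hγ, hγL, hγb⟩ : ∃ γ, α ≤ γ ∧ γ + L / 4 ≤ α + L ∧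
        ∀ x ∈ Icc γ (γ + L / 4), B * (L / 4) ≤ |v j x| := by
      by_contra! hcon
      obtain ⟨p, hp, hpb⟩ := hcon α le_rfl (by linarith)
      obtain ⟨q, hq, hqb⟩ := hcon (α + 3 * L / 4) (by linarith) (by linarith)
      have hpq : p < q := by linarith [hp.2, hq.1]
      have hsub : ∀ x ∈ Icc p q, x ∈ Icc α (α + L) := fun x hx =>
        ⟨hp.1.trans hx.1, by linarith [hx.2, hq.2]⟩
      obtain ⟨c, hc, hce⟩ := exists_hasDerivAt_eq_slope (v j) (v (j + 1)) hpq
        (fun x hx => (hd j (Nat.lt_succ_self j) x (hsub x hx)).continuousAt.continuousWithinAt)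
        (fun x hx => hd j (Nat.lt_succ_self j) x (hsub x (Ioo_subset_Icc_self hx)))
      have h1 := hb c (hsub c (Ioo_subset_Icc_self hc))
      rw [hce, abs_div, abs_of_pos (sub_pos.2 hpq), le_div_iff₀ (sub_pos.2 hpq)] at h1
      have h2 := abs_sub (v j q) (v j p)
      have h3 : B * (L / 2) ≤ B * (q - p) := mul_le_mul_of_nonneg_left
        (by linarith [hp.2, hq.1]) hB
      linarith
    obtain ⟨β, l, h1, h2, h3, h4⟩ := H v γ (L / 4) (B * (L / 4)) (by linarith) (by linarith)
      (by positivity) (fun i hi x hx => hd i (by omega) x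
        ⟨hγ.trans hx.1, hx.2.trans hγL⟩) hγb
    have h4j : (1 : ℝ) ≤ 4 ^ j := one_le_pow₀ (by norm_num)
    refine ⟨β, l, hγ.trans h1, h2.trans hγL, le_trans ?_ h3, fun i hi x hx => ?_⟩
    · rw [pow_succ, div_mul_eq_mul_div, div_le_iff₀ (by positivity)]
      nlinarith [mul_pos hκ hL]
    · have e : κ / 4 ^ (j + 1) * B * L ^ (j + 1) = κ * (B * (L / 4)) * (L / 4) ^ j := by
        rw [div_pow, pow_succ, pow_succ]; field_simp
      rw [e]
      rcases Nat.lt_or_ge j i with hji | hij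
      · obtain rfl : i = j + 1 := by omega
        refine le_trans ?_ (hb x ⟨(hγ.trans h1).trans hx.1, hx.2.trans (h2.trans hγL)⟩)
        have e1 : (L / 4) ^ j ≤ 1 := pow_le_one₀ (by positivity) (by linarith)
        calc κ * (B * (L / 4)) * (L / 4) ^ j ≤ 1 * (B * 1) * 1 := by
              gcongr; linarith
          _ = B := by ring
      · exact h4 i hij x hx

/-- Arbitrarily close to the origin there is a place `x` where `g` is much smaller than its
maximum `c` on `[0,x]`, preceded by an interval of length at least `2c` on which all derivatives
of order at most `k` are bounded below by a fixed power of `c`. -/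
theorem exists_window {g : ℝ → ℝ} (hg : ContDiffOn ℝ ∞ g (Ici 0))
    (hosc : ∀ M : ℕ, ∀ δ > 0, ∃ x, 0 < x ∧ x < δ ∧ ∃ y, 0 < y ∧ y ≤ x ∧ |g x| < |g y| ^ M)
    (hne : ∀ x, 0 < x → g x ≠ 0)
    (hflat : ∀ n, iteratedDerivWithin n g (Ici 0) 0 = 0) (k M : ℕ) {δ : ℝ} (hδ : 0 < δ) :
    ∃ x c u l, 0 < x ∧ x < δ ∧ 0 < c ∧ c < δ ∧ |g x| ≤ c ^ M ∧ (∀ z ∈ Icc 0 x, |g z| ≤ c) ∧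
      2 * c ≤ l ∧ 0 < u - l ∧ u ≤ x ∧
      ∀ z ∈ Icc (u - l) u, ∀ m ≤ k, c ^ (k + 3) ≤ |iteratedDerivWithin m g (Ici 0) z| := by
  set v : ℕ → ℝ → ℝ := fun j => iteratedDerivWithin j g (Ici 0) with hv
  have hvc : ∀ j, ContinuousOn (v j) (Ici 0) := fun j => (iteratedDerivWithin_smooth hg j).continuousOn
  have hvd : ∀ j x, 0 < x → HasDerivAt (v j) (v (j + 1) x) x := fun j x hx =>
    hasDerivAt_iteratedDerivWithin hg j hx
  have hv0 : ∀ j, v j 0 = 0 := hflat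
  have hvlim : ∀ j, Tendsto (v j) (𝓝[>] 0) (𝓝 0) := fun j => by
    have := ((hvc j 0 (mem_Ici.2 le_rfl)).mono Ioi_subset_Ici_self).tendsto
    rwa [hv0 j] at this
  obtain ⟨κ₀, hκ₀, -, H₀⟩ := exists_subinterval_lower_bound k
  obtain ⟨κ₁, hκ₁, -, H₁⟩ := exists_subinterval_lower_bound (k + 1)
  set κ := min (min κ₀ κ₁) 1 with hκdef
  have hκ : 0 < κ := lt_min (lt_min hκ₀ hκ₁) one_pos
  have hκ1 : κ ≤ 1 := min_le_right _ _
  set b : ℝ := κ / 2 ^ (k + 3) with hb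
  have hbpos : 0 < b := by positivity
  have hb1 : b ≤ 1 := div_le_one_of_le₀ (hκ1.trans (one_le_pow₀ (by norm_num))) (by positivity)
  set e : ℝ := min δ (b ^ 2) with he
  have hepos : 0 < e := lt_min hδ (by positivity)
  have hev : ∀ᶠ x in 𝓝[>] (0 : ℝ), |v 0 x| < e ∧ |v (k + 2) x| < 1 := by
    refine ((hvlim 0).abs.eventually_lt_const (by simpa using hepos)).and
      ((hvlim (k + 2)).abs.eventually_lt_const (by simp))
  obtain ⟨δ', hδ', hδb⟩ := mem_nhdsGT_iff_exists_Ioo_subset.1 hev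
  obtain ⟨x, hx, hxδ, y', hy', hyx', hlt⟩ := hosc M (min (min δ δ') 1)
    (lt_min (lt_min hδ hδ') one_pos)
  have hx1 : x < 1 := hxδ.trans_le (min_le_right _ _)
  have hxδ₀ : x < δ := hxδ.trans_le ((min_le_left _ _).trans (min_le_left _ _))
  have hxδ' : x < δ' := hxδ.trans_le ((min_le_left _ _).trans (min_le_right _ _))
  have hv00 : ∀ z, v 0 z = g z := fun z => by simp [hv]
  -- the maximum of `|g|`
  obtain ⟨y, hy, hymax⟩ := isCompact_Icc.exists_isMaxOn (nonempty_Icc.2 hx.le)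
    (((hvc 0).mono fun z hz => mem_Ici.2 hz.1).abs : ContinuousOn (fun z => |v 0 z|) (Icc 0 x))
  set c := |v 0 y| with hc
  have hcmax : ∀ z ∈ Icc 0 x, |v 0 z| ≤ c := fun z hz => hymax hz
  have hcpos : 0 < c := (abs_pos.2 (by rw [hv00]; exact hne x hx)).trans_le
    (hcmax x ⟨hx.le, le_rfl⟩)
  have hypos : 0 < y := by
    rcases hy.1.eq_or_lt with h | h
    · simp [hc, ← h, hv0] at hcpos
    · exact h
  have hce : c < e := (hδb ⟨hypos, hy.2.trans_lt hxδ'⟩).1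
  set q := Real.sqrt c with hq
  have hqpos : 0 < q := Real.sqrt_pos.2 hcpos
  have hqq : q * q = c := Real.mul_self_sqrt hcpos.le
  have hqb : q < b := by
    rw [hq, Real.sqrt_lt' hbpos]
    exact hce.trans_le (min_le_right _ _)
  have hq1 : q ≤ 1 := hqb.le.trans hb1
  -- the maxima of the derivatives on `[0,y]`
  have hmax : ∀ j, ∃ z ∈ Icc 0 y, ∀ w ∈ Icc 0 y, |v j w| ≤ |v j z| := fun j => by
    obtain ⟨z, hz, hzm⟩ := isCompact_Icc.exists_isMaxOn (nonempty_Icc.2 hypos.le)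
      (((hvc j).mono fun z hz => mem_Ici.2 hz.1).abs : ContinuousOn (fun z => |v j z|) (Icc 0 y))
    exact ⟨z, hz, fun w hw => hzm hw⟩
  choose Z hZ hZmax using hmax
  set A : ℕ → ℝ := fun j => |v j (Z j)| with hA
  have hA_lip : ∀ j p q, 0 ≤ p → p ≤ q → q ≤ y → |v j q - v j p| ≤ A (j + 1) * (q - p) := by
    intro j p q hp hpq hqy
    rcases hpq.eq_or_lt with rfl | hpq
    · simp
    obtain ⟨w, hw, hwe⟩ := exists_hasDerivAt_eq_slope (v j) (v (j + 1)) hpq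
      ((hvc j).mono fun z hz => mem_Ici.2 (hp.trans hz.1))
      (fun z hz => hvd j z (hp.trans_lt hz.1))
    have := hZmax (j + 1) w ⟨hp.trans hw.1.le, hw.2.le.trans hqy⟩
    rw [hwe, abs_div, abs_of_pos (sub_pos.2 hpq), div_le_iff₀ (sub_pos.2 hpq)] at this
    exact this
  have hAZ : ∀ j, A j ≤ A (j + 1) * Z j := fun j => by
    have := hA_lip j 0 (Z j) le_rfl (hZ j).1 (hZ j).2
    rwa [hv0, sub_zero, sub_zero] at this
  have hAsucc : ∀ j, A j ≤ A (j + 1) := fun j =>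
    (hAZ j).trans (mul_le_of_le_one_right (abs_nonneg _) ((hZ j).2.trans (hy.2.trans hx1.le)))
  have hAmono : Monotone A := monotone_nat_of_le_succ hAsucc
  have hA0 : c ≤ A 0 := hZmax 0 y ⟨hypos.le, le_rfl⟩
  have hAc : ∀ j, c ≤ A j := fun j => hA0.trans (hAmono (Nat.zero_le j))
  have hA2 : A (k + 2) ≤ 1 := by
    rcases (hZ (k + 2)).1.eq_or_lt with h | h
    · simp [hA, ← h, hv0]
    · exact (hδb ⟨h, (hZ (k + 2)).2.trans_lt (hy.2.trans_lt hxδ')⟩).2.le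
  obtain ⟨j, hj, hjA⟩ : ∃ j, (j = k ∨ j = k + 1) ∧ A (j + 1) * q ≤ A j := by
    by_contra! hcon
    have h1 := hcon k (Or.inl rfl)
    have h2 := hcon (k + 1) (Or.inr rfl)
    have h3 := hAc k
    have h4 : A (k + 1) * q < q * q := by
      calc A (k + 1) * q < A (k + 1 + 1) * q * q := mul_lt_mul_of_pos_right h2 hqpos
        _ ≤ 1 * q * q := by gcongr
        _ = q * q := by ring
    linarith
  have hAj1 : 0 < A (j + 1) := hcpos.trans_le (hAc _)
  have hZq : q ≤ Z j := by
    have := hjA.trans (hAZ j)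
    exact le_of_mul_le_mul_left this hAj1
  have hlow : ∀ w ∈ Icc (Z j - q / 2) (Z j - q / 2 + q / 2), c / 2 ≤ |v j w| := by
    intro w hw
    rw [sub_add_cancel] at hw
    have h1 := hA_lip j w (Z j) (by linarith [hw.1]) hw.2 (hZ j).2
    have h2 : A (j + 1) * (Z j - w) ≤ A (j + 1) * (q / 2) :=
      mul_le_mul_of_nonneg_left (by linarith [hw.1]) hAj1.le
    have h3 := abs_sub_abs_le_abs_sub (v j (Z j)) (v j w)
    have h4 : |v j (Z j)| = A j := rfl
    have h5 := hAc j
    linarith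
  have hκj : ∃ β l, Z j - q / 2 ≤ β ∧ β + l ≤ Z j - q / 2 + q / 2 ∧ κ * (q / 2) ≤ l ∧
      ∀ i ≤ j, ∀ z ∈ Icc β (β + l), κ * (c / 2) * (q / 2) ^ j ≤ |v i z| := by
    have hd : ∀ i < j, ∀ z ∈ Icc (Z j - q / 2) (Z j - q / 2 + q / 2),
        HasDerivAt (v i) (v (i + 1) z) z := fun i _ z hz => hvd i z (by linarith [hz.1])
    obtain ⟨κ', hκ', H⟩ : ∃ κ', κ ≤ κ' ∧ ∃ β l, Z j - q / 2 ≤ β ∧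
        β + l ≤ Z j - q / 2 + q / 2 ∧ κ' * (q / 2) ≤ l ∧
        ∀ i ≤ j, ∀ z ∈ Icc β (β + l), κ' * (c / 2) * (q / 2) ^ j ≤ |v i z| := by
      rcases hj with rfl | rfl
      · exact ⟨κ₀, (min_le_left _ _).trans (min_le_left _ _),
          H₀ v _ (q / 2) (c / 2) (by linarith) (by linarith) (by linarith) hd hlow⟩
      · exact ⟨κ₁, (min_le_left _ _).trans (min_le_right _ _),
          H₁ v _ (q / 2) (c / 2) (by linarith) (by linarith) (by linarith) hd hlow⟩
    obtain ⟨β, l, h1, h2, h3, h4⟩ := H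
    refine ⟨β, l, h1, h2, le_trans (by gcongr) h3, fun i hi z hz => le_trans ?_ (h4 i hi z hz)⟩
    gcongr
  obtain ⟨β, l, h1, h2, h3, h4⟩ := hκj
  have hb4 : b ≤ κ / 4 := by
    rw [hb]
    refine div_le_div_of_nonneg_left hκ.le (by norm_num) ?_
    calc (4 : ℝ) = 2 ^ 2 := by norm_num
      _ ≤ 2 ^ (k + 3) := pow_le_pow_right₀ (by norm_num) (by omega)
  refine ⟨x, c, β + l, l, hx, hxδ₀, hcpos, hce.trans_le (min_le_left _ _), ?_, ?_, ?_, ?_, ?_, ?_⟩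
  · refine hlt.le.trans (pow_le_pow_left₀ (abs_nonneg _) ?_ _)
    rw [← hv00]
    exact hcmax y' ⟨hy'.le, hyx'⟩
  · intro z hz
    rw [← hv00]; exact hcmax z hz
  · refine le_trans ?_ h3
    rw [← hqq]
    nlinarith
  · linarith
  · linarith [(hZ j).2, hy.2]
  · intro z hz m hm
    rw [add_sub_cancel_right] at hz
    refine le_trans ?_ (h4 m (by omega) z hz)
    have hjk : j ≤ k + 1 := by omega
    calc c ^ (k + 3) = q ^ (k + 3) * q ^ (k + 3) := by rw [← hqq, mul_pow]
      _ ≤ b * q ^ (k + 3) := by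
          gcongr
          calc q ^ (k + 3) ≤ q ^ 1 := pow_le_pow_of_le_one hqpos.le hq1 (by omega)
            _ ≤ b := by simpa using hqb.le
      _ = κ * (c / 2) * (q / 2) ^ (k + 1) * (1 / 2) := by
          rw [hb, ← hqq, div_pow, pow_add, pow_add, pow_add, pow_add]; field_simp
      _ ≤ κ * (c / 2) * (q / 2) ^ (k + 1) := by
          refine mul_le_of_le_one_right (by positivity) (by norm_num)
      _ ≤ κ * (c / 2) * (q / 2) ^ j := by
          gcongr κ * (c / 2) * ?_
          exact pow_le_pow_of_le_one (by positivity) (by linarith) hjk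

namespace TimeChart

variable {ξ X T : ℝ → ℝ} {C : ℝ} (h : TimeChart ξ X T C)
include h

theorem exists_speed (t s : ℝ) (hs : 0 < s) :
    ∃ θ ∈ Ioo t (t + s), X t - X (t + s) = -ξ (X θ) * s := by
  obtain ⟨θ, hθ, he⟩ := exists_hasDerivAt_eq_slope X (fun t => ξ (X t)) (show t < t + s by linarith)
    h.continuous.continuousOn (fun z _ => h.hasDerivAt z)
  refine ⟨θ, hθ, ?_⟩
  rw [he, add_sub_cancel_left]
  field_simp
  ring

theorem disp_le (t : ℝ) : X t - X (t + 1) ≤ Real.exp C * -ξ (X t) := by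
  obtain ⟨θ, hθ, he⟩ := h.exists_speed t 1 one_pos
  rw [he, mul_one]
  refine (h.speed_le θ t).trans (mul_le_mul_of_nonneg_right (Real.exp_le_exp.2 ?_) (h.speed_pos t).le)
  refine mul_le_of_le_one_right h.C_nonneg ?_
  rw [abs_le]; constructor <;> linarith [hθ.1, hθ.2]

theorem speed_le_disp (t : ℝ) : -ξ (X t) ≤ Real.exp C * (X t - X (t + 1)) := by
  obtain ⟨θ, hθ, he⟩ := h.exists_speed t 1 one_pos
  rw [he, mul_one]
  refine (h.speed_le t θ).trans (mul_le_mul_of_nonneg_right (Real.exp_le_exp.2 ?_) (h.speed_pos θ).le)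
  refine mul_le_of_le_one_right h.C_nonneg ?_
  rw [abs_le]; constructor <;> linarith [hθ.1, hθ.2]

theorem derivWithin_eq_zero {g : ℝ → ℝ} (hg : ∀ t, g (X t) = X (t + 1) - X t)
    (hgd : HasDerivWithinAt g 0 (Ici 0) 0) (hg0 : g 0 = 0) :
    derivWithin ξ (Ici 0) 0 = 0 := by
  have h1 := hasDerivWithinAt_iff_isLittleO.1 hgd
  have h2 : HasDerivWithinAt ξ 0 (Ici 0) 0 := by
    rw [hasDerivWithinAt_iff_isLittleO]
    simp only [h.zero, hg0, sub_zero, smul_zero] at h1 ⊢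
    refine IsBigO.trans_isLittleO (IsBigO.of_bound (Real.exp C) ?_) h1
    filter_upwards [self_mem_nhdsWithin] with x hx
    rcases (mem_Ici.1 hx).eq_or_lt with rfl | hx
    · simp [h.zero, hg0]
    · have h3 := h.speed_le_disp (T x)
      have h4 := hg (T x)
      rw [h.right_inv x hx] at h3 h4
      have h5 := h.neg x hx
      rw [Real.norm_of_nonpos h5.le, Real.norm_eq_abs, h4, abs_sub_comm, abs_of_pos]
      · exact h3
      · by_contra! hle
        nlinarith [Real.exp_pos C]
  exact h2.derivWithin (uniqueDiffOn_Ici (0 : ℝ) 0 (mem_Ici.2 le_rfl))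

end TimeChart

theorem exists_seq_of_step {α : Type*} (Q : ℕ → α → Prop) (R : ℕ → α → α → Prop)
    (h0 : ∃ a, Q 0 a) (hstep : ∀ n a, ∃ b, Q (n + 1) b ∧ R n a b) :
    ∃ a : ℕ → α, (∀ n, Q n (a n)) ∧ ∀ n, R n (a n) (a (n + 1)) := by
  obtain ⟨a₀, ha₀⟩ := h0
  choose F hF using hstep
  refine ⟨fun n => Nat.rec a₀ F n, fun n => ?_, fun n => (hF n _).2⟩
  cases n with
  | zero => exact ha₀
  | succ n => exact (hF n _).1

/-- The parameters of the successive pulses of the perturbation: the amplitudes are powers of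
`c n`, the pulse of frequency `3 ^ κ n` is switched off around the time `s n`, and at the
time `r n` the speed `σ` is much smaller than the amplitude. -/
structure Pulses (σ : ℝ → ℝ) (w : ℕ → ℝ → ℝ) (k : ℕ) (η : ℝ) (c s r : ℕ → ℝ) (κ : ℕ → ℕ) :
    Prop where
  c_pos : ∀ n, 0 < c n
  c_le : ∀ n, c n ≤ η * (1 / 2) ^ n
  freq : ∀ n, 3 ^ κ n * c n ≤ 1
  le_r : ∀ n : ℕ, n ≤ r n
  r_le : ∀ n, r n + 1 ≤ s n
  s_le : ∀ n, s n + 2 ≤ r (n + 1)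
  strictMono : StrictMono κ
  gap : ∀ n : ℕ, ∃ μ : ℝ, 0 < μ ∧ μ ≤ 1 ∧ (∀ t ∈ Icc 0 (s n), μ ≤ σ t) ∧
    ((3 : ℝ) ^ κ (n + 1))⁻¹ ≤ μ ^ n
  speed_r : ∀ n, σ (r n) ≤ c n ^ (n + 3)
  window : ∀ n, ∀ t ∈ Icc (s n - 1) (s n + 1),
    c n ^ (k + 4) ≤ σ t ∧ ∀ m ≤ k, σ t ^ (k + 4) ≤ w m t

namespace TimeChart

variable {ξ X T : ℝ → ℝ} {C : ℝ} (h : TimeChart ξ X T C)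
include h

theorem exists_pulse {g : ℝ → ℝ} (hgX : ∀ t, g (X t) = X (t + 1) - X t)
    (hg : ContDiffOn ℝ ∞ g (Ici 0))
    (hosc : ∀ M : ℕ, ∀ δ > 0, ∃ x, 0 < x ∧ x < δ ∧ ∃ y, 0 < y ∧ y ≤ x ∧ |g x| < |g y| ^ M)
    (hflat : ∀ n, iteratedDerivWithin n g (Ici 0) 0 = 0) (k M : ℕ) (R : ℝ) {δ : ℝ} (hδ : 0 < δ) :
    ∃ c s r, 0 < c ∧ c < δ ∧ R ≤ r ∧ r + 1 ≤ s ∧ -ξ (X r) ≤ c ^ M ∧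
      ∀ t ∈ Icc (s - 1) (s + 1), c ^ (k + 4) ≤ -ξ (X t) ∧
        ∀ m ≤ k, (-ξ (X t)) ^ (k + 4) ≤ |iteratedDerivWithin m g (Ici 0) (X t)| := by
  have hgabs : ∀ t, |g (X t)| = X t - X (t + 1) := fun t => by
    rw [hgX, abs_sub_comm, abs_of_pos (sub_pos.2 (h.strictAnti (lt_add_one t)))]
  have hne : ∀ x, 0 < x → g x ≠ 0 := fun x hx => by
    have := hgX (T x)
    rw [h.right_inv x hx] at this
    rw [this, sub_ne_zero]
    have h2 := (h.strictAnti (lt_add_one (T x))).ne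
    rwa [h.right_inv x hx] at h2
  obtain ⟨x, c, u, l, hx, hxδ, hc, hcδ, hgx, hgmax, hl, hul, hux, hwin⟩ :=
    exists_window hg hosc hne hflat k (M + 1)
      (δ := min (min δ (X R)) (Real.exp (-(C * (k + 4)))))
      (lt_min (lt_min hδ (h.pos R)) (Real.exp_pos _))
  have hcδ' : c < δ := hcδ.trans_le ((min_le_left _ _).trans (min_le_left _ _))
  have hxR : x < X R := hxδ.trans_le ((min_le_left _ _).trans (min_le_right _ _))
  have hcexp : c ≤ Real.exp (-(C * (k + 4))) := hcδ.le.trans (min_le_right _ _)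
  have hC := h.C_nonneg
  have hce : c * Real.exp C ^ (k + 4) ≤ 1 := by
    have : Real.exp C ^ (k + 4) = Real.exp (C * (k + 4)) := by
      rw [← Real.exp_nat_mul]; congr 1; push_cast; ring
    rw [this]
    calc _ ≤ Real.exp (-(C * (k + 4))) * Real.exp (C * (k + 4)) := by gcongr
      _ = 1 := by rw [← Real.exp_add]; simp
  have hexp1 : 1 ≤ Real.exp C := Real.one_le_exp hC
  have hce1 : c * Real.exp C ≤ 1 := le_trans
    (mul_le_mul_of_nonneg_left (le_self_pow₀ hexp1 (by omega)) hc.le) hce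
  have hc1 : c ≤ 1 := le_trans (le_mul_of_one_le_right hc.le hexp1) hce1
  have hu : 0 < u := by linarith
  have hXx := h.right_inv x hx
  have hXu := h.right_inv u hu
  have hTux : T x ≤ T u := by
    by_contra! hlt
    have := h.strictAnti hlt
    rw [hXx, hXu] at this
    linarith
  refine ⟨c, T u + 1, T x, hc, hcδ', (h.lt_time hx hxR).le, by linarith, ?_, fun t ht => ?_⟩
  · refine (h.speed_le_disp _).trans ?_
    rw [← hgabs, hXx]
    calc Real.exp C * |g x| ≤ Real.exp C * c ^ (M + 1) := by gcongr
      _ = (c * Real.exp C) * c ^ M := by ring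
      _ ≤ 1 * c ^ M := by gcongr
      _ = c ^ M := one_mul _
  · rw [add_sub_cancel_right, add_assoc, one_add_one_eq_two] at ht
    have hgle : ∀ t', T x ≤ t' → X t' - X (t' + 1) ≤ c := fun t' ht' => by
      rw [← hgabs]
      refine hgmax _ ⟨(h.pos _).le, ?_⟩
      have := h.strictAnti.antitone ht'
      rwa [hXx] at this
    have hmem : X t ∈ Icc (u - l) u := by
      constructor
      · have h1 := h.strictAnti.antitone ht.2
        have h2 := hgle (T u) hTux
        have h3 := hgle (T u + 1) (by linarith)
        rw [add_assoc, one_add_one_eq_two] at h3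
        rw [hXu] at h2
        linarith
      · have := h.strictAnti.antitone ht.1
        rwa [hXu] at this
    have hw := hwin _ hmem
    have h0 := hw 0 (Nat.zero_le k)
    rw [iteratedDerivWithin_zero, hgabs] at h0
    constructor
    · have h1 := h.disp_le t
      calc c ^ (k + 4) = c * c ^ (k + 3) := by ring
        _ ≤ c * (Real.exp C * -ξ (X t)) := by gcongr; exact h0.trans h1
        _ = (c * Real.exp C) * -ξ (X t) := by ring
        _ ≤ 1 * -ξ (X t) := by gcongr; exact (h.speed_pos t).le
        _ = _ := one_mul _
    · intro m hm
      refine le_trans ?_ (hw m hm)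
      have h1 : -ξ (X t) ≤ Real.exp C * c := (h.speed_le_disp t).trans
        (mul_le_mul_of_nonneg_left (hgle t (hTux.trans ht.1)) (Real.exp_pos C).le)
      calc (-ξ (X t)) ^ (k + 4) ≤ (Real.exp C * c) ^ (k + 4) :=
            pow_le_pow_left₀ (h.speed_pos t).le h1 _
        _ = (c * Real.exp C ^ (k + 4)) * c ^ (k + 3) := by ring
        _ ≤ 1 * c ^ (k + 3) := by gcongr
        _ = _ := one_mul _

theorem exists_pulses {g : ℝ → ℝ} (hgX : ∀ t, g (X t) = X (t + 1) - X t)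
    (hg : ContDiffOn ℝ ∞ g (Ici 0))
    (hosc : ∀ M : ℕ, ∀ δ > 0, ∃ x, 0 < x ∧ x < δ ∧ ∃ y, 0 < y ∧ y ≤ x ∧ |g x| < |g y| ^ M)
    (hflat : ∀ n, iteratedDerivWithin n g (Ici 0) 0 = 0) (k : ℕ) {η : ℝ} (hη : 0 < η) :
    ∃ c s r κ, Pulses (fun t => -ξ (X t)) (fun m t => |iteratedDerivWithin m g (Ici 0) (X t)|)
      k η c s r κ := by
  have hpulse := h.exists_pulse hgX hg hosc hflat k
  have hQ : ∀ (n κ : ℕ) (R : ℝ), ∃ a : ℝ × ℝ × ℝ × ℕ, a.2.2.2 = κ ∧ 0 < a.1 ∧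
      a.1 ≤ η * (1 / 2) ^ n ∧ 3 ^ κ * a.1 ≤ 1 ∧ R ≤ a.2.2.1 ∧ a.2.2.1 + 1 ≤ a.2.1 ∧
      -ξ (X a.2.2.1) ≤ a.1 ^ (n + 3) ∧ ∀ t ∈ Icc (a.2.1 - 1) (a.2.1 + 1),
        a.1 ^ (k + 4) ≤ -ξ (X t) ∧
        ∀ m ≤ k, (-ξ (X t)) ^ (k + 4) ≤ |iteratedDerivWithin m g (Ici 0) (X t)| := by
    intro n κ R
    obtain ⟨c, s, r, hc, hcδ, hR, hrs, hr, hw⟩ := hpulse (n + 3) R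
      (δ := min (η * (1 / 2) ^ n) ((3 : ℝ) ^ κ)⁻¹) (by positivity)
    refine ⟨(c, s, r, κ), rfl, hc, hcδ.le.trans (min_le_left _ _), ?_, hR, hrs, hr, hw⟩
    have := hcδ.le.trans (min_le_right _ _)
    calc (3 : ℝ) ^ κ * c ≤ 3 ^ κ * (3 ^ κ)⁻¹ := by gcongr
      _ = 1 := mul_inv_cancel₀ (by positivity)
  obtain ⟨a, ha, hlink⟩ := exists_seq_of_step (α := ℝ × ℝ × ℝ × ℕ)
    (fun n a => 0 < a.1 ∧
      a.1 ≤ η * (1 / 2) ^ n ∧ 3 ^ a.2.2.2 * a.1 ≤ 1 ∧ (n : ℝ) ≤ a.2.2.1 ∧ a.2.2.1 + 1 ≤ a.2.1 ∧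
      -ξ (X a.2.2.1) ≤ a.1 ^ (n + 3) ∧ ∀ t ∈ Icc (a.2.1 - 1) (a.2.1 + 1),
        a.1 ^ (k + 4) ≤ -ξ (X t) ∧
        ∀ m ≤ k, (-ξ (X t)) ^ (k + 4) ≤ |iteratedDerivWithin m g (Ici 0) (X t)|)
    (fun n a b => a.2.2.2 < b.2.2.2 ∧ a.2.1 + 2 ≤ b.2.2.1 ∧ ∃ μ : ℝ, 0 < μ ∧ μ ≤ 1 ∧
      (∀ t ∈ Icc 0 a.2.1, μ ≤ -ξ (X t)) ∧ ((3 : ℝ) ^ b.2.2.2)⁻¹ ≤ μ ^ n)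
    (by
      obtain ⟨a, hκ, h1⟩ := hQ 0 0 0
      refine ⟨a, ?_⟩
      rw [hκ]
      simpa using h1)
    (by
      intro n a
      have hcont : Continuous fun t => -ξ (X t) :=
        continuous_iff_continuousAt.2 fun t => (h.hasDerivAt_speed t).continuousAt
      obtain ⟨μ, hμ, hμ1, hμb⟩ : ∃ μ : ℝ, 0 < μ ∧ μ ≤ 1 ∧ ∀ t ∈ Icc 0 a.2.1, μ ≤ -ξ (X t) := by
        rcases (Icc (0 : ℝ) a.2.1).eq_empty_or_nonempty with he | hne
        · exact ⟨1, one_pos, le_rfl, fun t ht => by simp [he] at ht⟩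
        · obtain ⟨z, hz, hzm⟩ := isCompact_Icc.exists_isMinOn hne hcont.continuousOn
          exact ⟨min (-ξ (X z)) 1, lt_min (h.speed_pos z) one_pos, min_le_right _ _,
            fun t ht => (min_le_left _ _).trans (hzm ht)⟩
      obtain ⟨p, hp⟩ := exists_pow_lt_of_lt_one (pow_pos hμ n) (show (1 / 3 : ℝ) < 1 by norm_num)
      obtain ⟨b, hκ, h1, h2, h3, h4, h5, h6⟩ := hQ (n + 1) (max p (a.2.2.2 + 1))
        (max (n + 1) (a.2.1 + 2))
      refine ⟨b, ⟨h1, h2, by rwa [hκ], ?_, h5, h6⟩, ?_, ?_, μ, hμ, hμ1, hμb, ?_⟩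
      · push_cast
        exact (le_max_left _ _).trans h4
      · rw [hκ]; omega
      · exact (le_max_right _ _).trans h4
      · rw [hκ, ← inv_pow, ← one_div]
        exact (pow_le_pow_of_le_one (by norm_num) (by norm_num) (le_max_left _ _)).trans hp.le)
  refine ⟨fun n => (a n).1, fun n => (a n).2.1, fun n => (a n).2.2.1, fun n => (a n).2.2.2, ?_⟩
  exact ⟨fun n => (ha n).1, fun n => (ha n).2.1, fun n => (ha n).2.2.1, fun n => (ha n).2.2.2.1,
    fun n => (ha n).2.2.2.2.1, fun n => (hlink n).2.1, strictMono_nat_of_lt_succ fun n => (hlink n).1,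
    fun n => (hlink n).2.2, fun n => (ha n).2.2.2.2.2.1, fun n => (ha n).2.2.2.2.2.2⟩

end TimeChart

/-- A cosine of frequency `3 ^ q` and amplitude `a`, smoothly cut off on `[s, s + 1]`. -/
noncomputable def pulse (s a : ℝ) (q : ℕ) (t : ℝ) : ℝ :=
  a * (Real.smoothTransition (s + 1 - t) * Real.cos (2 * Real.pi * 3 ^ q * t))

theorem pulse_smooth (s a : ℝ) (q : ℕ) : ContDiff ℝ ∞ (pulse s a q) := by
  have : ContDiff ℝ ∞ fun t : ℝ => Real.smoothTransition (s + 1 - t) :=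
    Real.smoothTransition.contDiff.comp (contDiff_const.sub contDiff_id)
  exact contDiff_const.mul (this.mul (Real.contDiff_cos.comp (contDiff_const.mul contDiff_id)))

theorem pulse_eq_zero {s t : ℝ} (a : ℝ) (q : ℕ) (ht : s + 1 ≤ t) : pulse s a q t = 0 := by
  rw [pulse, Real.smoothTransition.zero_of_nonpos (by linarith), zero_mul, mul_zero]

theorem pulse_eq_cos {s t : ℝ} (a : ℝ) (q : ℕ) (ht : t ≤ s) :
    pulse s a q t = a * Real.cos (2 * Real.pi * 3 ^ q * t) := by
  rw [pulse, Real.smoothTransition.one_of_one_le (by linarith), one_mul]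

theorem abs_pulse_le (s a : ℝ) (q : ℕ) (t : ℝ) : |pulse s a q t| ≤ |a| := by
  rw [pulse, abs_mul, abs_mul, abs_of_nonneg (Real.smoothTransition.nonneg _)]
  have := Real.abs_cos_le_one (2 * Real.pi * 3 ^ q * t)
  have h2 := Real.smoothTransition.le_one (s + 1 - t)
  have h3 := Real.smoothTransition.nonneg (s + 1 - t)
  have : Real.smoothTransition (s + 1 - t) * |Real.cos (2 * Real.pi * 3 ^ q * t)| ≤ 1 :=
    mul_le_one₀ h2 (abs_nonneg _) this
  exact mul_le_of_le_one_right (abs_nonneg _) this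

theorem exists_smoothTransition_bound (m : ℕ) :
    ∃ B : ℝ, 0 ≤ B ∧ ∀ t, |iteratedDeriv m Real.smoothTransition t| ≤ B := by
  have hsm : ContDiff ℝ ∞ Real.smoothTransition := Real.smoothTransition.contDiff
  have hc : Continuous (iteratedDeriv m Real.smoothTransition) :=
    hsm.continuous_iteratedDeriv m (by exact_mod_cast le_top)
  obtain ⟨B, hB⟩ := (isCompact_Icc (a := (0 : ℝ)) (b := 1)).exists_bound_of_continuousOn
    hc.continuousOn
  have hconst : ∀ (b : ℝ) (t : ℝ), Real.smoothTransition =ᶠ[𝓝 t] (fun _ => b) → |b| ≤ 1 →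
      |iteratedDeriv m Real.smoothTransition t| ≤ 1 := fun b t hE hb => by
    rw [hE.iteratedDeriv_eq, iteratedDeriv_const]
    split_ifs <;> simp [hb]
  refine ⟨max B 1, zero_le_one.trans (le_max_right _ _), fun t => ?_⟩
  rcases lt_or_ge t 0 with ht | ht
  · refine (hconst 0 t ?_ (by simp)).trans (le_max_right _ _)
    filter_upwards [eventually_lt_nhds ht] with x hx
      using Real.smoothTransition.zero_of_nonpos hx.le
  rcases lt_or_ge 1 t with ht1 | ht1
  · refine (hconst 1 t ?_ (by simp)).trans (le_max_right _ _)
    filter_upwards [eventually_gt_nhds ht1] with x hx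
      using Real.smoothTransition.one_of_one_le hx.le
  · exact (hB t ⟨ht, ht1⟩).trans (le_max_left _ _)

theorem exists_pulse_bound : ∃ K : ℕ → ℝ, (∀ m, 0 ≤ K m) ∧
    ∀ m s a q t, |iteratedDeriv m (pulse s a q) t| ≤ K m * (|a| * 3 ^ (q * m)) := by
  choose B hB0 hB using exists_smoothTransition_bound
  refine ⟨fun m => ∑ i ∈ Finset.range (m + 1), m.choose i * B i * (2 * Real.pi) ^ (m - i),
    fun m => Finset.sum_nonneg fun i _ => by have := hB0 i; positivity, fun m s a q t => ?_⟩
  set lam : ℝ := 2 * Real.pi * 3 ^ q with hlam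
  have hlam0 : 0 ≤ lam := by positivity
  have h1 : ContDiff ℝ ∞ fun t : ℝ => Real.smoothTransition (s + 1 - t) :=
    Real.smoothTransition.contDiff.comp (contDiff_const.sub contDiff_id)
  have h2 : ContDiff ℝ ∞ fun t : ℝ => Real.cos (lam * t) :=
    Real.contDiff_cos.comp (contDiff_const.mul contDiff_id)
  have hd1 : ∀ i, |iteratedDeriv i (fun t : ℝ => Real.smoothTransition (s + 1 - t)) t| ≤ B i := by
    intro i
    rw [iteratedDeriv_comp_const_sub]
    simp only [smul_eq_mul, abs_mul, abs_pow, abs_neg, abs_one, one_pow, one_mul]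
    exact hB i _
  have hd2 : ∀ i, |iteratedDeriv i (fun t : ℝ => Real.cos (lam * t)) t| ≤ lam ^ i := by
    intro i
    rw [iteratedDeriv_comp_const_mul Real.contDiff_cos]
    simp only [abs_mul, abs_pow, abs_of_nonneg hlam0]
    exact mul_le_of_le_one_right (by positivity) (Real.abs_iteratedDeriv_cos_le_one i _)
  have hprod := norm_iteratedFDeriv_mul_le h1 h2 t (n := m) (by exact_mod_cast le_top)
  simp only [norm_iteratedFDeriv_eq_norm_iteratedDeriv, Real.norm_eq_abs] at hprod
  have hconst : iteratedDeriv m (pulse s a q) t = a * iteratedDeriv m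
      (fun t : ℝ => Real.smoothTransition (s + 1 - t) * Real.cos (lam * t)) t := by
    have := iteratedDeriv_const_mul_field (n := m) (x := t) a
      (fun t : ℝ => Real.smoothTransition (s + 1 - t) * Real.cos (lam * t))
    exact this
  rw [hconst, abs_mul, mul_left_comm]
  refine mul_le_mul_of_nonneg_left (hprod.trans ?_) (abs_nonneg _)
  rw [Finset.sum_mul]
  refine Finset.sum_le_sum fun i hi => ?_
  have h3 : lam ^ (m - i) ≤ (2 * Real.pi) ^ (m - i) * 3 ^ (q * m) := by
    rw [hlam, mul_pow, ← pow_mul]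
    gcongr
    · norm_num
    · exact Nat.sub_le _ _
  calc _ ≤ (m.choose i : ℝ) * B i * lam ^ (m - i) := by
        gcongr
        · exact mul_nonneg (Nat.cast_nonneg _) (hB0 i)
        · exact hd1 i
        · exact hd2 _
    _ ≤ m.choose i * B i * ((2 * Real.pi) ^ (m - i) * 3 ^ (q * m)) := by
        gcongr
        exact mul_nonneg (Nat.cast_nonneg _) (hB0 i)
    _ = _ := by ring

theorem tsum_smooth {f : ℕ → ℝ → ℝ} {v : ℕ → ℕ → ℝ} (hf : ∀ n, ContDiff ℝ ∞ (f n))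
    (hv : ∀ m, Summable (v m)) (hb : ∀ m n t, |iteratedDeriv m (f n) t| ≤ v m n) :
    (∀ m, iteratedDeriv m (fun t => ∑' n, f n t) = fun t => ∑' n, iteratedDeriv m (f n) t) ∧
      ContDiff ℝ ∞ fun t => ∑' n, f n t := by
  have hd : ∀ m n t, HasDerivAt (iteratedDeriv m (f n)) (iteratedDeriv (m + 1) (f n) t) t := by
    intro m n t
    have hd : Differentiable ℝ (iteratedDeriv m (f n)) :=
      (hf n).differentiable_iteratedDeriv m (WithTop.coe_lt_coe.2 (ENat.natCast_lt_top m))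
    rw [iteratedDeriv_succ]
    exact (hd t).hasDerivAt
  have hstep : ∀ m t, HasDerivAt (fun t => ∑' n, iteratedDeriv m (f n) t)
      (∑' n, iteratedDeriv (m + 1) (f n) t) t := fun m t =>
    hasDerivAt_tsum (g := fun n => iteratedDeriv m (f n))
      (g' := fun n => iteratedDeriv (m + 1) (f n)) (hv (m + 1)) (hd m) (hb (m + 1))
      (Summable.of_norm_bounded (hv m) fun n => hb m n 0) t
  have heq : ∀ m, iteratedDeriv m (fun t => ∑' n, f n t) =
      fun t => ∑' n, iteratedDeriv m (f n) t := by
    intro m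
    induction m with
    | zero => simp
    | succ m ih =>
      rw [iteratedDeriv_succ, ih]
      exact funext fun t => (hstep m t).deriv
  refine ⟨heq, contDiff_of_differentiable_iteratedDeriv fun m _ => ?_⟩
  rw [heq m]
  exact fun t => (hstep m t).differentiableAt

/-- The superposition of the pulses with cut-offs `s n`, amplitudes `a n`, frequencies `3 ^ κ n`. -/
noncomputable def wave (s a : ℕ → ℝ) (κ : ℕ → ℕ) (t : ℝ) : ℝ := ∑' n, pulse (s n) (a n) (κ n) t

/-- Amplitudes so small that the wave is smooth with slope at most `1 / 2`. -/
structure SmallAmp (K : ℕ → ℝ) (a : ℕ → ℝ) (κ : ℕ → ℕ) : Prop where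
  bound : ∀ m s a q t, |iteratedDeriv m (pulse s a q) t| ≤ K m * (|a| * 3 ^ (q * m))
  summable : ∀ m, Summable fun n => K m * (|a n| * 3 ^ (κ n * m))
  slope : ∑' n, K 1 * (|a n| * 3 ^ (κ n * 1)) ≤ 1 / 2

namespace SmallAmp

variable {K a : ℕ → ℝ} {κ : ℕ → ℕ} (h : SmallAmp K a κ) (s : ℕ → ℝ)
include h

theorem smooth : ContDiff ℝ ∞ (wave s a κ) :=
  (tsum_smooth (fun _ => pulse_smooth _ _ _) h.summable fun m _ t => h.bound m _ _ _ t).2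

theorem iteratedDeriv_eq (m : ℕ) : iteratedDeriv m (wave s a κ) =
    fun t => ∑' n, iteratedDeriv m (pulse (s n) (a n) (κ n)) t :=
  (tsum_smooth (fun _ => pulse_smooth _ _ _) h.summable fun m _ t => h.bound m _ _ _ t).1 m

theorem abs_iteratedDeriv_le (m : ℕ) (t : ℝ) :
    |iteratedDeriv m (wave s a κ) t| ≤ ∑' n, K m * (|a n| * 3 ^ (κ n * m)) := by
  rw [h.iteratedDeriv_eq]
  exact tsum_of_norm_bounded (f := fun n => iteratedDeriv m (pulse (s n) (a n) (κ n)) t)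
    (h.summable m).hasSum fun n => h.bound m _ _ _ t

theorem tame : Tame (wave s a κ) := by
  refine ⟨h.smooth s, fun m i _ => IsBigO.of_bound (∑' n, K i * (|a n| * 3 ^ (κ n * i))) ?_⟩
  exact Eventually.of_forall fun t => by
    simpa using h.abs_iteratedDeriv_le s i t

theorem abs_deriv_le (t : ℝ) : |deriv (wave s a κ) t| ≤ 1 / 2 := by
  rw [← iteratedDeriv_one]
  exact (h.abs_iteratedDeriv_le s 1 t).trans h.slope

theorem tendsto (m : ℕ) : Tendsto (iteratedDeriv m (wave s a κ)) atTop (𝓝 0) := by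
  rw [h.iteratedDeriv_eq]
  have := tendsto_tsum_of_dominated_convergence (𝓕 := atTop)
    (f := fun t n => iteratedDeriv m (pulse (s n) (a n) (κ n)) t) (g := fun _ => (0 : ℝ))
    (h.summable m) (fun n => ?_) (Eventually.of_forall fun t n => h.bound m _ _ _ t)
  · simpa using this
  refine tendsto_const_nhds.congr' ?_
  filter_upwards [eventually_gt_atTop (s n + 1)] with t ht
  have : pulse (s n) (a n) (κ n) =ᶠ[𝓝 t] fun _ => 0 := by
    filter_upwards [eventually_gt_nhds ht] with x hx using pulse_eq_zero _ _ hx.le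
  rw [this.iteratedDeriv_eq, iteratedDeriv_const]
  simp

theorem summable_pulse (t : ℝ) :
    Summable fun n => pulse (s n) (a n) (κ n) t :=
  Summable.of_norm_bounded (h.summable 0) fun n => by
    simpa using h.bound 0 (s n) (a n) (κ n) t

end SmallAmp

theorem wave_congr {s a a' : ℕ → ℝ} {κ : ℕ → ℕ} {t : ℝ} (h : ∀ n, a n = a' n ∨ s n + 1 ≤ t) :
    wave s a κ t = wave s a' κ t := by
  refine tsum_congr fun n => ?_
  rcases h n with h | h
  · rw [h]
  · rw [pulse_eq_zero _ _ h, pulse_eq_zero _ _ h]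

theorem abs_pulse_add_sub_le {s t τ a : ℝ} {q : ℕ} (ha : 0 ≤ a) (hτ : 0 ≤ τ) (ht : t + τ ≤ s)
    (z : ℤ) : |pulse s a q (t + τ) - pulse s a q t| ≤
      a * (2 * Real.pi * 3 ^ q) * |τ - z / 3 ^ q| := by
  rw [pulse_eq_cos _ _ ht, pulse_eq_cos _ _ (by linarith), ← mul_sub, abs_mul, abs_of_nonneg ha,
    mul_assoc a]
  refine mul_le_mul_of_nonneg_left ?_ ha
  have h3 : (3 : ℝ) ^ q ≠ 0 := by positivity
  have : 2 * Real.pi * 3 ^ q * (t + τ) =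
      2 * Real.pi * 3 ^ q * t + 2 * Real.pi * 3 ^ q * (τ - z / 3 ^ q) + z * (2 * Real.pi) := by
    field_simp
    ring
  rw [this, Real.cos_add_int_mul_two_pi]
  have h4 := Real.abs_cos_sub_cos_le (2 * Real.pi * 3 ^ q * t + 2 * Real.pi * 3 ^ q * (τ - z / 3 ^ q))
    (2 * Real.pi * 3 ^ q * t)
  rwa [add_sub_cancel_left, abs_mul, abs_of_nonneg (by positivity : 0 ≤ 2 * Real.pi * (3 : ℝ) ^ q)]
    at h4

theorem wave_add_one {s a : ℕ → ℝ} {κ : ℕ → ℕ} {t : ℝ} (ha : ∀ n, 0 ≤ a n)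
    (ht : ∀ n, a n = 0 ∨ t < s n - 1 ∨ s n + 1 < t) :
    wave s a κ (t + 1) = wave s a κ t := by
  refine tsum_congr fun n => ?_
  rcases ht n with h | h | h
  · simp [pulse, h]
  · have := abs_pulse_add_sub_le (s := s n) (t := t) (q := κ n) (ha n) zero_le_one (by linarith)
      (3 ^ κ n)
    have h3 : ((3 ^ κ n : ℤ) : ℝ) / 3 ^ κ n = 1 := by
      push_cast
      exact div_self (by positivity)
    rw [h3, sub_self, abs_zero, mul_zero] at this
    exact sub_eq_zero.1 (abs_nonpos_iff.1 this)
  · rw [pulse_eq_zero _ _ h.le, pulse_eq_zero _ _ (by linarith)]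

namespace Pulses

variable {σ : ℝ → ℝ} {w : ℕ → ℝ → ℝ} {k : ℕ} {η : ℝ} {c s r : ℕ → ℝ} {κ : ℕ → ℕ}
  (hp : Pulses σ w k η c s r κ)
include hp

theorem c_le_pow (hη : η ≤ 1) (n : ℕ) : c n ≤ (1 / 2) ^ n :=
  (hp.c_le n).trans (mul_le_of_le_one_left (by positivity) hη)

theorem c_le_one (hη : η ≤ 1) (n : ℕ) : c n ≤ 1 :=
  (hp.c_le_pow hη n).trans (pow_le_one₀ (by norm_num) (by norm_num))

theorem s_step (n : ℕ) : s n + 3 ≤ s (n + 1) := by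
  linarith [hp.s_le n, hp.r_le (n + 1)]

theorem s_strictMono : StrictMono s := strictMono_nat_of_lt_succ fun n => by
  linarith [hp.s_step n]

theorem le_s (n : ℕ) : (n : ℝ) + 1 ≤ s n := by linarith [hp.le_r n, hp.r_le n]

theorem amp_le (hη : η ≤ 1) {n m : ℕ} (hm : m ≤ n + 1) :
    c n ^ (n + 2) * 3 ^ (κ n * m) ≤ c n := by
  have hc := hp.c_pos n
  have h1 : c n ^ (n + 2) = c n * c n ^ (n + 1 - m) * c n ^ m := by
    rw [← pow_succ', ← pow_add]
    congr 1
    omega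
  have h2 : (3 ^ κ n * c n) ^ m ≤ 1 := pow_le_one₀ (by positivity) (hp.freq n)
  have h3 : c n ^ (n + 1 - m) ≤ 1 := pow_le_one₀ hc.le (hp.c_le_one hη n)
  calc _ = c n * c n ^ (n + 1 - m) * (3 ^ κ n * c n) ^ m := by rw [h1, mul_pow, ← pow_mul]; ring
    _ ≤ c n * 1 * 1 := by gcongr
    _ = c n := by ring

theorem smallAmp (hη : η ≤ 1) {K : ℕ → ℝ} (hK0 : ∀ m, 0 ≤ K m)
    (hK : ∀ m s a q t, |iteratedDeriv m (pulse s a q) t| ≤ K m * (|a| * 3 ^ (q * m)))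
    (hK1 : K 1 * η ≤ 1 / 4) {a : ℕ → ℝ} (ha : ∀ n, 0 ≤ a n) (hac : ∀ n, a n ≤ c n ^ (n + 2)) :
    SmallAmp K a κ := by
  have hle : ∀ {m n}, m ≤ n + 1 → |a n| * 3 ^ (κ n * m) ≤ c n := fun {m n} hm => by
    rw [abs_of_nonneg (ha n)]
    exact (mul_le_mul_of_nonneg_right (hac n) (by positivity)).trans (hp.amp_le hη hm)
  have hsum : ∀ m, Summable fun n => K m * (|a n| * 3 ^ (κ n * m)) := fun m => by
    refine Summable.of_norm_bounded_eventually_nat (g := fun n => K m * (1 / 2) ^ n)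
      ((summable_geometric_of_lt_one (by norm_num) (by norm_num)).mul_left _) ?_
    filter_upwards [eventually_ge_atTop m] with n hn
    rw [Real.norm_of_nonneg (mul_nonneg (hK0 m) (by positivity))]
    exact mul_le_mul_of_nonneg_left ((hle (by omega)).trans (hp.c_le_pow hη n)) (hK0 m)
  refine ⟨hK, hsum, ?_⟩
  have hg : HasSum (fun n : ℕ => K 1 * η * (1 / 2 : ℝ) ^ n) (K 1 * η * 2) :=
    hasSum_geometric_two.mul_left _
  refine (hasSum_le (fun n => ?_) (hsum 1).hasSum hg).trans (by linarith)
  rw [mul_assoc]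
  exact mul_le_mul_of_nonneg_left ((hle (by omega)).trans (hp.c_le n)) (hK0 1)

theorem wave_add_sub_isBigO (hη : η ≤ 1) {K a : ℕ → ℝ} (hw : SmallAmp K a κ)
    (ha : ∀ n, 0 ≤ a n) (hac : ∀ n, a n ≤ c n ^ (n + 2)) (hσ : ∀ t, 0 < σ t) {τ : ℝ}
    (hτ : τ ∈ Icc (0 : ℝ) 1)
    (hgood : ∀ n, ∃ z : ℤ, |τ - z / 3 ^ κ n| ≤ 2 * ((3 : ℝ) ^ κ (n + 1))⁻¹) (N : ℕ) :
    (fun t => wave s a κ (t + τ) - wave s a κ t) =O[atTop] fun t => σ t ^ N := by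
  set J := N * (k + 4) with hJ
  have hNJ : N ≤ J := Nat.le_mul_of_pos_right _ (by omega)
  refine IsBigO.of_bound (4 * Real.pi * 2) ?_
  filter_upwards [eventually_ge_atTop (s J + 1)] with t ht
  have ht0 : 0 ≤ t := by linarith [hp.le_s J, (Nat.cast_nonneg J : (0 : ℝ) ≤ J)]
  have hsN : 0 ≤ σ t ^ N := pow_nonneg (hσ t).le N
  have hpi := Real.pi_gt_three
  rw [Real.norm_of_nonneg hsN, wave, wave,
    ← (hw.summable_pulse s _).tsum_sub (hw.summable_pulse s _)]
  have hg : HasSum (fun n : ℕ => 4 * Real.pi * σ t ^ N * (1 / 2 : ℝ) ^ n)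
      (4 * Real.pi * σ t ^ N * 2) := hasSum_geometric_two.mul_left _
  rw [show 4 * Real.pi * 2 * σ t ^ N = 4 * Real.pi * σ t ^ N * 2 by ring]
  refine tsum_of_norm_bounded hg fun j => ?_
  have hc := hp.c_pos j
  have hc1 := hp.c_le_one hη j
  rw [Real.norm_eq_abs]
  rcases le_or_gt (s j + 1) t with h1 | h1
  · rw [pulse_eq_zero _ _ h1, pulse_eq_zero _ _ (h1.trans (by linarith [hτ.1])), sub_zero, abs_zero]
    positivity
  have hJj : J < j := by
    by_contra hj
    have := hp.s_strictMono.monotone (not_lt.1 hj)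
    linarith
  rcases le_or_gt (s j - 1) t with h2 | h2
  · have hwin := (hp.window j t ⟨h2, h1.le⟩).1
    have h3 : a j ≤ (1 / 2) ^ j * σ t ^ N := by
      calc a j ≤ c j ^ (j + 2) := hac j
        _ ≤ c j ^ (1 + J) := pow_le_pow_of_le_one hc.le hc1 (by omega)
        _ = c j * (c j ^ (k + 4)) ^ N := by rw [pow_add, pow_one, ← pow_mul, hJ, mul_comm N]
        _ ≤ (1 / 2) ^ j * σ t ^ N := by
          gcongr
          exact hp.c_le_pow hη j
    have h4 := abs_pulse_le (s j) (a j) (κ j) (t + τ)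
    have h5 := abs_pulse_le (s j) (a j) (κ j) t
    rw [abs_of_nonneg (ha j)] at h4 h5
    have h6 : 0 ≤ (1 / 2 : ℝ) ^ j * σ t ^ N := by positivity
    have h7 := abs_sub_le (pulse (s j) (a j) (κ j) (t + τ)) 0 (pulse (s j) (a j) (κ j) t)
    rw [sub_zero, zero_sub, abs_neg] at h7
    calc _ ≤ 2 * a j := by linarith
      _ ≤ 4 * Real.pi * ((1 / 2) ^ j * σ t ^ N) := by nlinarith
      _ = _ := by ring
  · obtain ⟨z, hz⟩ := hgood j
    obtain ⟨μ, hμ, hμ1, hμσ, hμκ⟩ := hp.gap j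
    have hst : μ ≤ σ t := hμσ t ⟨ht0, by linarith⟩
    have h3 := hp.amp_le hη (n := j) (m := 1) (by omega)
    rw [mul_one] at h3
    calc _ ≤ a j * (2 * Real.pi * 3 ^ κ j) * |τ - z / 3 ^ κ j| :=
          abs_pulse_add_sub_le (ha j) hτ.1 (by linarith [hτ.2]) z
      _ ≤ c j ^ (j + 2) * (2 * Real.pi * 3 ^ κ j) * (2 * μ ^ j) := by
          gcongr
          · exact hac j
          · exact hz.trans (by gcongr)
      _ = 4 * Real.pi * (c j ^ (j + 2) * 3 ^ κ j) * μ ^ j := by ring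
      _ ≤ 4 * Real.pi * (1 / 2) ^ j * σ t ^ N := by
          gcongr
          · exact h3.trans (hp.c_le_pow hη j)
          · exact (pow_le_pow_of_le_one hμ.le hμ1 (hNJ.trans hJj.le)).trans
              (pow_le_pow_left₀ hμ.le hst N)
      _ = _ := by ring

theorem eventually_outside {t : ℝ} (ht : ∀ n, t < s n - 1 ∨ s n + 1 < t) :
    ∀ᶠ x in 𝓝 t, ∀ n, x < s n - 1 ∨ s n + 1 < x := by
  obtain ⟨N, hN⟩ := exists_nat_gt (t + 1)
  have h1 : ∀ᶠ x in 𝓝 t, ∀ n ∈ Iio N, x < s n - 1 ∨ s n + 1 < x := by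
    refine (eventually_all_finite (finite_Iio N)).2 fun n _ => ?_
    rcases ht n with h | h
    · exact (eventually_lt_nhds h).mono fun x hx => Or.inl hx
    · exact (eventually_gt_nhds h).mono fun x hx => Or.inr hx
  filter_upwards [h1, eventually_lt_nhds (lt_add_one t)] with x hx hx1 n
  by_cases hn : n < N
  · exact hx n hn
  · have : (N : ℝ) ≤ n := by exact_mod_cast not_lt.1 hn
    exact Or.inl (by linarith [hp.le_s n])

theorem exists_half_shift {K a : ℕ → ℝ} (hw : SmallAmp K a κ) (ha : ∀ n, 0 ≤ a n) (n : ℕ) :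
    ∃ A, 2 * a n ≤ A ∧ ∀ (i : ℕ) (t : ℝ), 2 * 3 ^ κ n * t = i → r n - 1 ≤ t → t + 1 / 2 ≤ s n →
      wave s a κ t - wave s a κ (t + 1 / 2) = (-1) ^ i * A := by
  have hfreq : ∀ (i : ℕ) (t : ℝ), 2 * 3 ^ κ n * t = i → ∀ m, n ≤ m →
      Real.cos (2 * Real.pi * 3 ^ κ m * t) = (-1) ^ i := by
    intro i t hit m hm
    obtain ⟨d, hd⟩ := Nat.exists_eq_add_of_le (hp.strictMono.monotone hm)
    have : 2 * Real.pi * 3 ^ κ m * t = ((i * 3 ^ d : ℕ) : ℝ) * Real.pi := by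
      push_cast
      rw [← hit, hd, pow_add]
      ring
    rw [this, Real.cos_nat_mul_pi, mul_comm i, pow_mul, Odd.neg_one_pow (Odd.pow (by decide))]
  have hhalf : ∀ (m : ℕ) (t : ℝ), Real.cos (2 * Real.pi * 3 ^ κ m * (t + 1 / 2)) =
      -Real.cos (2 * Real.pi * 3 ^ κ m * t) := by
    intro m t
    have : 2 * Real.pi * 3 ^ κ m * (t + 1 / 2) =
        2 * Real.pi * 3 ^ κ m * t + ((3 ^ κ m : ℕ) : ℝ) * Real.pi := by
      push_cast
      ring
    rw [this, Real.cos_add_nat_mul_pi, Odd.neg_one_pow (Odd.pow (by decide)), neg_one_mul]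
  have hasum : Summable a := by
    have := (hw.summable_pulse (fun n => 0) 0)
    refine this.congr fun n => ?_
    rw [pulse_eq_cos _ _ le_rfl]
    simp
  set b : ℕ → ℝ := fun m => if m < n then 0 else 2 * a m with hb
  have hb0 : ∀ m, 0 ≤ b m := fun m => by
    simp only [hb]
    split_ifs
    · exact le_rfl
    · linarith [ha m]
  have hbs : Summable b := Summable.of_nonneg_of_le hb0 (fun m => by
    simp only [hb]
    split_ifs
    · linarith [ha m]
    · exact le_rfl) (hasum.mul_left 2)
  refine ⟨∑' m, b m, ?_, fun i t hit hrt hts => ?_⟩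
  · have := hbs.le_tsum n fun m _ => hb0 m
    simpa [hb] using this
  rw [wave, wave, ← (hw.summable_pulse s _).tsum_sub (hw.summable_pulse s _), ← tsum_mul_left]
  refine tsum_congr fun m => ?_
  rcases lt_or_ge m n with hm | hm
  · obtain ⟨l, rfl⟩ : ∃ l, n = l + 1 := ⟨n - 1, by omega⟩
    have h1 : s m ≤ s l := hp.s_strictMono.monotone (by omega)
    have h2 := hp.s_le l
    rw [pulse_eq_zero _ _ (by linarith), pulse_eq_zero _ _ (by linarith)]
    simp only [hb, if_pos hm, sub_zero, mul_zero]
  · have h1 : s n ≤ s m := hp.s_strictMono.monotone hm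
    rw [pulse_eq_cos _ _ (by linarith), pulse_eq_cos _ _ (by linarith), hhalf, hfreq i t hit m hm]
    simp only [hb, not_lt.2 hm, if_false]
    ring

end Pulses

/-- Times in `[0, 1]` that are very well approximated by multiples of each `3 ^ (-κ n)`. -/
def goodTimes (κ : ℕ → ℕ) : Set ℝ :=
  {τ | τ ∈ Icc (0 : ℝ) 1 ∧ ∀ n, ∃ z : ℤ, |τ - z / 3 ^ κ n| ≤ 2 * ((3 : ℝ) ^ κ (n + 1))⁻¹}

theorem one_mem_goodTimes (κ : ℕ → ℕ) : (1 : ℝ) ∈ goodTimes κ := by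
  refine ⟨by simp, fun n => ⟨3 ^ κ n, ?_⟩⟩
  push_cast
  rw [div_self (by positivity), sub_self, abs_zero]
  positivity

theorem exists_int_div {m n : ℕ} (h : m ≤ n) : ∃ z : ℤ, ((3 : ℝ) ^ m)⁻¹ = z / 3 ^ n :=
  ⟨3 ^ (n - m), by
    push_cast
    rw [eq_div_iff (by positivity), inv_mul_eq_iff_eq_mul₀ (by positivity), ← pow_add,
      Nat.add_sub_cancel' h]⟩

theorem inv_pow_mem_goodTimes {κ : ℕ → ℕ} (hκ : StrictMono κ) (i : ℕ) :
    ((3 : ℝ) ^ κ i)⁻¹ ∈ goodTimes κ := by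
  refine ⟨⟨by positivity, inv_le_one_of_one_le₀ (one_le_pow₀ (by norm_num))⟩, fun n => ?_⟩
  rcases le_or_gt i n with h | h
  · obtain ⟨z, hz⟩ := exists_int_div (hκ.monotone h)
    refine ⟨z, ?_⟩
    rw [hz, sub_self, abs_zero]
    positivity
  · refine ⟨0, ?_⟩
    have h1 : ((3 : ℝ) ^ κ i)⁻¹ ≤ ((3 : ℝ) ^ κ (n + 1))⁻¹ :=
      inv_anti₀ (by positivity) (pow_le_pow_right₀ (by norm_num) (hκ.monotone h))
    rw [Int.cast_zero, zero_div, sub_zero, abs_of_nonneg (by positivity)]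
    linarith [show (0 : ℝ) ≤ ((3 : ℝ) ^ κ (n + 1))⁻¹ by positivity]

theorem cantorFunction_mem_goodTimes {κ : ℕ → ℕ} (hκ : StrictMono κ) {b : ℕ → Bool}
    (hb : ∀ j, b j = true → ∃ i, κ (i + 1) = j) :
    Cardinal.cantorFunction (1 / 3) b ∈ goodTimes κ := by
  have hnn : ∀ j, 0 ≤ Cardinal.cantorFunctionAux (1 / 3) b j := fun j =>
    Cardinal.cantorFunctionAux_nonneg (by norm_num)
  have hle : ∀ j, Cardinal.cantorFunctionAux (1 / 3) b j ≤ (1 / 3) ^ j := fun j => by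
    cases h : b j
    · rw [Cardinal.cantorFunctionAux_false h]
      positivity
    · rw [Cardinal.cantorFunctionAux_true h]
  have hs : Summable (Cardinal.cantorFunctionAux (1 / 3) b) :=
    Cardinal.summable_cantor_function b (by norm_num) (by norm_num)
  have hgeo : HasSum (fun j : ℕ => (1 / 3 : ℝ) ^ j) (3 / 2) := by
    convert! hasSum_geometric_of_lt_one (r := (1 / 3 : ℝ)) (by norm_num) (by norm_num) using 1
    norm_num
  have htail : ∀ N, ∑' i, Cardinal.cantorFunctionAux (1 / 3) b (i + N) ≤ 3 / 2 * (1 / 3) ^ N :=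
    fun N => by
      refine hasSum_le (fun i => ?_) ((summable_nat_add_iff N).2 hs).hasSum
        (hgeo.mul_right ((1 / 3 : ℝ) ^ N))
      rw [← pow_add]
      exact hle _
  have htail0 : ∀ N, 0 ≤ ∑' i, Cardinal.cantorFunctionAux (1 / 3) b (i + N) := fun N =>
    tsum_nonneg fun i => hnn _
  have hsplit : ∀ N, Cardinal.cantorFunction (1 / 3) b =
      ∑ j ∈ Finset.range N, Cardinal.cantorFunctionAux (1 / 3) b j +
        ∑' i, Cardinal.cantorFunctionAux (1 / 3) b (i + N) := fun N =>
    (hs.sum_add_tsum_nat_add N).symm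
  refine ⟨⟨tsum_nonneg hnn, ?_⟩, fun n => ?_⟩
  · have h0 : b 0 = false := by
      by_contra h
      obtain ⟨i, hi⟩ := hb 0 (by simpa using h)
      have := hκ (Nat.succ_pos i)
      rw [Nat.succ_eq_add_one, hi] at this
      omega
    rw [hsplit 1, Finset.sum_range_one, Cardinal.cantorFunctionAux_false h0]
    linarith [htail 1]
  · have hterm : ∀ j ∈ Finset.range (κ (n + 1)), ∃ z : ℤ,
        Cardinal.cantorFunctionAux (1 / 3) b j = z / 3 ^ κ n := by
      intro j hj
      cases h : b j
      · exact ⟨0, by rw [Cardinal.cantorFunctionAux_false h]; simp⟩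
      · rw [Cardinal.cantorFunctionAux_true h]
        obtain ⟨i, rfl⟩ := hb j h
        rw [one_div, inv_pow]
        refine exists_int_div (hκ.monotone ?_)
        exact Nat.lt_succ_iff.1 (hκ.lt_iff_lt.1 (Finset.mem_range.1 hj))
    choose! z hz using hterm
    refine ⟨∑ j ∈ Finset.range (κ (n + 1)), z j, ?_⟩
    rw [hsplit (κ (n + 1)), Finset.sum_congr rfl hz, ← Finset.sum_div, Int.cast_sum,
      add_sub_cancel_left, abs_of_nonneg (htail0 _)]
    refine (htail _).trans ?_
    rw [one_div, inv_pow]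
    gcongr
    norm_num

theorem goodTimes_not_countable {κ : ℕ → ℕ} (hκ : StrictMono κ) : ¬ (goodTimes κ).Countable := by
  classical
  intro hc
  set B : (ℕ → Bool) → ℕ → Bool := fun A j => decide (∃ i, κ (i + 1) = j ∧ A i = true) with hB
  have hBinj : Function.Injective B := by
    intro A A' hAA
    funext i
    have h := congrFun hAA (κ (i + 1))
    have hval : ∀ A : ℕ → Bool, B A (κ (i + 1)) = A i := by
      intro A
      rw [Bool.eq_iff_iff]
      simp only [hB, decide_eq_true_eq]
      refine ⟨fun ⟨l, hl, hA⟩ => ?_, fun hA => ⟨i, rfl, hA⟩⟩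
      have := hκ.injective hl
      rwa [← Nat.succ_injective this]
    rwa [hval, hval] at h
  have hinj : Function.Injective fun A => Cardinal.cantorFunction (1 / 3) (B A) :=
    (Cardinal.cantorFunction_injective (by norm_num) (by norm_num)).comp hBinj
  have hmem : ∀ A, Cardinal.cantorFunction (1 / 3) (B A) ∈ goodTimes κ := fun A =>
    cantorFunction_mem_goodTimes hκ fun j hj => by
      simp only [hB, decide_eq_true_eq] at hj
      exact hj.imp fun i hi => hi.1
  have : Countable (goodTimes κ) := hc.to_subtype
  have h2 : Countable (ℕ → Bool) :=
    Function.Injective.countable (f := fun A => (⟨_, hmem A⟩ : goodTimes κ)) fun A A' hA =>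
      hinj (congrArg Subtype.val hA)
  have h3 : ¬ Countable (ℕ → Bool) := by
    rw [← Cardinal.mk_le_aleph0_iff, not_le, ← Cardinal.power_def, Cardinal.mk_nat,
      Cardinal.mk_bool]
    exact Cardinal.cantor Cardinal.aleph0
  exact h3 h2

theorem halfLineDiffeo_of_hasDerivWithinAt {f : ℝ → ℝ} (h0 : f 0 = 0)
    (hb : BijOn f (Ici 0) (Ici 0))
    (hd : ∀ x ∈ Ici (0 : ℝ), ∃ d : ℝ, 0 < d ∧ HasDerivWithinAt f d (Ici 0) x) :
    HalfLineDiffeo f := by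
  refine ⟨h0, hb, hd, fun y hy => ?_⟩
  set g := Function.invFunOn f (Ici 0) with hg
  have hgf : InvOn g f (Ici 0) (Ici 0) := hb.invOn_invFunOn
  have hgm : MapsTo g (Ici 0) (Ici 0) := hb.surjOn.mapsTo_invFunOn
  have hmono : StrictMonoOn f (Ici 0) := by
    refine strictMonoOn_of_deriv_pos (convex_Ici 0) (fun x hx => ?_) fun x hx => ?_
    · obtain ⟨d, -, h⟩ := hd x hx
      exact h.continuousWithinAt
    · rw [interior_Ici] at hx
      obtain ⟨d, hd0, h⟩ := hd x (mem_Ici.2 (le_of_lt hx))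
      rwa [(h.hasDerivAt (Ici_mem_nhds hx)).deriv]
  have hcont : ContinuousOn g (Ici 0) := by
    rw [continuousOn_iff_continuous_domRestrict]
    have hc : Continuous (MapsTo.restrict g (Ici 0) (Ici 0) hgm) := by
      refine Monotone.continuous_of_surjective (fun a b hab => ?_) fun x => ?_
      · change g a ≤ g b
        rw [← hmono.le_iff_le (hgm a.2) (hgm b.2), hgf.2 a.2, hgf.2 b.2]
        exact hab
      · exact ⟨⟨f x, hb.mapsTo x.2⟩, Subtype.ext (hgf.1 x.2)⟩
    exact continuous_subtype_val.comp hc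
  obtain ⟨d, hd0, h⟩ := hd (g y) (hgm hy)
  refine ⟨d⁻¹, ?_⟩
  rw [hasDerivWithinAt_iff_tendsto_slope] at h ⊢
  have hg' : Tendsto g (𝓝[Ici 0 \ {y}] y) (𝓝[Ici 0 \ {g y}] (g y)) := by
    refine tendsto_nhdsWithin_of_tendsto_nhds_of_eventually_within _
      ((hcont y hy).mono_left (nhdsWithin_mono _ sdiff_subset)) ?_
    filter_upwards [self_mem_nhdsWithin] with x hx
    exact ⟨hgm hx.1, fun hxy => hx.2 (hgf.2.injOn hx.1 hy hxy)⟩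
  refine ((h.comp hg').inv₀ hd0.ne').congr' ?_
  filter_upwards [self_mem_nhdsWithin] with x hx
  simp only [Function.comp, slope_def_field, hgf.2 hx.1, hgf.2 hy, inv_div]

theorem halfLineDiffeo_comp {f g : ℝ → ℝ} (hf : HalfLineDiffeo f) (hg : HalfLineDiffeo g) :
    HalfLineDiffeo fun x => f (g x) := by
  obtain ⟨hf0, hfb, hfd, -⟩ := hf
  obtain ⟨hg0, hgb, hgd, -⟩ := hg
  refine halfLineDiffeo_of_hasDerivWithinAt (by rw [hg0, hf0]) (hfb.comp hgb) fun x hx => ?_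
  obtain ⟨d, hd, h⟩ := hgd x hx
  obtain ⟨e, he, h2⟩ := hfd (g x) (hgb.mapsTo hx)
  exact ⟨e * d, mul_pos he hd, h2.comp x h hgb.mapsTo⟩

theorem halfLineDiffeo_congr {f g : ℝ → ℝ} (hf : HalfLineDiffeo f) (h : EqOn g f (Ici 0)) :
    HalfLineDiffeo g := by
  obtain ⟨hf0, hfb, hfd, -⟩ := hf
  refine halfLineDiffeo_of_hasDerivWithinAt ((h (mem_Ici.2 le_rfl)).trans hf0)
    (hfb.congr h.symm) fun x hx => ?_
  obtain ⟨d, hd, hder⟩ := hfd x hx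
  exact ⟨d, hd, hder.congr h (h hx)⟩

theorem crHalfLineDiffeo_comp {r : ℕ∞} {f g : ℝ → ℝ} (hf : CrHalfLineDiffeo r f)
    (hg : CrHalfLineDiffeo r g) : CrHalfLineDiffeo r fun x => f (g x) :=
  ⟨halfLineDiffeo_comp hf.1 hg.1, hf.2.comp hg.2 hg.1.2.1.mapsTo⟩

theorem crHalfLineDiffeo_congr {r : ℕ∞} {f g : ℝ → ℝ} (hf : CrHalfLineDiffeo r f)
    (h : EqOn g f (Ici 0)) : CrHalfLineDiffeo r g :=
  ⟨halfLineDiffeo_congr hf.1 h, hf.2.congr h⟩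

theorem crHalfLineDiffeo_mono {r r' : ℕ∞} {f : ℝ → ℝ} (hf : CrHalfLineDiffeo r f) (h : r' ≤ r) :
    CrHalfLineDiffeo r' f :=
  ⟨hf.1, hf.2.of_le (by exact_mod_cast h)⟩

theorem contDiffOn_inverse {f g : ℝ → ℝ} (hf : CrHalfLineDiffeo ⊤ f) (hg : HalfLineDiffeo g)
    (hfg : ∀ x ∈ Ici (0 : ℝ), f (g x) = x) : ContDiffOn ℝ ∞ g (Ici 0) := by
  obtain ⟨⟨-, -, hfd, -⟩, hfs⟩ := hf
  obtain ⟨-, hgb, hgd, -⟩ := hg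
  have hfs : ContDiffOn ℝ ∞ f (Ici 0) := hfs
  have hU : UniqueDiffOn ℝ (Ici (0 : ℝ)) := uniqueDiffOn_Ici 0
  have hpos : ∀ x ∈ Ici (0 : ℝ), 0 < derivWithin f (Ici 0) x := fun x hx => by
    obtain ⟨d, hd, h⟩ := hfd x hx
    rwa [h.derivWithin (hU x hx)]
  have hder : ∀ x ∈ Ici (0 : ℝ), derivWithin g (Ici 0) x = (derivWithin f (Ici 0) (g x))⁻¹ := by
    intro x hx
    obtain ⟨d, -, h⟩ := hgd x hx
    obtain ⟨e, he, h2⟩ := hfd (g x) (hgb.mapsTo hx)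
    have h3 : HasDerivWithinAt (fun x => f (g x)) (e * d) (Ici 0) x := h2.comp x h hgb.mapsTo
    have h4 : HasDerivWithinAt (fun x => f (g x)) 1 (Ici 0) x :=
      (hasDerivWithinAt_id x _).congr hfg (hfg x hx)
    rw [h.derivWithin (hU x hx), h2.derivWithin (hU _ (hgb.mapsTo hx))]
    exact eq_inv_of_mul_eq_one_right ((hU x hx).eq_deriv _ h3 h4)
  have hdiff : DifferentiableOn ℝ g (Ici 0) := fun x hx => by
    obtain ⟨d, -, h⟩ := hgd x hx
    exact h.differentiableWithinAt
  refine contDiffOn_infty.2 fun n => ?_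
  induction n with
  | zero => exact contDiffOn_zero.2 hdiff.continuousOn
  | succ n ih =>
    have h1 : ContDiffOn ℝ (n : ℕ∞) (derivWithin g (Ici 0)) (Ici 0) := by
      refine ContDiffOn.congr ?_ hder
      refine ContDiffOn.inv ?_ fun x hx => (hpos _ (hgb.mapsTo hx)).ne'
      exact ((contDiffOn_derivWithin hfs).of_le (by exact_mod_cast le_top)).comp ih hgb.mapsTo
    push_cast
    exact (contDiffOn_succ_iff_derivWithin hU).2 ⟨hdiff, by simp, h1⟩

/-- `t ↦ t + P t` is a smooth change of time tangent to the identity at infinity, with inverse `K`. -/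
structure Clock (P K : ℝ → ℝ) : Prop where
  tame : Tame P
  slope : ∀ t, |deriv P t| ≤ 1 / 2
  tendsto : ∀ m, Tendsto (iteratedDeriv m P) atTop (𝓝 0)
  smooth_inv : ContDiff ℝ ∞ K
  left_inv : ∀ t, K (t + P t) = t
  right_inv : ∀ u, K u + P (K u) = u

theorem hasDerivAt_id_add {P : ℝ → ℝ} (hP : ContDiff ℝ ∞ P) (t : ℝ) :
    HasDerivAt (fun t => t + P t) (1 + deriv P t) t :=
  (hasDerivAt_id t).add (differentiable_of_smooth hP t).hasDerivAt

theorem abs_sub_le_of_slope {P : ℝ → ℝ} (hP : ContDiff ℝ ∞ P) (hslope : ∀ t, |deriv P t| ≤ 1 / 2)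
    (a b : ℝ) : |a - b| ≤ 2 * |(a + P a) - (b + P b)| := by
  have h1 : |P a - P b| ≤ 1 / 2 * |a - b| :=
    convex_univ.norm_image_sub_le_of_norm_deriv_le (f := P)
      (fun x _ => differentiable_of_smooth hP x) (fun x _ => hslope x) (mem_univ b) (mem_univ a)
  have h2 : |a - b| ≤ |(a + P a) - (b + P b)| + |P a - P b| := by
    have := abs_sub ((a + P a) - (b + P b)) (P a - P b)
    rwa [show (a + P a) - (b + P b) - (P a - P b) = a - b by ring] at this
  linarith

theorem exists_clock {P : ℝ → ℝ} (hP : Tame P) (hslope : ∀ t, |deriv P t| ≤ 1 / 2)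
    (hlim : ∀ m, Tendsto (iteratedDeriv m P) atTop (𝓝 0)) : ∃ K, Clock P K := by
  have hd := hasDerivAt_id_add hP.smooth
  have hpos : ∀ t, 1 / 2 ≤ 1 + deriv P t := fun t => by linarith [(abs_le.1 (hslope t)).1]
  have hcont : Continuous fun t => t + P t := continuous_id.add hP.smooth.continuous
  have hmono : StrictMono fun t => t + P t := strictMono_of_hasDerivAt_pos hd fun t => by
    linarith [hpos t]
  have hbd : ∀ t, |P t| ≤ |P 0| + 1 / 2 * |t| := fun t => by
    have h1 : |P t - P 0| ≤ 1 / 2 * |t - 0| :=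
      convex_univ.norm_image_sub_le_of_norm_deriv_le (f := P)
        (fun x _ => differentiable_of_smooth hP.smooth x) (fun x _ => hslope x) (mem_univ 0)
        (mem_univ t)
    rw [sub_zero] at h1
    have := abs_add_le (P t - P 0) (P 0)
    rw [sub_add_cancel] at this
    linarith
  have htop : Tendsto (fun t => t + P t) atTop atTop := by
    refine tendsto_atTop_mono' atTop (f₁ := fun t => -|P 0| + 1 / 2 * t) ?_
      (tendsto_atTop_add_const_left _ _ (tendsto_id.const_mul_atTop (by norm_num)))
    filter_upwards [eventually_ge_atTop 0] with t ht
    have := hbd t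
    rw [abs_of_nonneg ht] at this
    linarith [neg_abs_le (P t)]
  have hbot : Tendsto (fun t => t + P t) atBot atBot := by
    refine tendsto_atBot_mono' atBot (f₁ := fun t => |P 0| + 1 / 2 * t) ?_
      (tendsto_atBot_add_const_left _ _ (tendsto_id.const_mul_atBot (r := (1 / 2 : ℝ)) (by norm_num)))
    filter_upwards [eventually_le_atBot 0] with t ht
    have := hbd t
    rw [abs_of_nonpos ht] at this
    linarith [le_abs_self (P t)]
  have hsurj := hcont.surjective htop hbot
  set e := hmono.orderIsoOfSurjective _ hsurj with he
  have hL : ∀ t, e.symm (t + P t) = t := fun t => e.symm_apply_apply t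
  have hR : ∀ u, e.symm u + P (e.symm u) = u := fun u => e.apply_symm_apply u
  refine ⟨e.symm, hP, hslope, hlim, ?_, hL, hR⟩
  exact e.toHomeomorph.contDiff_symm_deriv (f' := fun t => 1 + deriv P t)
    (fun t => ne_of_gt (by linarith [hpos t])) hd
    (contDiff_id.add hP.smooth)

namespace Clock

variable {P K : ℝ → ℝ} (h : Clock P K)
include h

theorem strictMono : StrictMono K := by
  have hmono : StrictMono fun t => t + P t :=
    strictMono_of_hasDerivAt_pos (hasDerivAt_id_add h.tame.smooth) fun t => by
      linarith [(abs_le.1 (h.slope t)).1]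
  intro a b hab
  refine hmono.lt_iff_lt.1 ?_
  simpa [h.right_inv] using hab

theorem tendsto_inv : Tendsto K atTop atTop :=
  h.strictMono.monotone.tendsto_atTop_atTop fun b => ⟨b + P b, (h.left_inv b).ge⟩

theorem hasDerivAt_inv (u : ℝ) : HasDerivAt K (1 + deriv P (K u))⁻¹ u :=
  (hasDerivAt_id_add h.tame.smooth (K u)).of_local_left_inverse h.smooth_inv.continuous.continuousAt
    (ne_of_gt (by linarith [(abs_le.1 (h.slope (K u))).1])) (Eventually.of_forall h.right_inv)

theorem tendsto_inv_sub : Tendsto (fun u => K u - u) atTop (𝓝 0) := by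
  have := ((h.tendsto 0).comp h.tendsto_inv).neg
  rw [neg_zero] at this
  refine this.congr fun u => ?_
  simp only [Function.comp, iteratedDeriv_zero]
  linarith [h.right_inv u]

theorem tendsto_deriv : Tendsto (deriv P) atTop (𝓝 0) := by
  simpa [iteratedDeriv_one] using h.tendsto 1

theorem tendsto_deriv_inv : Tendsto (deriv K) atTop (𝓝 1) := by
  have h1 : deriv K = fun u => (1 + deriv P (K u))⁻¹ := funext fun u => (h.hasDerivAt_inv u).deriv
  have h2 := ((h.tendsto_deriv.comp h.tendsto_inv).const_add 1).inv₀ (by norm_num)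
  rw [add_zero, inv_one] at h2
  rw [h1]
  exact h2

/-- The flow of the time change at time `τ` stays close to the translation by `τ`. -/
theorem abs_inv_sub_le (t τ : ℝ) :
    |K (t + P t + τ) - (t + τ)| ≤ 2 * |P (t + τ) - P t| := by
  have := abs_sub_le_of_slope h.tame.smooth h.slope (K (t + P t + τ)) (t + τ)
  rwa [h.right_inv, show t + P t + τ - (t + τ + P (t + τ)) = -(P (t + τ) - P t) by ring,
    abs_neg] at this

theorem shift_smooth (τ : ℝ) : ContDiff ℝ ∞ fun t => K (t + P t + τ) :=
  h.smooth_inv.comp ((contDiff_id.add h.tame.smooth).add contDiff_const)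

theorem tendsto_shift (τ : ℝ) : Tendsto (fun t => K (t + P t + τ)) atTop atTop := by
  refine h.tendsto_inv.comp (tendsto_atTop_add_const_right _ _ ?_)
  exact tendsto_id.atTop_add (by simpa using h.tendsto 0)

theorem tame_deriv_shift (τ : ℝ) : Tame (deriv fun t => K (t + P t + τ)) := by
  have hG' : deriv (fun t => t + P t) = fun t => 1 + deriv P t :=
    funext fun t => (hasDerivAt_id_add h.tame.smooth t).deriv
  refine Tame.of_conj (G := fun t => t + P t) (δ := 1 / 2) (τ := τ)
    (contDiff_id.add h.tame.smooth) ?_ (by norm_num) (fun t => ?_) (h.shift_smooth τ)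
    (h.tendsto_shift τ) fun t => h.right_inv _
  · rw [hG']
    exact (Tame.const 1).add h.tame.deriv
  · rw [hG']
    linarith [(abs_le.1 (h.slope t)).1]

end Clock

namespace TimeChart

variable {ξ X T : ℝ → ℝ} {C : ℝ} (h : TimeChart ξ X T C)
include h

theorem timeConj_pos (Ψ : ℝ → ℝ) {x : ℝ} (hx : 0 < x) : 0 < timeConj X T Ψ x := by
  rw [timeConj_of_pos hx]
  exact h.pos _

theorem timeConj_mem (Ψ : ℝ → ℝ) {x : ℝ} (hx : x ∈ Ici (0 : ℝ)) : timeConj X T Ψ x ∈ Ici (0 : ℝ) := by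
  rcases (mem_Ici.1 hx).eq_or_lt with rfl | hx
  · rw [timeConj_zero]
    exact hx
  · exact (h.timeConj_pos Ψ hx).le

theorem timeConj_comp (Ψ Φ : ℝ → ℝ) {x : ℝ} (hx : x ∈ Ici (0 : ℝ)) :
    timeConj X T Ψ (timeConj X T Φ x) = timeConj X T (fun t => Ψ (Φ t)) x := by
  rcases (mem_Ici.1 hx).eq_or_lt with rfl | hx
  · simp only [timeConj_zero]
  · rw [timeConj_of_pos (h.timeConj_pos Φ hx), timeConj_of_pos hx, timeConj_of_pos hx, h.left_inv]

theorem timeConj_id {x : ℝ} (hx : x ∈ Ici (0 : ℝ)) : timeConj X T (fun t => t) x = x := by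
  rcases (mem_Ici.1 hx).eq_or_lt with rfl | hx
  · exact timeConj_zero
  · rw [timeConj_of_pos hx, h.right_inv x hx]

theorem hasDerivAt_timeConj {Ψ : ℝ → ℝ} {x d : ℝ} (hx : 0 < x) (hΨ : HasDerivAt Ψ d (T x)) :
    HasDerivAt (timeConj X T Ψ) (ξ (X (Ψ (T x))) * (d * (ξ x)⁻¹)) x := by
  have h1 : HasDerivAt (fun y => X (Ψ (T y))) (ξ (X (Ψ (T x))) * (d * (ξ x)⁻¹)) x :=
    (h.hasDerivAt _).comp x (hΨ.comp x (h.hasDerivAt_time x hx))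
  refine h1.congr_of_eventuallyEq ?_
  filter_upwards [Ioi_mem_nhds hx] with y hy
  exact timeConj_of_pos hy

theorem timeConj_smoothOn {Ψ : ℝ → ℝ} (hΨ : ContDiff ℝ ∞ Ψ) :
    ContDiffOn ℝ ∞ (timeConj X T Ψ) (Ioi 0) := by
  have h1 : ContDiffOn ℝ ∞ (fun x => X (Ψ (T x))) (Ioi 0) :=
    (h.contDiff.comp hΨ).comp_contDiffOn h.contDiffOn_time
  exact h1.congr fun x hx => timeConj_of_pos hx

theorem tendsto_speed_ratio {Ψ : ℝ → ℝ} (hΨ : Tendsto (fun t => Ψ t - t) atTop (𝓝 0)) :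
    Tendsto (fun t => ξ (X (Ψ t)) * (ξ (X t))⁻¹) atTop (𝓝 1) := by
  have habs : Tendsto (fun t => C * |Ψ t - t|) atTop (𝓝 0) := by
    simpa using (hΨ.abs).const_mul C
  have hup := (Real.continuous_exp.tendsto 0).comp habs
  have hlow := (Real.continuous_exp.tendsto 0).comp (by simpa using habs.neg)
  rw [Real.exp_zero] at hup hlow
  refine tendsto_of_tendsto_of_tendsto_of_le_of_le hlow hup (fun t => ?_) fun t => ?_
  · have h1 := h.speed_le t (Ψ t)
    have h2 := h.speed_pos t
    have h3 : ξ (X (Ψ t)) * (ξ (X t))⁻¹ = -ξ (X (Ψ t)) / -ξ (X t) := by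
      rw [neg_div_neg_eq, div_eq_mul_inv]
    simp only [Function.comp]
    rw [h3, le_div_iff₀ h2, Real.exp_neg, inv_mul_le_iff₀ (Real.exp_pos _), abs_sub_comm]
    exact h1
  · have h1 := h.speed_le (Ψ t) t
    have h2 := h.speed_pos t
    have h3 : ξ (X (Ψ t)) * (ξ (X t))⁻¹ = -ξ (X (Ψ t)) / -ξ (X t) := by
      rw [neg_div_neg_eq, div_eq_mul_inv]
    simp only [Function.comp]
    rw [h3, div_le_iff₀ h2]
    exact h1

/-- A smooth change of time asymptotic to the identity in `C^1` is a `C^1` map of the half-line. -/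
theorem timeConj_contDiffOn_one {Ψ : ℝ → ℝ} (hΨ : ContDiff ℝ ∞ Ψ)
    (h0 : Tendsto (fun t => Ψ t - t) atTop (𝓝 0)) (h1 : Tendsto (deriv Ψ) atTop (𝓝 1)) :
    ContDiffOn ℝ 1 (timeConj X T Ψ) (Ici 0) ∧ HasDerivWithinAt (timeConj X T Ψ) 1 (Ici 0) 0 := by
  have hder : ∀ x, 0 < x → HasDerivAt (timeConj X T Ψ)
      (ξ (X (Ψ (T x))) * (deriv Ψ (T x) * (ξ x)⁻¹)) x := fun x hx =>
    h.hasDerivAt_timeConj hx (differentiable_of_smooth hΨ _).hasDerivAt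
  have hlimd : Tendsto (deriv (timeConj X T Ψ)) (𝓝[>] 0) (𝓝 1) := by
    have h2 := ((h.tendsto_speed_ratio h0).mul h1).comp h.tendsto_time
    rw [one_mul] at h2
    refine h2.congr' ?_
    filter_upwards [self_mem_nhdsWithin] with x hx
    rw [(hder x hx).deriv]
    simp only [Function.comp, h.right_inv x hx]
    ring
  have hlim : Tendsto (timeConj X T Ψ) (𝓝[>] 0) (𝓝 0) := by
    have hΨt : Tendsto Ψ atTop atTop := by
      have := tendsto_id.atTop_add h0
      refine this.congr fun t => ?_
      simp
    have h2 := (h.tendsto_zero.mono_right nhdsWithin_le_nhds).comp (hΨt.comp h.tendsto_time)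
    refine h2.congr' ?_
    filter_upwards [self_mem_nhdsWithin] with x hx
    rw [timeConj_of_pos hx]
    rfl
  constructor
  · have hflat : ContDiffOn ℝ ((1 : ℕ) : WithTop ℕ∞) (fun x => timeConj X T Ψ x - x) (Ici 0) := by
      refine contDiffOn_Ici_of_flat ((h.timeConj_smoothOn hΨ).sub contDiffOn_id)
        (by rw [timeConj_zero, sub_zero]) fun i hi => ?_
      interval_cases i
      · rw [iteratedDeriv_zero]
        simpa using hlim.sub (tendsto_id.mono_left nhdsWithin_le_nhds)
      · rw [iteratedDeriv_one]
        have h3 := hlimd.sub_const 1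
        rw [sub_self] at h3
        refine h3.congr' ?_
        filter_upwards [self_mem_nhdsWithin] with x hx
        have h4 : HasDerivAt (fun x => timeConj X T Ψ x - x) _ x := (hder x hx).sub (hasDerivAt_id x)
        rw [h4.deriv, (hder x hx).deriv]
    have h2 := hflat.add (contDiffOn_id (n := ((1 : ℕ) : WithTop ℕ∞)))
    simpa using h2
  · refine hasDerivWithinAt_Ici_of_tendsto_deriv (s := Ioi 0)
      (fun x hx => (hder x hx).differentiableAt.differentiableWithinAt) ?_ self_mem_nhdsWithin hlimd
    rw [ContinuousWithinAt, timeConj_zero]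
    exact hlim

/-- An invertible smooth change of time asymptotic to the identity in `C^1` is a `C^1`
diffeomorphism of the half-line. -/
theorem timeConj_crHalfLineDiffeo {Ψ Φ : ℝ → ℝ} (hΨ : ContDiff ℝ ∞ Ψ)
    (hpos : ∀ t, 0 < deriv Ψ t) (hΦ : ∀ t, Φ (Ψ t) = t) (hΦ' : ∀ t, Ψ (Φ t) = t)
    (h0 : Tendsto (fun t => Ψ t - t) atTop (𝓝 0)) (h1 : Tendsto (deriv Ψ) atTop (𝓝 1)) :
    CrHalfLineDiffeo 1 (timeConj X T Ψ) := by
  obtain ⟨hc, hd⟩ := h.timeConj_contDiffOn_one hΨ h0 h1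
  refine ⟨halfLineDiffeo_of_hasDerivWithinAt timeConj_zero ?_ fun x hx => ?_, by simpa using hc⟩
  · have hl : LeftInvOn (timeConj X T Φ) (timeConj X T Ψ) (Ici 0) := fun x hx => by
      rw [h.timeConj_comp _ _ hx]
      simp only [hΦ]
      exact h.timeConj_id hx
    have hr : LeftInvOn (timeConj X T Ψ) (timeConj X T Φ) (Ici 0) := fun x hx => by
      rw [h.timeConj_comp _ _ hx]
      simp only [hΦ']
      exact h.timeConj_id hx
    exact InvOn.bijOn ⟨hl, hr⟩ (fun x hx => h.timeConj_mem Ψ hx) fun x hx => h.timeConj_mem Φ hx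
  · rcases (mem_Ici.1 hx).eq_or_lt with rfl | hx
    · exact ⟨1, one_pos, hd⟩
    · refine ⟨_, ?_, (h.hasDerivAt_timeConj hx
        (differentiable_of_smooth hΨ (T x)).hasDerivAt).hasDerivWithinAt⟩
      refine mul_pos_of_neg_of_neg (h.neg _ (h.pos _)) (mul_neg_of_pos_of_neg (hpos _) ?_)
      exact inv_lt_zero.2 (h.neg x hx)

/-- Displacement of `X` under a bounded change of time. -/
theorem abs_sub_le {s t : ℝ} (hst : |s - t| ≤ 1) :
    |X s - X t| ≤ Real.exp C * -ξ (X t) * |s - t| := by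
  have hC := h.C_nonneg
  have hspeed : ∀ r ∈ uIcc t s, |ξ (X r)| ≤ Real.exp C * -ξ (X t) := fun r hr => by
    rw [abs_of_neg (h.neg _ (h.pos r))]
    refine (h.speed_le r t).trans (mul_le_mul_of_nonneg_right ?_ (h.speed_pos t).le)
    have hr1 : |r - t| ≤ |s - t| := by
      rw [uIcc_comm] at hr
      rw [abs_sub_comm r, abs_sub_comm s]
      exact abs_sub_right_of_mem_uIcc hr
    exact Real.exp_le_exp.2 (by nlinarith)
  have := (convex_uIcc t s).norm_image_sub_le_of_norm_hasDerivWithin_le (f := X)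
    (fun r _ => (h.hasDerivAt r).hasDerivWithinAt) hspeed left_mem_uIcc right_mem_uIcc
  simpa using this

end TimeChart

namespace TimeChart

variable {ξ X T : ℝ → ℝ} {C : ℝ} (h : TimeChart ξ X T C) {P K : ℝ → ℝ} (hK : Clock P K)
include h hK

theorem tame_shift (τ : ℝ) : Tame fun t => X (K (t + P t + τ)) :=
  h.tame.comp (hK.shift_smooth τ) (hK.tendsto_shift τ) (hK.tame_deriv_shift τ)

theorem shift_sub_isBigO {τ : ℝ} {N : ℕ}
    (hO : (fun t => P (t + τ) - P t) =O[atTop] fun t => (-ξ (X t)) ^ N) :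
    (fun t => X (K (t + P t + τ)) - X (t + τ)) =O[atTop] fun t => (-ξ (X t)) ^ N := by
  refine IsBigO.trans ?_ hO
  have hPt : Tendsto (fun t => P (t + τ) - P t) atTop (𝓝 0) := by
    have h1 : Tendsto P atTop (𝓝 0) := by simpa using hK.tendsto 0
    simpa using (h1.comp (tendsto_atTop_add_const_right atTop τ tendsto_id)).sub h1
  have hev : ∀ᶠ t in atTop, |P (t + τ) - P t| ≤ 1 / 2 := by
    have := hPt.abs
    rw [abs_zero] at this
    exact this.eventually_le_const (by norm_num)
  have hev2 : ∀ᶠ t in atTop, -ξ (X (t + τ)) ≤ 1 :=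
    (tendsto_atTop_add_const_right atTop τ tendsto_id).eventually h.speed_le_one
  refine IsBigO.of_bound (Real.exp C * 2) ?_
  filter_upwards [hev, hev2] with t ht ht2
  have h1 := hK.abs_inv_sub_le t τ
  have h2 := h.abs_sub_le (s := K (t + P t + τ)) (t := t + τ) (by linarith)
  simp only [Real.norm_eq_abs]
  calc _ ≤ _ := h2
    _ ≤ Real.exp C * 1 * (2 * |P (t + τ) - P t|) := by gcongr
    _ = _ := by ring

theorem timeConj_shift_smooth (hflat : derivWithin ξ (Ici 0) 0 = 0) {τ : ℝ}
    (hτ : τ ∈ Icc (0 : ℝ) 1)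
    (hO : ∀ N : ℕ, (fun t => P (t + τ) - P t) =O[atTop] fun t => (-ξ (X t)) ^ N) :
    ContDiffOn ℝ ∞ (timeConj X T fun t => K (t + P t + τ)) (Ici 0) :=
  h.contDiffOn_timeConj hflat (h.tame_shift hK τ) hτ fun n => h.shift_sub_isBigO hK (hO n)

theorem timeConj_clock : CrHalfLineDiffeo 1 (timeConj X T fun t => t + P t) := by
  have hd := hasDerivAt_id_add hK.tame.smooth
  have hd' : deriv (fun t => t + P t) = fun t => 1 + deriv P t := funext fun t => (hd t).deriv
  refine h.timeConj_crHalfLineDiffeo (contDiff_id.add hK.tame.smooth) (fun t => ?_) hK.left_inv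
    hK.right_inv ?_ ?_
  · rw [hd']
    linarith [(abs_le.1 (hK.slope t)).1]
  · simpa using hK.tendsto 0
  · rw [hd']
    simpa using hK.tendsto_deriv.const_add 1

theorem timeConj_clock_inv : CrHalfLineDiffeo 1 (timeConj X T K) := by
  refine h.timeConj_crHalfLineDiffeo hK.smooth_inv (fun t => ?_) hK.right_inv
    hK.left_inv hK.tendsto_inv_sub hK.tendsto_deriv_inv
  rw [(hK.hasDerivAt_inv t).deriv]
  exact inv_pos.2 (by linarith [(abs_le.1 (hK.slope (K t))).1])

end TimeChart

/-- Conjugation by `φ` transports a description of the centralizer. -/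
theorem centralizer_conj {r : ℕ∞} {φ ψ f₀ f : ℝ → ℝ} {F₀ F : ℝ → ℝ → ℝ}
    (hφ : CrHalfLineDiffeo r φ) (hψ : CrHalfLineDiffeo r ψ)
    (hψφ : ∀ x ∈ Ici (0 : ℝ), ψ (φ x) = x) (hφψ : ∀ x ∈ Ici (0 : ℝ), φ (ψ x) = x)
    (hf₀ : MapsTo f₀ (Ici 0) (Ici 0)) (hf : ∀ x ∈ Ici (0 : ℝ), f x = φ (f₀ (ψ x)))
    (hF : ∀ t, ∀ x ∈ Ici (0 : ℝ), F t x = φ (F₀ t (ψ x)))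
    (hZ : Centralizer r f₀ = {g | ∃ t, EqOn g (F₀ t) (Ici 0)}) :
    Centralizer r f = {g | ∃ t, EqOn g (F t) (Ici 0)} := by
  have mφ := hφ.1.2.1.mapsTo
  have mψ := hψ.1.2.1.mapsTo
  ext g
  constructor
  · rintro ⟨hg, hcomm⟩
    have mg := hg.1.2.1.mapsTo
    have hmem : (fun x => ψ (g (φ x))) ∈ Centralizer r f₀ := by
      refine ⟨crHalfLineDiffeo_comp hψ (crHalfLineDiffeo_comp hg hφ), fun x hx => ?_⟩
      have h1 : φ (f₀ x) = f (φ x) := by rw [hf _ (mφ hx), hψφ x hx]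
      simp only
      rw [h1, hcomm _ (mφ hx), hf _ (mg (mφ hx)), hψφ _ (hf₀ (mψ (mg (mφ hx))))]
    rw [hZ] at hmem
    obtain ⟨t, ht⟩ := hmem
    refine ⟨t, fun x hx => ?_⟩
    rw [hF t x hx, ← ht (mψ hx)]
    simp only
    rw [hφψ x hx, hφψ _ (mg hx)]
  · rintro ⟨t, ht⟩
    have hmem : F₀ t ∈ Centralizer r f₀ := by
      rw [hZ]
      exact ⟨t, fun x _ => rfl⟩
    obtain ⟨hF₀, hcomm⟩ := hmem
    have mF := hF₀.1.2.1.mapsTo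
    have hg : ∀ x ∈ Ici (0 : ℝ), g x = φ (F₀ t (ψ x)) := fun x hx => (ht hx).trans (hF t x hx)
    refine ⟨crHalfLineDiffeo_congr (crHalfLineDiffeo_comp hφ (crHalfLineDiffeo_comp hF₀ hψ)) hg,
      fun x hx => ?_⟩
    have mgx : φ (F₀ t (ψ x)) ∈ Ici (0 : ℝ) := mφ (mF (mψ hx))
    rw [hg x hx, hf x hx, hf _ mgx, hg _ (mφ (hf₀ (mψ hx))), hψφ _ (hf₀ (mψ hx)),
      hψφ _ (mF (mψ hx)), hcomm _ (mψ hx)]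

/-- The vector field generating the flow conjugated by the change of time `t ↦ t + P t`. -/
noncomputable def clockField (ξ T P : ℝ → ℝ) (x : ℝ) : ℝ :=
  if x ≤ 0 then 0 else ξ x * (1 + deriv P (T x))⁻¹

theorem clockField_of_pos {ξ T P : ℝ → ℝ} {x : ℝ} (hx : 0 < x) :
    clockField ξ T P x = ξ x * (1 + deriv P (T x))⁻¹ := if_neg (not_le.2 hx)

theorem clockField_zero {ξ T P : ℝ → ℝ} : clockField ξ T P 0 = 0 := if_pos le_rfl

/-- The flow conjugated by the change of time `t ↦ t + P t` with inverse `K`. -/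
noncomputable def clockFlow (X T P K : ℝ → ℝ) (t : ℝ) : ℝ → ℝ :=
  timeConj X T fun s => K (s + P s + t)

namespace TimeChart

variable {ξ X T : ℝ → ℝ} {C : ℝ} (h : TimeChart ξ X T C) {P K : ℝ → ℝ} (hK : Clock P K)
include h hK

theorem clockField_ne {x : ℝ} (hx : 0 < x) : clockField ξ T P x ≠ 0 := by
  rw [clockField_of_pos hx]
  exact mul_ne_zero (h.neg x hx).ne
    (inv_ne_zero (ne_of_gt (by linarith [(abs_le.1 (hK.slope (T x))).1])))

theorem isFlowOf_clockFlow : IsFlowOf (clockField ξ T P) (clockFlow X T P K) := by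
  intro x hx
  refine ⟨?_, fun t => ⟨h.timeConj_mem _ hx, ?_⟩⟩
  · simp only [clockFlow, add_zero, hK.left_inv]
    exact h.timeConj_id hx
  · rcases (mem_Ici.1 hx).eq_or_lt with rfl | hx
    · simp only [clockFlow, timeConj_zero, clockField_zero]
      exact hasDerivAt_const t 0
    · simp only [clockFlow, timeConj_of_pos hx]
      rw [clockField_of_pos (h.pos _), h.left_inv]
      exact (h.hasDerivAt _).comp t ((hK.hasDerivAt_inv _).comp_const_add _ t)

theorem contDiffOn_clockField (hflat : derivWithin ξ (Ici 0) 0 = 0) :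
    ContDiffOn ℝ 1 (clockField ξ T P) (Ici 0) := by
  have hne : ∀ t, 1 + deriv P t ≠ 0 := fun t =>
    ne_of_gt (by linarith [(abs_le.1 (hK.slope t)).1])
  have hP' : ContDiff ℝ ∞ (deriv P) := hK.tame.deriv.smooth
  have hs : ContDiffOn ℝ ∞ (clockField ξ T P) (Ioi 0) := by
    have h1 : ContDiffOn ℝ ∞ (fun x => ξ x * (1 + deriv P (T x))⁻¹) (Ioi 0) :=
      (h.smooth.mono Ioi_subset_Ici_self).mul
        ((contDiffOn_const.add (hP'.comp_contDiffOn h.contDiffOn_time)).inv fun x _ => hne _)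
    exact h1.congr fun x hx => clockField_of_pos hx
  have hinv : Tendsto (fun t => (1 + deriv P t)⁻¹) atTop (𝓝 1) := by
    have := (hK.tendsto_deriv.const_add 1).inv₀ (by norm_num)
    simpa using this
  have hP'' : Tendsto (deriv (deriv P)) atTop (𝓝 0) := by
    have := hK.tendsto 2
    rwa [iteratedDeriv_succ, iteratedDeriv_one] at this
  have hξ' : Tendsto (deriv ξ) (𝓝[>] 0) (𝓝 0) := by
    have h1 := (contDiffOn_derivWithin h.smooth).continuousOn 0 (mem_Ici.2 le_rfl)
    rw [ContinuousWithinAt, hflat] at h1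
    refine (h1.mono_left (nhdsWithin_mono _ Ioi_subset_Ici_self)).congr' ?_
    filter_upwards [self_mem_nhdsWithin] with x hx
    exact derivWithin_eq_deriv hx
  have hflatm : ContDiffOn ℝ ((1 : ℕ) : WithTop ℕ∞) (clockField ξ T P) (Ici 0) := by
    refine contDiffOn_Ici_of_flat hs clockField_zero fun i hi => ?_
    interval_cases i
    · rw [iteratedDeriv_zero]
      have h1 := h.tendsto_field.mul (hinv.comp h.tendsto_time)
      rw [zero_mul] at h1
      refine h1.congr' ?_
      filter_upwards [self_mem_nhdsWithin] with x hx
      exact (clockField_of_pos hx).symm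
    · rw [iteratedDeriv_one]
      have h1 := (hξ'.mul (hinv.comp h.tendsto_time)).sub
        ((hP''.mul (hinv.pow 2)).comp h.tendsto_time)
      rw [zero_mul, zero_mul, sub_zero] at h1
      refine h1.congr' ?_
      filter_upwards [self_mem_nhdsWithin] with x hx
      have hx : 0 < x := hx
      have hd : HasDerivAt (fun x => ξ x * (1 + deriv P (T x))⁻¹) _ x :=
        (((h.smooth.contDiffAt (Ici_mem_nhds hx)).differentiableAt (by simp)).hasDerivAt).mul
          (((((differentiable_of_smooth hP') (T x)).hasDerivAt.comp x
            (h.hasDerivAt_time x hx)).const_add 1).inv (hne (T x)))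
      have he : clockField ξ T P =ᶠ[𝓝 x] fun x => ξ x * (1 + deriv P (T x))⁻¹ := by
        filter_upwards [Ioi_mem_nhds hx] with y hy
        exact clockField_of_pos hy
      rw [he.deriv_eq, hd.deriv]
      have h2 := (h.neg x hx).ne
      have h3 := hne (T x)
      simp only [Function.comp]
      field_simp
      try ring
  exact_mod_cast hflatm

theorem clockFlow_add (s t : ℝ) {x : ℝ} (hx : x ∈ Ici (0 : ℝ)) :
    clockFlow X T P K s (clockFlow X T P K t x) = clockFlow X T P K (t + s) x := by
  rw [clockFlow, clockFlow, clockFlow, h.timeConj_comp _ _ hx]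
  simp only [hK.right_inv, add_assoc]

omit hK in
theorem clockFlow_eq_conj (t : ℝ) {x : ℝ} (hx : x ∈ Ici (0 : ℝ)) :
    clockFlow X T P K t x =
      timeConj X T K (timeConj X T (fun s => s + t) (timeConj X T (fun s => s + P s) x)) := by
  rw [h.timeConj_comp _ _ hx, h.timeConj_comp _ _ hx]
  rfl

theorem centralizer_clockFlow {f₀ : ℝ → ℝ} {F₀ : ℝ → ℝ → ℝ} (hf₀ : MapsTo f₀ (Ici 0) (Ici 0))
    (hF₀1 : ∀ x ∈ Ici (0 : ℝ), F₀ 1 x = f₀ x)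
    (hF₀ : ∀ t, ∀ x ∈ Ici (0 : ℝ), F₀ t x = timeConj X T (fun s => s + t) x)
    (hZ : Centralizer 1 f₀ = {g | ∃ t, EqOn g (F₀ t) (Ici 0)}) :
    Centralizer 1 (clockFlow X T P K 1) =
      {g | ∃ t, EqOn g (clockFlow X T P K t) (Ici 0)} := by
  have hF : ∀ t, ∀ x ∈ Ici (0 : ℝ), clockFlow X T P K t x =
      timeConj X T K (F₀ t (timeConj X T (fun s => s + P s) x)) := fun t x hx => by
    rw [h.clockFlow_eq_conj t hx, hF₀ t _ (h.timeConj_mem _ hx)]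
  refine centralizer_conj (h.timeConj_clock_inv hK) (h.timeConj_clock hK) (fun x hx => ?_)
    (fun x hx => ?_) hf₀ (fun x hx => ?_) hF hZ
  · rw [h.timeConj_comp _ _ hx]
    simp only [hK.right_inv]
    exact h.timeConj_id hx
  · rw [h.timeConj_comp _ _ hx]
    simp only [hK.left_inv]
    exact h.timeConj_id hx
  · rw [hF 1 x hx, hF₀1 _ (h.timeConj_mem _ hx)]

end TimeChart

theorem exists_second_deriv_ge {φ φ' φ'' : ℝ → ℝ} {x y z b : ℝ} (hxy : x < y) (hyz : y < z)
    (hb : 0 ≤ b) (h1 : ∀ u ∈ Icc x z, HasDerivAt φ (φ' u) u)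
    (h2 : ∀ u ∈ Icc x z, HasDerivAt φ' (φ'' u) u)
    (hx : φ x ≤ -b) (hy : b ≤ φ y) (hz : φ z ≤ -b) :
    ∃ u ∈ Ioo x z, b ≤ |φ'' u| * (z - x) ^ 2 := by
  obtain ⟨p, hp, hpe⟩ := exists_hasDerivAt_eq_slope φ φ' hxy
    (fun u hu => (h1 u ⟨hu.1, hu.2.trans hyz.le⟩).continuousAt.continuousWithinAt)
    fun u hu => h1 u ⟨hu.1.le, hu.2.le.trans hyz.le⟩
  obtain ⟨q, hq, hqe⟩ := exists_hasDerivAt_eq_slope φ φ' hyz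
    (fun u hu => (h1 u ⟨hxy.le.trans hu.1, hu.2⟩).continuousAt.continuousWithinAt)
    fun u hu => h1 u ⟨hxy.le.trans hu.1.le, hu.2.le⟩
  have hpq : p < q := hp.2.trans hq.1
  obtain ⟨u, hu, hue⟩ := exists_hasDerivAt_eq_slope φ' φ'' hpq
    (fun u hu => (h2 u ⟨hp.1.le.trans hu.1, hu.2.trans hq.2.le⟩).continuousAt.continuousWithinAt)
    fun u hu => h2 u ⟨hp.1.le.trans hu.1.le, hu.2.le.trans hq.2.le⟩
  refine ⟨u, ⟨hp.1.trans hu.1, hu.2.trans hq.2⟩, ?_⟩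
  have e1 : φ' p * (y - x) = φ y - φ x := by
    rw [hpe, div_mul_cancel₀ _ (sub_pos.2 hxy).ne']
  have e2 : φ' q * (z - y) = φ z - φ y := by
    rw [hqe, div_mul_cancel₀ _ (sub_pos.2 hyz).ne']
  have e3 : φ'' u * (q - p) = φ' q - φ' p := by
    rw [hue, div_mul_cancel₀ _ (sub_pos.2 hpq).ne']
  have hp0 : 0 ≤ φ' p := by
    by_contra! hcon
    nlinarith
  have hq0 : φ' q ≤ 0 := by
    by_contra! hcon
    nlinarith
  have h3 : φ' p ≤ |φ'' u| * (z - x) := by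
    have h4 : |φ'' u * (q - p)| = |φ'' u| * (q - p) := by rw [abs_mul, abs_of_pos (sub_pos.2 hpq)]
    have h5 := neg_abs_le (φ'' u * (q - p))
    have h6 : |φ'' u| * (q - p) ≤ |φ'' u| * (z - x) :=
      mul_le_mul_of_nonneg_left (by linarith [hp.1, hq.2]) (abs_nonneg _)
    linarith
  calc b ≤ φ' p * (y - x) := by rw [e1]; linarith
    _ ≤ φ' p * (z - x) := mul_le_mul_of_nonneg_left (by linarith) hp0
    _ ≤ |φ'' u| * (z - x) * (z - x) := mul_le_mul_of_nonneg_right h3 (by linarith)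
    _ = _ := by ring

/-- A smooth function on `[0,∞)` cannot oscillate near the origin at a scale at which its second
derivative would have to be unbounded. -/
theorem not_smoothOn_of_oscillation {φ : ℝ → ℝ}
    (hosc : ∀ M : ℝ, ∀ ρ > 0, ∃ x y z b e : ℝ, 0 < x ∧ x < y ∧ y < z ∧ z < ρ ∧ |e| = 1 ∧ 0 ≤ b ∧
      e * φ x ≤ -b ∧ b ≤ e * φ y ∧ e * φ z ≤ -b ∧ M * (z - x) ^ 2 < b) :
    ¬ ContDiffOn ℝ ∞ φ (Ici 0) := by
  intro hφ
  have hφ1 := contDiffOn_derivWithin hφ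
  have hφ2 := contDiffOn_derivWithin hφ1
  obtain ⟨M, hM⟩ := (isBigO_one_of_smoothOn hφ2).bound
  obtain ⟨ρ, hρ, hsub⟩ := mem_nhdsGT_iff_exists_Ioo_subset.1 hM
  obtain ⟨x, y, z, b, e, hx, hxy, hyz, hz, he, hb, h1, h2, h3, h4⟩ := hosc M ρ hρ
  obtain ⟨u, hu, hub⟩ := exists_second_deriv_ge (φ := fun u => e * φ u) hxy hyz hb
    (fun u hu => (hasDerivAt_of_smoothOn hφ (hx.trans_le hu.1)).const_mul e)
    (fun u hu => (hasDerivAt_of_smoothOn hφ1 (hx.trans_le hu.1)).const_mul e) h1 h2 h3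
  have h5 : ‖_‖ ≤ M * ‖(1 : ℝ)‖ := hsub ⟨hx.trans hu.1, hu.2.trans hz⟩
  rw [norm_one, mul_one, Real.norm_eq_abs] at h5
  rw [abs_mul, he, one_mul] at hub
  exact absurd (hub.trans (mul_le_mul_of_nonneg_right h5 (sq_nonneg _))) (not_le.2 h4)

namespace TimeChart

variable {ξ X T : ℝ → ℝ} {C : ℝ} (h : TimeChart ξ X T C)
include h

theorem translate_smooth (hflat : derivWithin ξ (Ici 0) 0 = 0) {τ : ℝ} (hτ : τ ∈ Icc (0 : ℝ) 1) :
    ContDiffOn ℝ ∞ (timeConj X T fun t => t + τ) (Ici 0) := by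
  refine h.contDiffOn_timeConj hflat (h.tame.comp (contDiff_id.add contDiff_const)
    (tendsto_atTop_add_const_right _ _ tendsto_id) ?_) hτ fun n => ?_
  · simpa using Tame.const 1
  · simp only [sub_self]
    exact isBigO_zero _ _

theorem speed_le_of_abs_le {s t b : ℝ} (hst : |s - t| ≤ b) :
    -ξ (X s) ≤ Real.exp (C * b) * -ξ (X t) :=
  (h.speed_le s t).trans (mul_le_mul_of_nonneg_right
    (Real.exp_le_exp.2 (mul_le_mul_of_nonneg_left hst h.C_nonneg)) (h.speed_pos t).le)

theorem le_speed_of_abs_le {s t b : ℝ} (hst : |s - t| ≤ b) :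
    Real.exp (-(C * b)) * -ξ (X t) ≤ -ξ (X s) := by
  rw [Real.exp_neg, inv_mul_le_iff₀ (Real.exp_pos _)]
  exact h.speed_le_of_abs_le (by rwa [abs_sub_comm])

variable {P K : ℝ → ℝ} (hK : Clock P K)
include hK

/-- A drop of `P` over half a unit of time makes the half-time map lag behind. -/
theorem half_shift_le {t r a : ℝ} (ha : 0 ≤ a) (ha1 : a ≤ 1) (htr : |t - r| ≤ 1)
    (hP : 2 * a ≤ P t - P (t + 1 / 2)) :
    X (K (t + P t + 1 / 2)) - X (t + 1 / 2) ≤ -(Real.exp (-(C * 3)) * a * -ξ (X r)) := by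
  rcases ha.eq_or_lt with rfl | ha
  · have h1 : t + 1 / 2 ≤ K (t + P t + 1 / 2) := by
      rw [← hK.left_inv (t + 1 / 2)]
      exact hK.strictMono.monotone (by linarith)
    have := h.strictAnti.antitone h1
    simp only [mul_zero, zero_mul, neg_zero]
    linarith
  have h1 : t + 1 / 2 + a ≤ K (t + P t + 1 / 2) := by
    rw [← hK.left_inv (t + 1 / 2 + a)]
    refine hK.strictMono.monotone ?_
    have h2 : |P (t + 1 / 2 + a) - P (t + 1 / 2)| ≤ 1 / 2 * |(t + 1 / 2 + a) - (t + 1 / 2)| :=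
      convex_univ.norm_image_sub_le_of_norm_deriv_le (f := P)
        (fun x _ => differentiable_of_smooth hK.tame.smooth x) (fun x _ => hK.slope x)
        (mem_univ _) (mem_univ _)
    rw [add_sub_cancel_left, abs_of_pos ha] at h2
    linarith [(abs_le.1 h2).2]
  have h2 := h.strictAnti.antitone h1
  obtain ⟨θ, hθ, he⟩ := h.exists_speed (t + 1 / 2) a ha
  have h3 := h.le_speed_of_abs_le (s := θ) (t := r) (b := 3) (by
    rw [abs_le] at htr ⊢
    constructor <;> linarith [hθ.1, hθ.2, htr.1, htr.2])
  have h4 := mul_le_mul_of_nonneg_right h3 ha.le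
  linarith

theorem le_half_shift {t r a : ℝ} (ha : 0 ≤ a) (ha1 : a ≤ 1) (htr : |t - r| ≤ 1)
    (hP : P t - P (t + 1 / 2) ≤ -(2 * a)) :
    Real.exp (-(C * 3)) * a * -ξ (X r) ≤ X (K (t + P t + 1 / 2)) - X (t + 1 / 2) := by
  rcases ha.eq_or_lt with rfl | ha
  · have h1 : K (t + P t + 1 / 2) ≤ t + 1 / 2 := by
      rw [← hK.left_inv (t + 1 / 2)]
      exact hK.strictMono.monotone (by linarith)
    have := h.strictAnti.antitone h1
    simp only [mul_zero, zero_mul]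
    linarith
  have h1 : K (t + P t + 1 / 2) ≤ t + 1 / 2 - a := by
    rw [← hK.left_inv (t + 1 / 2 - a)]
    refine hK.strictMono.monotone ?_
    have h2 : |P (t + 1 / 2) - P (t + 1 / 2 - a)| ≤ 1 / 2 * |(t + 1 / 2) - (t + 1 / 2 - a)| :=
      convex_univ.norm_image_sub_le_of_norm_deriv_le (f := P)
        (fun x _ => differentiable_of_smooth hK.tame.smooth x) (fun x _ => hK.slope x)
        (mem_univ _) (mem_univ _)
    rw [sub_sub_cancel, abs_of_pos ha] at h2
    linarith [(abs_le.1 h2).2]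
  have h2 := h.strictAnti.antitone h1
  obtain ⟨θ, hθ, he⟩ := h.exists_speed (t + 1 / 2 - a) a ha
  rw [sub_add_cancel] at he hθ
  have h3 := h.le_speed_of_abs_le (s := θ) (t := r) (b := 3) (by
    rw [abs_le] at htr ⊢
    constructor <;> linarith [hθ.1, hθ.2, htr.1, htr.2])
  have h4 := mul_le_mul_of_nonneg_right h3 ha.le
  linarith

end TimeChart

namespace TimeChart

variable {ξ X T : ℝ → ℝ} {C : ℝ} (h : TimeChart ξ X T C)
include h

theorem clockFlow_half_not_smooth (hflat : derivWithin ξ (Ici 0) 0 = 0) {w : ℕ → ℝ → ℝ} {k : ℕ}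
    {η : ℝ} {c s r : ℕ → ℝ} {κ : ℕ → ℕ} (hp : Pulses (fun t => -ξ (X t)) w k η c s r κ)
    (hη : η ≤ 1) {B a : ℕ → ℝ} (hw : SmallAmp B a κ) (ha : ∀ n, 0 ≤ a n) {N₀ : ℕ}
    (haN : ∀ n, N₀ ≤ n → a n = c n ^ (n + 2)) {K : ℝ → ℝ} (hK : Clock (wave s a κ) K) :
    ¬ ContDiffOn ℝ ∞ (clockFlow X T (wave s a κ) K (1 / 2)) (Ici 0) := by
  intro hs
  set P := wave s a κ with hP
  have hφ := hs.sub (h.translate_smooth hflat (τ := 1 / 2) (by norm_num))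
  refine not_smoothOn_of_oscillation ?_ hφ
  intro M ρ hρ
  have hc0 : Tendsto (fun n => |M| * Real.exp (C * 5) * c n) atTop (𝓝 0) := by
    have h1 : Tendsto c atTop (𝓝 0) :=
      squeeze_zero (fun n => (hp.c_pos n).le) (fun n => hp.c_le_pow hη n)
        (tendsto_pow_atTop_nhds_zero_of_lt_one (by norm_num) (by norm_num))
    simpa using h1.const_mul (|M| * Real.exp (C * 5))
  have hX0 : Tendsto (fun n : ℕ => X ((n : ℝ) - 1)) atTop (𝓝 0) :=
    (h.tendsto_zero.mono_right nhdsWithin_le_nhds).comp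
      (tendsto_atTop_add_const_right _ (-1) tendsto_natCast_atTop_atTop)
  obtain ⟨n, hnc, hnX, hnN, hn1⟩ := ((hc0.eventually_lt_const one_pos).and
    ((hX0.eventually_lt_const hρ).and ((eventually_ge_atTop N₀).and (eventually_ge_atTop 1)))).exists
  obtain ⟨A, hA, hshift⟩ := hp.exists_half_shift hw ha n
  set q : ℝ := 2 * 3 ^ κ n with hq
  have hq6 : 6 ≤ q := by
    have h1 : (3 : ℝ) ^ 1 ≤ 3 ^ κ n := pow_le_pow_right₀ (by norm_num)
      (hn1.trans (hp.strictMono.id_le n))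
    linarith
  have hq0 : 0 < q := by linarith
  have hr1 : 0 ≤ r n - 1 := by
    have h1 : (1 : ℝ) ≤ n := by exact_mod_cast hn1
    linarith [hp.le_r n]
  set i := ⌈q * (r n - 1)⌉₊ with hi
  have hi1 : q * (r n - 1) ≤ i := Nat.le_ceil _
  have hi2 : (i : ℝ) < q * (r n - 1) + 1 := Nat.ceil_lt_add_one (by positivity)
  set t : ℕ → ℝ := fun j => ((i + j : ℕ) : ℝ) / q with ht
  have htq : ∀ j, q * t j = ((i + j : ℕ) : ℝ) := fun j => mul_div_cancel₀ _ hq0.ne'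
  have htlow : ∀ j, r n - 1 ≤ t j := fun j => by
    have h1 : q * (r n - 1) ≤ q * t j := by
      rw [htq]
      push_cast
      linarith [(Nat.cast_nonneg j : (0 : ℝ) ≤ j)]
    exact le_of_mul_le_mul_left h1 hq0
  have htup : ∀ j ≤ 2, t j ≤ r n - 1 / 2 := fun j hj => by
    have hj' : (j : ℝ) ≤ 2 := by exact_mod_cast hj
    have h1 : q * t j ≤ q * (r n - 1 / 2) := by
      rw [htq]
      push_cast
      nlinarith
    exact le_of_mul_le_mul_left h1 hq0
  have htr : ∀ j ≤ 2, |t j - r n| ≤ 1 := fun j hj => by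
    rw [abs_le]
    constructor <;> linarith [htlow j, htup j hj]
  have hdiff : ∀ j ≤ 2, P (t j) - P (t j + 1 / 2) = (-1) ^ (i + j) * A := fun j hj =>
    hshift (i + j) (t j) (htq j) (htlow j) (by linarith [htup j hj, hp.r_le n])
  have hφX : ∀ j, (clockFlow X T P K (1 / 2) - timeConj X T fun t => t + 1 / 2) (X (t j)) =
      X (K (t j + P (t j) + 1 / 2)) - X (t j + 1 / 2) := fun j => by
    rw [Pi.sub_apply, clockFlow, timeConj_of_pos (h.pos _), timeConj_of_pos (h.pos _), h.left_inv]
  have hcn := hp.c_pos n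
  have han := haN n hnN
  have ha0 : 0 < a n := by
    rw [han]
    positivity
  have ha1 : a n ≤ 1 := by
    rw [han]
    exact pow_le_one₀ hcn.le (hp.c_le_one hη n)
  set b := Real.exp (-(C * 3)) * a n * -ξ (X (r n)) with hb
  have hσ := h.speed_pos (r n)
  have hlag : ∀ j ≤ 2, Even (i + j) →
      (clockFlow X T P K (1 / 2) - timeConj X T fun t => t + 1 / 2) (X (t j)) ≤ -b := by
    intro j hj he
    rw [hφX]
    refine h.half_shift_le hK ha0.le ha1 (htr j hj) ?_
    rw [hdiff j hj, he.neg_one_pow, one_mul]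
    exact hA
  have hlead : ∀ j ≤ 2, Odd (i + j) →
      b ≤ (clockFlow X T P K (1 / 2) - timeConj X T fun t => t + 1 / 2) (X (t j)) := by
    intro j hj he
    rw [hφX]
    refine h.le_half_shift hK ha0.le ha1 (htr j hj) ?_
    rw [hdiff j hj, he.neg_one_pow]
    linarith
  have htlt : ∀ j, t j < t (j + 1) := fun j => by
    simp only [ht]
    gcongr
    omega
  have hbpos : 0 ≤ b := by positivity
  have hsmall : M * (X (t 0) - X (t 2)) ^ 2 < b := by
    obtain ⟨θ, hθ, hθe⟩ := h.exists_speed (t 0) (t 2 - t 0) (by linarith [htlt 0, htlt 1])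
    rw [add_sub_cancel] at hθ hθe
    have h1 := h.speed_le_of_abs_le (s := θ) (t := r n) (b := 1) (by
      rw [abs_le]
      constructor <;> linarith [hθ.1, hθ.2, htlow 0, htup 2 le_rfl])
    have h2 : X (t 0) - X (t 2) ≤ Real.exp (C * 1) * -ξ (X (r n)) := by
      rw [hθe]
      refine le_trans ?_ h1
      exact mul_le_of_le_one_right (h.speed_pos θ).le (by linarith [htlow 0, htup 2 le_rfl])
    have h3 : 0 ≤ X (t 0) - X (t 2) := by
      rw [hθe]
      exact mul_nonneg (h.speed_pos θ).le (by linarith [hθ.1, hθ.2])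
    have h4 : -ξ (X (r n)) ≤ c n * a n := by
      have h5 := hp.speed_r n
      rw [han, ← pow_succ']
      exact h5
    have hexp : Real.exp (C * 1) ^ 2 = Real.exp (-(C * 3)) * Real.exp (C * 5) := by
      rw [← Real.exp_nat_mul, ← Real.exp_add]
      congr 1
      push_cast
      ring
    calc M * (X (t 0) - X (t 2)) ^ 2 ≤ |M| * (Real.exp (C * 1) * -ξ (X (r n))) ^ 2 := by
          gcongr
          exact le_abs_self M
      _ = (|M| * Real.exp (C * 5) * -ξ (X (r n))) * (Real.exp (-(C * 3)) * -ξ (X (r n))) := by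
          rw [mul_pow, hexp]
          ring
      _ ≤ (|M| * Real.exp (C * 5) * (c n * a n)) * (Real.exp (-(C * 3)) * -ξ (X (r n))) := by
          gcongr
      _ = (|M| * Real.exp (C * 5) * c n) * b := by
          rw [hb]
          ring
      _ < 1 * b := mul_lt_mul_of_pos_right hnc (by positivity)
      _ = b := one_mul b
  have hzρ : X (t 0) < ρ := by
    refine (h.strictAnti.antitone ?_).trans_lt hnX
    linarith [htlow 0, hp.le_r n]
  rcases Nat.even_or_odd i with he | ho
  · refine ⟨X (t 2), X (t 1), X (t 0), b, 1, h.pos _, h.strictAnti (htlt 1), h.strictAnti (htlt 0),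
      hzρ, abs_one, hbpos, ?_, ?_, ?_, hsmall⟩
    · rw [one_mul]
      exact hlag 2 le_rfl (he.add even_two)
    · rw [one_mul]
      exact hlead 1 (by norm_num) (he.add_one)
    · rw [one_mul]
      exact hlag 0 (by norm_num) he
  · refine ⟨X (t 2), X (t 1), X (t 0), b, -1, h.pos _, h.strictAnti (htlt 1), h.strictAnti (htlt 0),
      hzρ, by norm_num, hbpos, ?_, ?_, ?_, hsmall⟩
    · rw [neg_one_mul]
      exact neg_le_neg (hlead 2 le_rfl (ho.add_even even_two))
    · rw [neg_one_mul]
      exact le_neg_of_le_neg (hlag 1 (by norm_num) (ho.add_one))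
    · rw [neg_one_mul]
      exact neg_le_neg (hlead 0 (by norm_num) ho)

end TimeChart

namespace TimeChart

variable {ξ X T : ℝ → ℝ} {C : ℝ} (h : TimeChart ξ X T C) {P K : ℝ → ℝ} (hK : Clock P K)
include h hK

theorem clockFlow_zero {x : ℝ} (hx : x ∈ Ici (0 : ℝ)) : clockFlow X T P K 0 x = x := by
  simp only [clockFlow, add_zero, hK.left_inv]
  exact h.timeConj_id hx

theorem exists_smoothTimes (hd : ∀ t, HalfLineDiffeo (clockFlow X T P K t)) :
    ∃ S : AddSubgroup ℝ, (S : Set ℝ) = {t | CrHalfLineDiffeo ⊤ (clockFlow X T P K t)} := by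
  refine ⟨{ carrier := {t | CrHalfLineDiffeo ⊤ (clockFlow X T P K t)}
            add_mem' := fun {a b} ha hb => ?_
            zero_mem' := ⟨hd 0, contDiffOn_id.congr fun x hx => h.clockFlow_zero hK hx⟩
            neg_mem' := fun {a} ha => ⟨hd _, ?_⟩ }, rfl⟩
  · refine crHalfLineDiffeo_congr (crHalfLineDiffeo_comp hb ha) fun x hx => ?_
    exact (h.clockFlow_add hK b a hx).symm
  · refine contDiffOn_inverse ha (hd _) fun x hx => ?_
    rw [h.clockFlow_add hK a (-a) hx, neg_add_cancel, h.clockFlow_zero hK hx]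

end TimeChart

namespace TimeChart

variable {ξ X T : ℝ → ℝ} {C : ℝ} (h : TimeChart ξ X T C)
include h

theorem clockFlow_smooth_of_goodTimes (hflat : derivWithin ξ (Ici 0) 0 = 0) {w : ℕ → ℝ → ℝ} {k : ℕ}
    {η : ℝ} {c s r : ℕ → ℝ} {κ : ℕ → ℕ} (hp : Pulses (fun t => -ξ (X t)) w k η c s r κ)
    (hη : η ≤ 1) {B a : ℕ → ℝ} (hw : SmallAmp B a κ) (ha : ∀ n, 0 ≤ a n)
    (hac : ∀ n, a n ≤ c n ^ (n + 2)) {K : ℝ → ℝ} (hK : Clock (wave s a κ) K) {τ : ℝ}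
    (hτ : τ ∈ goodTimes κ) : ContDiffOn ℝ ∞ (clockFlow X T (wave s a κ) K τ) (Ici 0) :=
  h.timeConj_shift_smooth hK hflat hτ.1
    (hp.wave_add_sub_isBigO hη hw ha hac h.speed_pos hτ.1 hτ.2)

/-- At times where the perturbation does not change over one unit of time, the time-one map is
unchanged. -/
theorem iteratedDeriv_sub_eq_zero {P K : ℝ → ℝ} (hK : Clock P K) {x : ℝ} (hx : 0 < x)
    (hP : ∀ᶠ t in 𝓝 (T x), P (t + 1) = P t) (m : ℕ) :
    iteratedDeriv m (fun y => clockFlow X T P K 1 y - timeConj X T (fun t => t + 1) y) x = 0 := by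
  have h1 : (fun y => clockFlow X T P K 1 y - timeConj X T (fun t => t + 1) y) =ᶠ[𝓝 x]
      fun _ => 0 := by
    filter_upwards [(h.hasDerivAt_time x hx).continuousAt.eventually hP, Ioi_mem_nhds hx] with y hy hy0
    rw [clockFlow, timeConj_of_pos hy0, timeConj_of_pos hy0, ← hy,
      show T y + P (T y + 1) + 1 = T y + 1 + P (T y + 1) by ring, hK.left_inv, sub_self]
  rw [h1.iteratedDeriv_eq m]
  simp

omit h in
theorem inv_shift_congr {P P' K K' : ℝ → ℝ} (hK : Clock P K) (hK' : Clock P' K') {t : ℝ}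
    (hP : ∀ u, t ≤ u → P u = P' u) : K (t + P t + 1) = K' (t + P' t + 1) := by
  have h1 : t ≤ K (t + P t + 1) := by
    conv_lhs => rw [← hK.left_inv t]
    exact hK.strictMono.monotone (by linarith)
  rw [← hP t le_rfl]
  conv_rhs => rw [← hK.right_inv (t + P t + 1), hP _ h1, hK'.left_inv]

/-- The time-one map only depends on the perturbation downstream. -/
theorem iteratedDeriv_sub_congr {P P' K K' : ℝ → ℝ} (hK : Clock P K) (hK' : Clock P' K') {x R : ℝ}
    (hx : 0 < x) (hR : R < T x) (hP : ∀ u, R ≤ u → P u = P' u) (m : ℕ) (φ : ℝ → ℝ) :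
    iteratedDeriv m (fun y => clockFlow X T P K 1 y - φ y) x =
      iteratedDeriv m (fun y => clockFlow X T P' K' 1 y - φ y) x := by
  refine Filter.EventuallyEq.iteratedDeriv_eq m ?_
  filter_upwards [(h.hasDerivAt_time x hx).continuousAt.eventually (lt_mem_nhds hR),
    Ioi_mem_nhds hx] with y hy hy0
  rw [clockFlow, clockFlow, timeConj_of_pos hy0, timeConj_of_pos hy0,
    inv_shift_congr hK hK' fun u hu => hP u (hy.le.trans hu)]

theorem eventually_iteratedDeriv_le {P K : ℝ → ℝ} (hK : Clock P K)
    (hO : ∀ N : ℕ, (fun t => P (t + 1) - P t) =O[atTop] fun t => (-ξ (X t)) ^ N) (k : ℕ) {ε : ℝ}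
    (hε : 0 < ε) : ∀ᶠ t in atTop, ∀ m ≤ k,
      |iteratedDeriv m (fun y => clockFlow X T P K 1 y - timeConj X T (fun t => t + 1) y) (X t)| ≤
        ε * (-ξ (X t)) ^ (k + 4) := by
  have hu : Tame fun t => X (K (t + P t + 1)) - X (t + 1) := by
    refine (h.tame_shift hK 1).sub (h.tame.comp (contDiff_id.add contDiff_const)
      (tendsto_atTop_add_const_right _ _ tendsto_id) ?_)
    simpa using Tame.const 1
  refine (eventually_all_finite (finite_Iic k)).2 fun m _ => ?_
  have h1 := h.iteratedDeriv_isBigO_of_isBigO (m := m) (n := k + 5) hu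
    (g := fun y => clockFlow X T P K 1 y - timeConj X T (fun t => t + 1) y)
    (fun x hx => by rw [clockFlow, timeConj_of_pos hx, timeConj_of_pos hx])
    (h.shift_sub_isBigO hK (hO _))
  obtain ⟨A, hA⟩ := (h1.comp_tendsto h.tendsto_zero).bound
  have h2 : Tendsto (fun t => |A| * -ξ (X t)) atTop (𝓝 0) := by
    simpa using h.tendsto_speed.const_mul |A|
  filter_upwards [hA, h2.eventually_le_const hε] with t ht hte
  have hσ := h.speed_pos t
  simp only [Function.comp, Real.norm_eq_abs] at ht
  rw [abs_of_nonneg (pow_nonneg hσ.le (k + 5))] at ht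
  calc _ ≤ A * (-ξ (X t)) ^ (k + 5) := ht
    _ ≤ |A| * (-ξ (X t)) ^ (k + 5) := by
      gcongr
      exact le_abs_self A
    _ = (|A| * -ξ (X t)) * (-ξ (X t)) ^ (k + 4) := by ring
    _ ≤ ε * (-ξ (X t)) ^ (k + 4) := by gcongr

/-- The perturbation can be truncated so that the time-one map is close to the original one. -/
theorem exists_cutoff {w : ℕ → ℝ → ℝ} {k : ℕ} {η : ℝ} {c s r : ℕ → ℝ} {κ : ℕ → ℕ}
    (hp : Pulses (fun t => -ξ (X t)) w k η c s r κ) (hη : η ≤ 1) {B : ℕ → ℝ}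
    (hB : ∀ a : ℕ → ℝ, (∀ n, 0 ≤ a n) → (∀ n, a n ≤ c n ^ (n + 2)) → SmallAmp B a κ)
    (hw0 : ∀ m t, 0 ≤ w m t) {ε : ℝ} (hε : 0 < ε) :
    ∃ N₀ : ℕ, ∃ a : ℕ → ℝ, (∀ n, 0 ≤ a n) ∧ (∀ n, a n ≤ c n ^ (n + 2)) ∧
      (∀ n, N₀ ≤ n → a n = c n ^ (n + 2)) ∧ ∃ K, Clock (wave s a κ) K ∧ ∀ t, ∀ m ≤ k,
      |iteratedDeriv m (fun y => clockFlow X T (wave s a κ) K 1 y -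
        timeConj X T (fun t => t + 1) y) (X t)| ≤ ε * w m t := by
  have hclock : ∀ a : ℕ → ℝ, SmallAmp B a κ → ∃ K, Clock (wave s a κ) K := fun a hw =>
    exists_clock (hw.tame s) (hw.abs_deriv_le s) (hw.tendsto s)
  set a' : ℕ → ℝ := fun n => c n ^ (n + 2) with ha'
  have ha'0 : ∀ n, 0 ≤ a' n := fun n => pow_nonneg (hp.c_pos n).le _
  have hw' := hB a' ha'0 fun n => le_rfl
  obtain ⟨K', hK'⟩ := hclock a' hw'
  have hgood := one_mem_goodTimes κ
  obtain ⟨R, hR⟩ := eventually_atTop.1 (h.eventually_iteratedDeriv_le hK'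
    (hp.wave_add_sub_isBigO hη hw' ha'0 (fun n => le_rfl) h.speed_pos hgood.1 hgood.2) k hε)
  obtain ⟨N₀, hN₀⟩ := exists_nat_gt R
  set a : ℕ → ℝ := fun n => if n < N₀ then 0 else c n ^ (n + 2) with ha
  have ha0 : ∀ n, 0 ≤ a n := fun n => by
    simp only [ha]
    split_ifs
    exacts [le_rfl, ha'0 n]
  have hac : ∀ n, a n ≤ c n ^ (n + 2) := fun n => by
    simp only [ha]
    split_ifs
    exacts [ha'0 n, le_rfl]
  have haN : ∀ n, N₀ ≤ n → a n = c n ^ (n + 2) := fun n hn => if_neg (not_lt.2 hn)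
  have haz : ∀ n, n < N₀ → a n = 0 := fun n hn => if_pos hn
  obtain ⟨K, hK⟩ := hclock a (hB a ha0 hac)
  refine ⟨N₀, a, ha0, hac, haN, K, hK, fun t m hm => ?_⟩
  have hx := h.pos t
  have hout : (∀ᶠ u in 𝓝 t, ∀ n, a n = 0 ∨ u < s n - 1 ∨ s n + 1 < u) →
      |iteratedDeriv m (fun y => clockFlow X T (wave s a κ) K 1 y -
        timeConj X T (fun t => t + 1) y) (X t)| ≤ ε * w m t := fun hev => by
    rw [h.iteratedDeriv_sub_eq_zero hK hx, abs_zero]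
    · exact mul_nonneg hε.le (hw0 m t)
    · rw [h.left_inv]
      exact hev.mono fun u hu => wave_add_one ha0 hu
  by_cases htw : ∀ n, t < s n - 1 ∨ s n + 1 < t
  · exact hout ((hp.eventually_outside htw).mono fun u hu n => Or.inr (hu n))
  · push Not at htw
    obtain ⟨n, hn1, hn2⟩ := htw
    have hstep : ∀ {i j}, i < j → s i + 3 ≤ s j := fun {i j} hij => by
      have h1 := hp.s_strictMono.monotone (Nat.succ_le_of_lt hij)
      linarith [hp.s_le i, hp.r_le (i + 1)]
    rcases lt_or_ge n N₀ with hn | hn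
    · refine hout ?_
      have ht : t < s N₀ - 1 := by linarith [hstep hn]
      filter_upwards [eventually_lt_nhds ht] with u hu j
      rcases lt_or_ge j N₀ with hj | hj
      · exact Or.inl (haz j hj)
      · exact Or.inr (Or.inl (by linarith [hp.s_strictMono.monotone hj]))
    · have hsn := hp.s_strictMono.monotone hn
      rw [h.iteratedDeriv_sub_congr hK hK' hx (R := s N₀ - 2) (by rw [h.left_inv]; linarith)
        fun u hu => wave_congr fun j => ?_]
      · have h1 := hR t (by linarith [hp.le_s N₀]) m hm
        exact h1.trans (mul_le_mul_of_nonneg_left ((hp.window n t ⟨hn1, hn2⟩).2 m hm) hε.le)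
      · rcases lt_or_ge j N₀ with hj | hj
        · exact Or.inr (by linarith [hstep hj])
        · exact Or.inl (haN j hj)

end TimeChart

theorem abs_iteratedDerivWithin_le {u g : ℝ → ℝ} (hu : ContDiffOn ℝ ∞ u (Ici 0))
    (hg : ContDiffOn ℝ ∞ g (Ici 0)) {m : ℕ} {ε : ℝ}
    (hle : ∀ x, 0 < x → |iteratedDerivWithin m u (Ici 0) x| ≤
      ε * |iteratedDerivWithin m g (Ici 0) x|) {x : ℝ} (hx : x ∈ Ici (0 : ℝ)) :
    |iteratedDerivWithin m u (Ici 0) x| ≤ ε * |iteratedDerivWithin m g (Ici 0) x| := by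
  rcases (mem_Ici.1 hx).eq_or_lt with rfl | hx
  · have hlim : ∀ {v : ℝ → ℝ}, ContDiffOn ℝ ∞ v (Ici 0) →
        Tendsto (fun x => |iteratedDerivWithin m v (Ici 0) x|) (𝓝[>] 0)
          (𝓝 |iteratedDerivWithin m v (Ici 0) 0|) := fun hv =>
      (((iteratedDerivWithin_smooth hv m).continuousOn 0 (mem_Ici.2 le_rfl)).mono
        Ioi_subset_Ici_self).abs
    refine le_of_tendsto_of_tendsto (hlim hu) ((hlim hg).const_mul ε) ?_
    filter_upwards [self_mem_nhdsWithin] with y hy using hle y hy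
  · exact hle x hx

theorem dense_of_goodTimes {κ : ℕ → ℕ} (hκ : StrictMono κ) {S : AddSubgroup ℝ}
    (hS : goodTimes κ ⊆ S) : Dense (S : Set ℝ) := by
  refine AddSubgroup.dense_of_not_isolated_zero S fun ε hε => ?_
  obtain ⟨n, hn⟩ := exists_pow_lt_of_lt_one hε (show ((3 : ℝ)⁻¹) < 1 by norm_num)
  refine ⟨((3 : ℝ) ^ κ n)⁻¹, hS (inv_pow_mem_goodTimes hκ n), by positivity, ?_⟩
  rw [← inv_pow]
  exact (pow_le_pow_of_le_one (by norm_num) (by norm_num) (hκ.id_le n)).trans_lt hn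

theorem centralizer_top_eq {f : ℝ → ℝ} {F : ℝ → ℝ → ℝ}
    (hZ : Centralizer 1 f = {g | ∃ t, EqOn g (F t) (Ici 0)}) :
    Centralizer ⊤ f = {g | ∃ t, CrHalfLineDiffeo ⊤ (F t) ∧ EqOn g (F t) (Ici 0)} := by
  ext g
  constructor
  · rintro ⟨hg, hcomm⟩
    have hmem : g ∈ Centralizer 1 f := ⟨crHalfLineDiffeo_mono hg le_top, hcomm⟩
    rw [hZ] at hmem
    obtain ⟨t, ht⟩ := hmem
    exact ⟨t, crHalfLineDiffeo_congr hg ht.symm, ht⟩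
  · rintro ⟨t, hF, ht⟩
    have hmem : g ∈ Centralizer 1 f := by
      rw [hZ]
      exact ⟨t, ht⟩
    exact ⟨crHalfLineDiffeo_congr hF ht, hmem.2⟩

end HalfLine

/-- Any smooth contracting diffeomorphism `f₀` of `[0,∞)` with a smooth, `C^1`-bounded
Szekeres vector field and satisfying the oscillation condition can be approximated (in the
weighted `C^k` sense) by smooth diffeomorphisms `f` whose centralizer `Z^∞_f` is a proper,
dense and uncountable subgroup of the one-parameter group `Z^1_f`. -/
theorem statement5 (f₀ : ℝ → ℝ)
    (hf₀ : CrHalfLineDiffeo ⊤ f₀) (hf₀0 : f₀ 0 = 0)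
    (hf₀_contr : ∀ x : ℝ, 0 < x → 0 < f₀ x ∧ f₀ x < x)
    (ξ₀ : ℝ → ℝ) (F₀ : ℝ → ℝ → ℝ)
    (hξ₀_smooth : ContDiffOn ℝ ((⊤ : ℕ∞) : WithTop ℕ∞) ξ₀ (Set.Ici 0))
    (hξ₀0 : ξ₀ 0 = 0) (hξ₀_ne : ∀ x : ℝ, 0 < x → ξ₀ x ≠ 0)
    (hξ₀_bdd : ∃ C : ℝ, ∀ x ∈ Set.Ici (0 : ℝ),
      |ξ₀ x| + |derivWithin ξ₀ (Set.Ici 0) x| ≤ C)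
    (hF₀ : IsFlowOf ξ₀ F₀)
    (hF₀1 : ∀ x ∈ Set.Ici (0 : ℝ), F₀ 1 x = f₀ x)
    (hSzekeres : Centralizer 1 f₀ =
      {g : ℝ → ℝ | ∃ t : ℝ, Set.EqOn g (F₀ t) (Set.Ici 0)})
    -- the oscillation condition:
    -- `limsup_{x→0⁺} sup_{0<y≤x} |log(x−f₀x)|/|log(y−f₀y)| = +∞`
    (hosc : ∀ M : ℝ, ∀ ε : ℝ, 0 < ε → ∃ x : ℝ, 0 < x ∧ x < ε ∧
      ∃ y : ℝ, 0 < y ∧ y ≤ x ∧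
        M < |Real.log (x - f₀ x)| / |Real.log (y - f₀ y)|) :
    ∀ (k : ℕ) (ε : ℝ), 0 < ε →
      ∃ f : ℝ → ℝ, CrHalfLineDiffeo ⊤ f ∧
        (∀ m ≤ k, ∀ x ∈ Set.Ici (0 : ℝ),
          |iteratedDerivWithin m (fun y => f y - f₀ y) (Set.Ici 0) x| ≤
            ε * |iteratedDerivWithin m (fun y => f₀ y - y) (Set.Ici 0) x|) ∧
        ∃ (ξ : ℝ → ℝ) (F : ℝ → ℝ → ℝ),
          ContDiffOn ℝ 1 ξ (Set.Ici 0) ∧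
          ξ 0 = 0 ∧ (∀ x : ℝ, 0 < x → ξ x ≠ 0) ∧
          IsFlowOf ξ F ∧
          (∀ x ∈ Set.Ici (0 : ℝ), F 1 x = f x) ∧
          Centralizer 1 f = {g : ℝ → ℝ | ∃ t : ℝ, Set.EqOn g (F t) (Set.Ici 0)} ∧
          Centralizer ⊤ f = {g : ℝ → ℝ | ∃ t : ℝ,
            CrHalfLineDiffeo ⊤ (F t) ∧ Set.EqOn g (F t) (Set.Ici 0)} ∧
          ∃ S : AddSubgroup ℝ,
            (S : Set ℝ) = {t : ℝ | CrHalfLineDiffeo ⊤ (F t)} ∧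
            (S : Set ℝ) ≠ Set.univ ∧ Dense (S : Set ℝ) ∧
            ¬ (S : Set ℝ).Countable := by
  classical
  intro k ε hε
  have hF₀C : ∀ t, CrHalfLineDiffeo 1 (F₀ t) := fun t => by
    have : F₀ t ∈ Centralizer 1 f₀ := by
      rw [hSzekeres]
      exact ⟨t, fun x _ => rfl⟩
    exact this.1
  obtain ⟨X, T, C, h, hF₀X⟩ := HalfLine.exists_timeChart hf₀_contr hξ₀_smooth hξ₀0 hξ₀_ne hξ₀_bdd
    hF₀ hF₀1 fun t => (hF₀C t).1
  have hF₀conj : ∀ t, ∀ x ∈ Ici (0 : ℝ), F₀ t x = HalfLine.timeConj X T (fun s => s + t) x := by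
    intro t x hx
    rcases (mem_Ici.1 hx).eq_or_lt with rfl | hx
    · rw [HalfLine.timeConj_zero, (hF₀C t).1.1]
    · rw [hF₀X t x hx, HalfLine.timeConj_of_pos hx]
  have hf₀conj : ∀ x ∈ Ici (0 : ℝ), f₀ x = HalfLine.timeConj X T (fun s => s + 1) x :=
    fun x hx => by rw [← hF₀1 x hx, hF₀conj 1 x hx]
  set g : ℝ → ℝ := fun y => f₀ y - y with hgdef
  have hgs : ContDiffOn ℝ ((⊤ : ℕ∞) : WithTop ℕ∞) g (Ici 0) := hf₀.2.sub contDiffOn_id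
  have hg0 : g 0 = 0 := by simp [hgdef, hf₀0]
  have hgX : ∀ t, g (X t) = X (t + 1) - X t := fun t => by
    simp only [hgdef]
    rw [hf₀conj _ (h.pos t).le, HalfLine.timeConj_of_pos (h.pos t), h.left_inv]
  have hgosc : ∀ M : ℕ, ∀ δ > 0, ∃ x, 0 < x ∧ x < δ ∧ ∃ y, 0 < y ∧ y ≤ x ∧ |g x| < |g y| ^ M :=
    fun M δ hδ => HalfLine.exists_pow_gt hf₀_contr hosc M hδ
  have hgflat := HalfLine.iteratedDerivWithin_eq_zero_of_osc hgs (hgosc 2) hg0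
  have hflat : derivWithin ξ₀ (Ici 0) 0 = 0 := by
    refine h.derivWithin_eq_zero hgX ?_ hg0
    have h1 := (hgs.differentiableOn (by simp) 0 (mem_Ici.2 le_rfl)).hasDerivWithinAt
    rwa [← iteratedDerivWithin_one, hgflat 1] at h1
  obtain ⟨B, hB0, hB⟩ := HalfLine.exists_pulse_bound
  set η : ℝ := min 1 (1 / (4 * (B 1 + 1))) with hη
  have hB1 := hB0 1
  have hηpos : 0 < η := lt_min one_pos (by positivity)
  have hη1 : η ≤ 1 := min_le_left _ _
  have hBη : B 1 * η ≤ 1 / 4 := by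
    calc B 1 * η ≤ (B 1 + 1) * (1 / (4 * (B 1 + 1))) :=
          mul_le_mul (by linarith) (min_le_right _ _) hηpos.le (by linarith)
      _ = 1 / 4 := by field_simp
  obtain ⟨c, s, r, κ, hp⟩ := h.exists_pulses hgX hgs hgosc hgflat k hηpos
  have hamp : ∀ a : ℕ → ℝ, (∀ n, 0 ≤ a n) → (∀ n, a n ≤ c n ^ (n + 2)) →
      HalfLine.SmallAmp B a κ := fun a ha hac => hp.smallAmp hη1 hB0 hB hBη ha hac
  obtain ⟨N₀, a, ha, hac, haN, K, hK, hle⟩ := h.exists_cutoff hp hη1 hamp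
    (fun m t => abs_nonneg _) hε
  have hw := hamp a ha hac
  set F := HalfLine.clockFlow X T (HalfLine.wave s a κ) K with hF
  have hZ : Centralizer 1 (F 1) = {g | ∃ t, EqOn g (F t) (Ici 0)} :=
    h.centralizer_clockFlow hK hf₀.1.2.1.mapsTo hF₀1 hF₀conj hSzekeres
  have hFC : ∀ t, HalfLineDiffeo (F t) := fun t => by
    have : F t ∈ Centralizer 1 (F 1) := by
      rw [hZ]
      exact ⟨t, fun x _ => rfl⟩
    exact this.1.1
  have hgood : HalfLine.goodTimes κ ⊆ {t | CrHalfLineDiffeo ⊤ (F t)} := fun t ht =>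
    ⟨hFC t, h.clockFlow_smooth_of_goodTimes hflat hp hη1 hw ha hac hK ht⟩
  have hF1 : CrHalfLineDiffeo ⊤ (F 1) := hgood (HalfLine.one_mem_goodTimes κ)
  obtain ⟨S, hS⟩ := h.exists_smoothTimes hK hFC
  refine ⟨F 1, hF1, fun m hm x hx => ?_, HalfLine.clockField ξ₀ T (HalfLine.wave s a κ), F,
    h.contDiffOn_clockField hK hflat, HalfLine.clockField_zero, fun x hx => h.clockField_ne hK hx,
    h.isFlowOf_clockFlow hK, fun x _ => rfl, hZ, HalfLine.centralizer_top_eq hZ, S, hS, ?_, ?_, ?_⟩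
  · refine HalfLine.abs_iteratedDerivWithin_le (hF1.2.sub hf₀.2) hgs (fun x hx => ?_) hx
    have h1 := hle (T x) m hm
    rw [h.right_inv x hx] at h1
    rw [HalfLine.iteratedDerivWithin_eq_of_pos m hx, HalfLine.iteratedDeriv_congr_Ioi
      (g := fun y => F 1 y - HalfLine.timeConj X T (fun t => t + 1) y)
      (fun y hy => by rw [hf₀conj y hy.le]) m hx]
    exact h1
  · intro huniv
    have h1 : (1 / 2 : ℝ) ∈ (S : Set ℝ) := by
      rw [huniv]
      exact mem_univ _
    rw [hS] at h1
    exact h.clockFlow_half_not_smooth hflat hp hη1 hw ha haN hK h1.2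
  · exact HalfLine.dense_of_goodTimes hp.strictMono (hS ▸ hgood)
  · exact fun hcount => HalfLine.goodTimes_not_countable hp.strictMono
      (hcount.mono (hS ▸ hgood))
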